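/- Suppose u satisfies NLS on the half-line with the boundary condition iu_t - 2u_x√(4b² - |u|²) - 4(a² + b²)u + 2u|u|² = 0 at x = 0 and Schwartz decay as x → +∞. Then I₃ = (i/4)∫₀^∞ (|u|⁴ - |u_x|²) dx + [(i/6)|u(0,t)|² - i(a² - b²/3)]·√(4b² - |u(0,t)|²) is conserved: dI₃/dt = 0. -/

import Mathlib

namespace HL
open MeasureTheory Filter Set Topology

lemma int_mul {α : Type*} [MeasurableSpace α] {μ : Measure α} {f g : α → ℝ}
    (hf : AEStronglyMeasurable f μ) (hg : AEStronglyMeasurable g μ)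
    (hf2 : Integrable (fun x => f x ^ 2) μ) (hg2 : Integrable (fun x => g x ^ 2) μ) :
    Integrable (fun x => f x * g x) μ := by
  refine Integrable.mono' (hf2.add hg2) (hf.mul hg) (ae_of_all _ fun x => ?_)
  simp only [Pi.add_apply, Real.norm_eq_abs, abs_mul]
  nlinarith [sq_nonneg (|f x| - |g x|), sq_abs (f x), sq_abs (g x), abs_nonneg (f x), abs_nonneg (g x),
    mul_nonneg (abs_nonneg (f x)) (abs_nonneg (g x))]

lemma int_sq_sub {α : Type*} [MeasurableSpace α] {μ : Measure α} {f g : α → ℝ}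
    (hf : AEStronglyMeasurable f μ) (hg : AEStronglyMeasurable g μ)
    (hf2 : Integrable (fun x => f x ^ 2) μ) (hg2 : Integrable (fun x => g x ^ 2) μ) :
    Integrable (fun x => (f x - g x) ^ 2) μ := by
  have := ((hf2.add hg2).sub ((int_mul hf hg hf2 hg2).const_mul 2))
  refine this.congr (ae_of_all _ fun x => ?_)
  simp only [Pi.add_apply, Pi.sub_apply]; ring

/-- weak convergence from pointwise convergence and boundedness in `L²` -/
lemma wc {α ι : Type*} [MeasurableSpace α] {μ : Measure α} {l : Filter ι} [l.IsCountablyGenerated]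
    {g d0 : α → ℝ} {d : ι → α → ℝ} {D : ℝ}
    (hg : AEStronglyMeasurable g μ) (hg2 : Integrable (fun x => g x ^ 2) μ)
    (hd0 : AEStronglyMeasurable d0 μ) (hd02 : Integrable (fun x => d0 x ^ 2) μ)
    (hd : ∀ᶠ i in l, AEStronglyMeasurable (d i) μ)
    (hd2 : ∀ᶠ i in l, Integrable (fun x => d i x ^ 2) μ ∧ ∫ x, d i x ^ 2 ∂μ ≤ D)
    (hlim : ∀ᵐ x ∂μ, Tendsto (fun i => d i x) l (𝓝 (d0 x))) :
    Tendsto (fun i => ∫ x, g x * d i x ∂μ) l (𝓝 (∫ x, g x * d0 x ∂μ)) := by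
  rw [Metric.tendsto_nhds]
  intro ε hε
  set D1 : ℝ := 2 * |D| + 2 * ∫ x, d0 x ^ 2 ∂μ with hD1
  have hD1n : 0 ≤ D1 := by
    have : 0 ≤ ∫ x, d0 x ^ 2 ∂μ := integral_nonneg fun x => sq_nonneg _
    positivity
  obtain ⟨Λ, hΛ, hΛ2⟩ : ∃ Λ : ℝ, 0 < Λ ∧ D1 / Λ < ε / 2 := by
    refine ⟨2 * (D1 + 1) / ε, by positivity, ?_⟩
    rw [div_lt_iff₀ (by positivity)]
    field_simp; linarith
  have hm : Tendsto (fun i => ∫ x, min (|g x * (d i x - d0 x)|) (Λ * g x ^ 2) ∂μ) l (𝓝 (∫ _x, (0:ℝ) ∂μ)) := by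
    refine tendsto_integral_filter_of_dominated_convergence (fun x => Λ * g x ^ 2) ?_ ?_ (hg2.const_mul Λ) ?_
    · filter_upwards [hd] with i hi
      have h1 : AEStronglyMeasurable (fun x => |g x * (d i x - d0 x)|) μ := by
        simpa [Real.norm_eq_abs] using (hg.mul (hi.sub hd0)).norm
      exact h1.inf ((hg2.const_mul Λ).aestronglyMeasurable)
    · refine Eventually.of_forall fun i => ae_of_all _ fun x => ?_
      rw [Real.norm_eq_abs, abs_of_nonneg (le_min (abs_nonneg _) (by positivity))]
      exact min_le_right _ _
    · filter_upwards [hlim] with x hx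
      have h1 : Tendsto (fun i => |g x * (d i x - d0 x)|) l (𝓝 0) := by
        have : Tendsto (fun i => |g x * (d i x - d0 x)|) l (𝓝 (|g x * (d0 x - d0 x)|)) :=
          ((hx.sub_const _).const_mul _).abs
        simpa using this
      have h2 := h1.min (tendsto_const_nhds (x := Λ * g x ^ 2))
      rwa [min_eq_left (by positivity)] at h2
  rw [integral_zero, Metric.tendsto_nhds] at hm
  filter_upwards [hm (ε / 2) (by positivity), hd, hd2] with i hi hdi hdi2
  have hgd := int_mul hg hdi hg2 hdi2.1
  have hgd0 := int_mul hg hd0 hg2 hd02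
  have he2 := int_sq_sub hdi hd0 hdi2.1 hd02
  have hge := int_mul hg (hdi.sub hd0) hg2 he2
  simp only [Pi.sub_apply] at hge
  rw [Real.dist_eq, ← integral_sub hgd hgd0]
  have hmin : Integrable (fun x => min (|g x * (d i x - d0 x)|) (Λ * g x ^ 2)) μ :=
    hge.abs.inf (hg2.const_mul Λ)
  have hE : ∫ x, (d i x - d0 x) ^ 2 ∂μ ≤ D1 := by
    have : ∫ x, (d i x - d0 x) ^ 2 ∂μ ≤ ∫ x, (2 * d i x ^ 2 + 2 * d0 x ^ 2) ∂μ := by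
      refine integral_mono he2 ((hdi2.1.const_mul 2).add (hd02.const_mul 2)) fun x => ?_
      simp only []
      nlinarith [sq_nonneg (d i x + d0 x)]
    rw [integral_add (hdi2.1.const_mul 2) (hd02.const_mul 2), integral_const_mul, integral_const_mul] at this
    have := le_abs_self D
    have := hdi2.2
    linarith
  have hmi : ∫ x, min (|g x * (d i x - d0 x)|) (Λ * g x ^ 2) ∂μ < ε / 2 := by
    rw [Real.dist_eq, sub_zero] at hi
    exact (le_abs_self _).trans_lt hi
  calc |∫ x, (g x * d i x - g x * d0 x) ∂μ| ≤ ∫ x, |g x * d i x - g x * d0 x| ∂μ := abs_integral_le_integral_abs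
    _ ≤ ∫ x, (min (|g x * (d i x - d0 x)|) (Λ * g x ^ 2) + (1 / Λ) * (d i x - d0 x) ^ 2) ∂μ := by
        refine integral_mono (hgd.sub hgd0).abs (hmin.add (he2.const_mul _)) fun x => ?_
        simp only []
        rw [← mul_sub]
        rcases le_total (|g x * (d i x - d0 x)|) (Λ * g x ^ 2) with h | h
        · rw [min_eq_left h]; have : 0 ≤ 1 / Λ * (d i x - d0 x) ^ 2 := by positivity
          linarith
        · rw [min_eq_right h]
          set e := d i x - d0 x
          rw [abs_mul]
          have : Λ * (|g x| * |e|) ≤ Λ * (Λ * g x ^ 2) + e ^ 2 := by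
            rw [← sq_abs (g x), ← sq_abs e]
            nlinarith [sq_nonneg (Λ * |g x| - |e|), sq_nonneg (Λ * |g x|), sq_nonneg |e|]
          have h3 : |g x| * |e| = (1 / Λ) * (Λ * (|g x| * |e|)) := by field_simp
          rw [h3]
          calc _ ≤ (1 / Λ) * (Λ * (Λ * g x ^ 2) + e ^ 2) := by gcongr
            _ = _ := by field_simp
    _ = ∫ x, min (|g x * (d i x - d0 x)|) (Λ * g x ^ 2) ∂μ + (1 / Λ) * ∫ x, (d i x - d0 x) ^ 2 ∂μ := by
        rw [integral_add hmin (he2.const_mul _), integral_const_mul]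
    _ ≤ ∫ x, min (|g x * (d i x - d0 x)|) (Λ * g x ^ 2) ∂μ + D1 / Λ := by
        have : (1 / Λ) * ∫ x, (d i x - d0 x) ^ 2 ∂μ ≤ (1 / Λ) * D1 := by gcongr
        have h4 : (1 / Λ) * D1 = D1 / Λ := by ring
        linarith
    _ < ε := by linarith

/-- linear functionals of an `L²`-Lipschitz family -/
lemma lin_der {α : Type*} [MeasurableSpace α] {μ : Measure α} {I : Set ℝ} {t D : ℝ}
    {f : α → ℝ → ℝ} {ft g : α → ℝ}
    (hfm : ∀ τ, AEStronglyMeasurable (fun x => f x τ) μ) (hft : AEStronglyMeasurable ft μ)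
    (hft2 : Integrable (fun x => ft x ^ 2) μ)
    (hder : ∀ x, HasDerivAt (fun τ => f x τ) (ft x) t)
    (hlip : ∀ τ ∈ I, Integrable (fun x => (f x τ - f x t) ^ 2) μ ∧
      ∫ x, (f x τ - f x t) ^ 2 ∂μ ≤ D * (τ - t) ^ 2)
    (hg : AEStronglyMeasurable g μ) (hg2 : Integrable (fun x => g x ^ 2) μ) :
    HasDerivWithinAt (fun τ => ∫ x, g x * (f x τ - f x t) ∂μ) (∫ x, g x * ft x ∂μ) I t := by
  rw [hasDerivWithinAt_iff_tendsto_slope]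
  have key := wc (l := 𝓝[I \ {t}] t) (d := fun τ x => (τ - t)⁻¹ * (f x τ - f x t)) (D := D) hg hg2 hft hft2
    (Eventually.of_forall fun τ => ((hfm τ).sub (hfm t)).const_mul _) ?_ ?_
  · refine key.congr' ?_
    filter_upwards [self_mem_nhdsWithin] with τ hτ
    rw [slope_def_field]
    simp only [sub_self, mul_zero, integral_zero, sub_zero]
    rw [div_eq_inv_mul, ← integral_const_mul]
    congr 1; ext x; ring
  · filter_upwards [self_mem_nhdsWithin] with τ hτ
    have hne : τ - t ≠ 0 := sub_ne_zero.mpr hτ.2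
    obtain ⟨h1, h2⟩ := hlip τ hτ.1
    have : (fun x => ((τ - t)⁻¹ * (f x τ - f x t)) ^ 2) = fun x => ((τ - t)⁻¹) ^ 2 * (f x τ - f x t) ^ 2 := by
      ext x; ring
    rw [this]
    refine ⟨h1.const_mul _, ?_⟩
    rw [integral_const_mul]
    calc _ ≤ ((τ - t)⁻¹) ^ 2 * (D * (τ - t) ^ 2) := by gcongr
      _ = D := by field_simp
  · refine ae_of_all _ fun x => ?_
    have := (hasDerivAt_iff_tendsto_slope.mp (hder x)).mono_left
      (nhdsWithin_mono t (show I \ {t} ⊆ {t}ᶜ from fun y hy => hy.2))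
    refine this.congr fun τ => ?_
    rw [slope_def_field, div_eq_inv_mul]

lemma sq_der {α : Type*} [MeasurableSpace α] {μ : Measure α} {I : Set ℝ} {t D M : ℝ}
    {f : α → ℝ → ℝ} {ft W : α → ℝ}
    (hfm : ∀ τ, AEStronglyMeasurable (fun x => f x τ) μ) (hft : AEStronglyMeasurable ft μ)
    (hft2 : Integrable (fun x => ft x ^ 2) μ)
    (hder : ∀ x, HasDerivAt (fun τ => f x τ) (ft x) t)
    (hlip : ∀ τ ∈ I, Integrable (fun x => (f x τ - f x t) ^ 2) μ ∧
      ∫ x, (f x τ - f x t) ^ 2 ∂μ ≤ D * (τ - t) ^ 2)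
    (hW : AEStronglyMeasurable W μ) (hM : 0 ≤ M) (hWM : ∀ᵐ x ∂μ, |W x| ≤ M)
    (hW2 : Integrable (fun x => (W x * f x t) ^ 2) μ)
    (hWf : Integrable (fun x => W x * f x t ^ 2) μ) :
    HasDerivWithinAt (fun τ => ∫ x, W x * f x τ ^ 2 ∂μ) (2 * ∫ x, W x * f x t * ft x ∂μ) I t := by
  have h1 := (lin_der hfm hft hft2 hder hlip (hW.mul (hfm t)) hW2).const_mul (2:ℝ)
  have hb : ∀ τ ∈ I, Integrable (fun x => W x * (f x τ - f x t) ^ 2) μ := fun τ hτ =>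
    (hlip τ hτ).1.bdd_mul hW hWM
  have h2 : HasDerivWithinAt (fun τ => ∫ x, W x * (f x τ - f x t) ^ 2 ∂μ) 0 I t := by
    rw [hasDerivWithinAt_iff_tendsto_slope]
    have h0 : Tendsto (fun τ : ℝ => M * D * |τ - t|) (𝓝[I \ {t}] t) (𝓝 0) := by
      have : Continuous fun τ : ℝ => M * D * |τ - t| := by fun_prop
      have := (this.tendsto t).mono_left (nhdsWithin_le_nhds (s := I \ {t}))
      simpa using this
    refine squeeze_zero_norm' ?_ h0
    filter_upwards [self_mem_nhdsWithin] with τ hτ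
    have hne : τ - t ≠ 0 := sub_ne_zero.mpr hτ.2
    obtain ⟨hi, hi2⟩ := hlip τ hτ.1
    rw [slope_def_field]
    simp only [sub_self, ne_eq, OfNat.ofNat_ne_zero, not_false_eq_true, zero_pow, mul_zero, integral_zero, sub_zero]
    rw [Real.norm_eq_abs, abs_div, div_le_iff₀ (abs_pos.mpr hne)]
    calc |∫ x, W x * (f x τ - f x t) ^ 2 ∂μ| ≤ ∫ x, |W x * (f x τ - f x t) ^ 2| ∂μ := abs_integral_le_integral_abs
      _ ≤ ∫ x, M * (f x τ - f x t) ^ 2 ∂μ := by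
          refine integral_mono_ae (hb τ hτ.1).abs (hi.const_mul M) ?_
          filter_upwards [hWM] with x hx
          simp only [abs_mul, abs_pow, sq_abs]
          exact mul_le_mul_of_nonneg_right hx (sq_nonneg _)
      _ = M * ∫ x, (f x τ - f x t) ^ 2 ∂μ := integral_const_mul _ _
      _ ≤ M * (D * (τ - t) ^ 2) := by
          exact mul_le_mul_of_nonneg_left hi2 hM
      _ = M * D * |τ - t| * |τ - t| := by rw [mul_assoc, abs_mul_abs_self]; ring
  have h3 := (h1.add h2).const_add (∫ x, W x * f x t ^ 2 ∂μ)
  simp only [add_zero] at h3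
  refine h3.congr (fun τ hτ => ?_) ?_ |>.congr_deriv ?_
  · have e1 := int_mul (hW.mul (hfm t)) ((hfm τ).sub (hfm t)) hW2 (hlip τ hτ).1
    simp only [Pi.mul_apply, Pi.sub_apply, Pi.add_apply] at e1 ⊢
    have e2 : Integrable (fun x => 2 * (W x * f x t * (f x τ - f x t)) + W x * (f x τ - f x t) ^ 2) μ :=
      (e1.const_mul 2).add (hb τ hτ)
    rw [← integral_const_mul, ← integral_add (e1.const_mul 2) (hb τ hτ), ← integral_add hWf e2]
    congr 1; ext x; ring
  · simp
  · simp

end HL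

namespace HL
open MeasureTheory Filter Set Topology

lemma l2_of_lint {α : Type*} [MeasurableSpace α] {μ : Measure α} {f : α → ℝ} {D : ℝ}
    (hf : AEStronglyMeasurable f μ) (hD : 0 ≤ D)
    (h : ∫⁻ x, ENNReal.ofReal (f x ^ 2) ∂μ ≤ ENNReal.ofReal D) :
    Integrable (fun x => f x ^ 2) μ ∧ ∫ x, f x ^ 2 ∂μ ≤ D := by
  have hi : Integrable (fun x => f x ^ 2) μ := by
    refine ⟨hf.pow 2, ?_⟩
    rw [hasFiniteIntegral_iff_ofReal (ae_of_all _ fun x => sq_nonneg _)]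
    exact h.trans_lt ENNReal.ofReal_lt_top
  refine ⟨hi, ?_⟩
  rw [← ofReal_integral_eq_lintegral_ofReal hi (ae_of_all _ fun x => sq_nonneg _)] at h
  exact (ENNReal.ofReal_le_ofReal_iff hD).mp h

lemma lint_of_l2 {α : Type*} [MeasurableSpace α] {μ : Measure α} {f : α → ℝ} {D : ℝ}
    (hi : Integrable f μ) (h0 : ∀ x, 0 ≤ f x) (h : ∫ x, f x ∂μ ≤ D) :
    ∫⁻ x, ENNReal.ofReal (f x) ∂μ ≤ ENNReal.ofReal D := by
  rw [← ofReal_integral_eq_lintegral_ofReal hi (ae_of_all _ h0)]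
  exact ENNReal.ofReal_le_ofReal h

lemma meas_der {f f' : ℝ → ℝ} (h : ∀ x, HasDerivAt f (f' x) x) : Measurable f' := by
  have : f' = deriv f := by ext x; exact (h x).deriv.symm
  rw [this]; exact measurable_deriv f

lemma cont_der {f f' : ℝ → ℝ} (h : ∀ x, HasDerivAt f (f' x) x) : Continuous f :=
  continuous_iff_continuousAt.mpr fun x => (h x).continuousAt

lemma cs1 {f f' : ℝ → ℝ} (h : ∀ x, HasDerivAt f (f' x) x) {a b : ℝ} (hab : a ≤ b) :
    ENNReal.ofReal ((f b - f a) ^ 2) ≤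
      ENNReal.ofReal (b - a) * ∫⁻ x in Ioc a b, ENNReal.ofReal (f' x ^ 2) := by
  rcases eq_or_lt_of_le hab with rfl | hab'
  · simp
  by_cases htop : ∫⁻ x in Ioc a b, ENNReal.ofReal (f' x ^ 2) = ⊤
  · rw [htop, ENNReal.mul_top]
    · exact le_top
    · simpa using hab'
  have hm := meas_der h
  have hi2 : IntegrableOn (fun x => f' x ^ 2) (Ioc a b) := by
    refine ⟨(hm.pow_const 2).aestronglyMeasurable, ?_⟩
    rw [hasFiniteIntegral_iff_ofReal (ae_of_all _ fun x => sq_nonneg _)]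
    exact lt_top_iff_ne_top.mpr htop
  have hc : ∀ c : ℝ, IntegrableOn (fun _ : ℝ => c) (Ioc a b) := fun c => by
    exact integrableOn_const (by simp)
  have hi : IntegrableOn f' (Ioc a b) := by
    refine Integrable.mono' (hi2.add (hc 1)) hm.aestronglyMeasurable (ae_of_all _ fun x => ?_)
    simp only [Pi.add_apply, Real.norm_eq_abs]
    nlinarith [sq_nonneg (|f' x| - 1), sq_abs (f' x), abs_nonneg (f' x)]
  have ftc : ∫ x in Ioc a b, f' x = f b - f a := by
    rw [← intervalIntegral.integral_of_le hab]
    refine intervalIntegral.integral_eq_sub_of_hasDerivAt (fun x _ => h x) ?_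
    rwa [intervalIntegrable_iff_integrableOn_Ioc_of_le hab]
  rw [← ofReal_integral_eq_lintegral_ofReal hi2 (ae_of_all _ fun x => sq_nonneg _),
    ← ENNReal.ofReal_mul (by linarith)]
  refine ENNReal.ofReal_le_ofReal ?_
  set m := (f b - f a) / (b - a) with hmm
  have h0 : 0 ≤ ∫ x in Ioc a b, (f' x - m) ^ 2 := integral_nonneg fun x => sq_nonneg _
  have h1 : ∫ x in Ioc a b, (f' x - m) ^ 2 = (∫ x in Ioc a b, f' x ^ 2) - 2 * m * (f b - f a) + m ^ 2 * (b - a) := by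
    have : (fun x => (f' x - m) ^ 2) = fun x => f' x ^ 2 - 2 * m * f' x + m ^ 2 := by ext x; ring
    have e1 : IntegrableOn (fun x => f' x ^ 2 - 2 * m * f' x) (Ioc a b) := hi2.sub (hi.const_mul _)
    rw [this, integral_add e1 (hc _), integral_sub hi2 (hi.const_mul _), integral_const_mul, ftc]
    simp [hab, mul_comm]
  rw [h1] at h0
  have hpos : 0 < b - a := by linarith
  have h2 : m * (b - a) = f b - f a := by rw [hmm]; field_simp
  rw [← h2] at h0 ⊢
  nlinarith

lemma lipL2 {F Ft : ℝ → ℝ → ℝ} (hF : ∀ x t, HasDerivAt (F x) (Ft x t) t)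
    (hc : ∀ t, Continuous fun x => F x t) {t1 t2 : ℝ} (h12 : t1 ≤ t2) {D : ENNReal}
    (hD : ∀ τ ∈ Ioc t1 t2, ∫⁻ x in Ioi (0:ℝ), ENNReal.ofReal (Ft x τ ^ 2) ≤ D) :
    ∫⁻ x in Ioi (0:ℝ), ENNReal.ofReal ((F x t2 - F x t1) ^ 2) ≤ ENNReal.ofReal ((t2 - t1) ^ 2) * D := by
  have hmF : Measurable (Function.uncurry F) := by
    have := measurable_uncurry_of_continuous_of_measurable (u := fun x t => F x t) 
      (fun t => hc t) (fun x => (cont_der (hF x)).measurable)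
    exact this
  have hmFt : Measurable (Function.uncurry Ft) := by
    have hs : ∀ n : ℕ, Measurable (fun z : ℝ × ℝ => ((n:ℝ) + 1) * (F z.1 (z.2 + 1 / ((n:ℝ) + 1)) - F z.1 z.2)) := by
      intro n
      refine Measurable.const_mul ?_ _
      refine Measurable.sub ?_ hmF
      exact hmF.comp (measurable_fst.prodMk (measurable_snd.add_const _))
    refine measurable_of_tendsto_metrizable hs ?_
    rw [tendsto_pi_nhds]
    rintro ⟨x, t⟩
    have h1 := (hasDerivAt_iff_tendsto_slope.mp (hF x t))
    have h2 : Tendsto (fun n : ℕ => t + 1 / ((n:ℝ) + 1)) atTop (𝓝[≠] t) := by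
      rw [tendsto_nhdsWithin_iff]
      constructor
      · simpa using (tendsto_one_div_add_atTop_nhds_zero_nat (𝕜 := ℝ)).const_add t
      · refine Eventually.of_forall fun n => ?_
        simp only [mem_compl_iff, mem_singleton_iff]
        have : (0:ℝ) < 1 / ((n:ℝ) + 1) := by positivity
        linarith
    refine (h1.comp h2).congr fun n => ?_
    simp only [Function.comp, slope_def_field]
    have : ((n:ℝ) + 1) ≠ 0 := by positivity
    field_simp
    ring
  calc ∫⁻ x in Ioi (0:ℝ), ENNReal.ofReal ((F x t2 - F x t1) ^ 2)
      ≤ ∫⁻ x in Ioi (0:ℝ), ENNReal.ofReal (t2 - t1) * ∫⁻ τ in Ioc t1 t2, ENNReal.ofReal (Ft x τ ^ 2) := by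
        exact lintegral_mono fun x => cs1 (hF x) h12
    _ = ENNReal.ofReal (t2 - t1) * ∫⁻ x in Ioi (0:ℝ), ∫⁻ τ in Ioc t1 t2, ENNReal.ofReal (Ft x τ ^ 2) := by
        rw [lintegral_const_mul']; exact ENNReal.ofReal_ne_top
    _ = ENNReal.ofReal (t2 - t1) * ∫⁻ τ in Ioc t1 t2, ∫⁻ x in Ioi (0:ℝ), ENNReal.ofReal (Ft x τ ^ 2) := by
        rw [lintegral_lintegral_swap]
        exact ((hmFt.pow_const 2).ennreal_ofReal).aemeasurable
    _ ≤ ENNReal.ofReal (t2 - t1) * ∫⁻ τ in Ioc t1 t2, D := by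
        exact mul_le_mul' le_rfl (setLIntegral_mono measurable_const hD)
    _ = _ := by
        rw [lintegral_const, Measure.restrict_apply_univ, Real.volume_Ioc, sq, ENNReal.ofReal_mul (by linarith)]
        ring

/-- translation estimate -/
lemma transL2 {f f' : ℝ → ℝ} (h : ∀ x, HasDerivAt f (f' x) x) {D : ENNReal}
    (hD : ∫⁻ x in Ioi (0:ℝ), ENNReal.ofReal (f' x ^ 2) ≤ D) {δ : ℝ} (hδ : 0 ≤ δ) :
    ∫⁻ x in Ioi (0:ℝ), ENNReal.ofReal ((f (x + δ) - f x) ^ 2) ≤ ENNReal.ofReal (δ ^ 2) * D := by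
  have := lipL2 (F := fun x t => f (x + t)) (Ft := fun x t => f' (x + t))
    (fun x t => by simpa using (h (x + t)).comp_const_add x t)
    (fun t => (cont_der h).comp (continuous_id.add continuous_const)) hδ (D := D) ?_
  · simpa using this
  · intro τ hτ
    have e : ∫⁻ x in Ioi (0:ℝ), ENNReal.ofReal (f' (x + τ) ^ 2) = ∫⁻ x in Ioi τ, ENNReal.ofReal (f' x ^ 2) := by
      have h1 := (measurePreserving_add_right (volume : Measure ℝ) τ).setLIntegral_comp_preimage_emb
        (measurableEmbedding_addRight τ) (fun x => ENNReal.ofReal (f' x ^ 2)) (Ioi τ)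
      rw [← h1]
      congr 2
      ext x; simp
    rw [e]
    refine le_trans ?_ hD
    exact lintegral_mono_set (Ioi_subset_Ioi hτ.1.le)

/-- Fatou -/
lemma fatou_sq {f : ℕ → ℝ → ℝ} {f0 : ℝ → ℝ} {D : ENNReal} (hm : ∀ k, Measurable (f k))
    (h : ∀ x, 0 < x → Tendsto (fun k => f k x) atTop (𝓝 (f0 x)))
    (hD : ∀ k, ∫⁻ x in Ioi (0:ℝ), ENNReal.ofReal (f k x ^ 2) ≤ D) :
    ∫⁻ x in Ioi (0:ℝ), ENNReal.ofReal (f0 x ^ 2) ≤ D := by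
  calc ∫⁻ x in Ioi (0:ℝ), ENNReal.ofReal (f0 x ^ 2)
      = ∫⁻ x in Ioi (0:ℝ), liminf (fun k => ENNReal.ofReal (f k x ^ 2)) atTop := by
        refine setLIntegral_congr_fun measurableSet_Ioi fun x hx => ?_
        exact (ENNReal.tendsto_ofReal ((h x hx).pow 2)).liminf_eq.symm
    _ ≤ liminf (fun k => ∫⁻ x in Ioi (0:ℝ), ENNReal.ofReal (f k x ^ 2)) atTop :=
        lintegral_liminf_le fun k => ((hm k).pow_const 2).ennreal_ofReal
    _ ≤ D := by
        refine liminf_le_of_frequently_le' (Frequently.of_forall hD)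

lemma lscL2 {f f' : ℕ → ℝ → ℝ} {f0 f0' : ℝ → ℝ} {D : ENNReal}
    (hf : ∀ k x, HasDerivAt (f k) (f' k x) x) (hf0 : ∀ x, HasDerivAt f0 (f0' x) x)
    (h : ∀ x, 0 < x → Tendsto (fun k => f k x) atTop (𝓝 (f0 x)))
    (hD : ∀ k, ∫⁻ x in Ioi (0:ℝ), ENNReal.ofReal (f' k x ^ 2) ≤ D) :
    ∫⁻ x in Ioi (0:ℝ), ENNReal.ofReal (f0' x ^ 2) ≤ D := by
  have h1 : ∀ δ : ℝ, 0 < δ → ∫⁻ x in Ioi (0:ℝ), ENNReal.ofReal ((f0 (x + δ) - f0 x) ^ 2) ≤ ENNReal.ofReal (δ ^ 2) * D := by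
    intro δ hδ
    refine fatou_sq (f := fun k x => f k (x + δ) - f k x) (fun k => ?_) (fun x hx => ?_) (fun k => ?_)
    · have := cont_der (hf k)
      exact Continuous.measurable (by fun_prop)
    · exact (h _ (by linarith)).sub (h x hx)
    · exact transL2 (hf k) (hD k) hδ.le
  refine fatou_sq (f := fun k x => ((k:ℝ) + 1) * (f0 (x + 1 / ((k:ℝ) + 1)) - f0 x)) (fun k => ?_) (fun x hx => ?_) (fun k => ?_)
  · have := cont_der hf0
    exact Continuous.measurable (by fun_prop)
  · have h1 := (hasDerivAt_iff_tendsto_slope.mp (hf0 x))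
    have h2 : Tendsto (fun n : ℕ => x + 1 / ((n:ℝ) + 1)) atTop (𝓝[≠] x) := by
      rw [tendsto_nhdsWithin_iff]
      constructor
      · simpa using (tendsto_one_div_add_atTop_nhds_zero_nat (𝕜 := ℝ)).const_add x
      · refine Eventually.of_forall fun n => ?_
        simp only [mem_compl_iff, mem_singleton_iff]
        have : (0:ℝ) < 1 / ((n:ℝ) + 1) := by positivity
        linarith
    refine (h1.comp h2).congr fun n => ?_
    simp only [Function.comp, slope_def_field]
    have : ((n:ℝ) + 1) ≠ 0 := by positivity
    field_simp
    ring
  · have hp : (0:ℝ) < (k:ℝ) + 1 := by positivity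
    have h3 := h1 (1 / ((k:ℝ) + 1)) (by positivity)
    calc _ = ENNReal.ofReal (((k:ℝ) + 1) ^ 2) * ∫⁻ x in Ioi (0:ℝ), ENNReal.ofReal ((f0 (x + 1 / ((k:ℝ) + 1)) - f0 x) ^ 2) := by
          rw [← lintegral_const_mul' _ _ ENNReal.ofReal_ne_top]
          congr 1; ext x
          rw [← ENNReal.ofReal_mul (by positivity)]; congr 1; ring
      _ ≤ ENNReal.ofReal (((k:ℝ) + 1) ^ 2) * (ENNReal.ofReal ((1 / ((k:ℝ) + 1)) ^ 2) * D) := by gcongr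
      _ = D := by
          rw [← mul_assoc, ← ENNReal.ofReal_mul (by positivity)]
          have : ((k:ℝ) + 1) ^ 2 * (1 / ((k:ℝ) + 1)) ^ 2 = 1 := by field_simp
          rw [this]; simp

end HL

namespace HL
open MeasureTheory Filter Set Topology

lemma exp_int {L x0 : ℝ} (hL : 0 < L) : IntegrableOn (fun y => Real.exp (-(y - x0) / L)) (Ioi x0) ∧
    ∫ y in Ioi x0, Real.exp (-(y - x0) / L) = L := by
  have hd : ∀ y ∈ Ici x0, HasDerivAt (fun y => -L * Real.exp (-(y - x0) / L)) (Real.exp (-(y - x0) / L)) y := by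
    intro y _
    have h1 : HasDerivAt (fun y => -(y - x0) / L) (-1 / L) y := (((hasDerivAt_id y).sub_const x0).neg).div_const L
    refine (h1.exp.const_mul (-L)).congr_deriv ?_
    field_simp
  have ht : Tendsto (fun y => -L * Real.exp (-(y - x0) / L)) atTop (𝓝 0) := by
    have : Tendsto (fun y => Real.exp (-(y - x0) / L)) atTop (𝓝 0) := by
      refine Real.tendsto_exp_atBot.comp ?_
      have : Tendsto (fun y => ((y - x0) / L)) atTop atTop :=
        (tendsto_atTop_add_const_right atTop (-x0) tendsto_id).atTop_div_const hL
      refine (tendsto_neg_atTop_atBot.comp this).congr fun y => ?_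
      simp only [Function.comp]; ring
    simpa using this.const_mul (-L)
  have hi := integrableOn_Ioi_deriv_of_nonneg' hd (fun y _ => (Real.exp_pos _).le) ht
  refine ⟨hi, ?_⟩
  rw [integral_Ioi_of_hasDerivAt_of_tendsto' hd hi ht]
  simp

/-- pointwise bound through an exponential kernel -/
lemma expb {f f' G : ℝ → ℝ} (hf : ∀ x, HasDerivAt f (f' x) x) {L c B x0 : ℝ} (hL : 0 < L) 
    (hx0 : 0 ≤ x0) (hB : ∀ y, x0 ≤ y → |f y| ≤ B) (hG : IntegrableOn G (Ioi 0)) (hG0 : ∀ y, 0 ≤ G y)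
    (hb : ∀ y, x0 ≤ y → |f y| / L + |f' y| ≤ c + G y) : f x0 ≤ c * L + ∫ y in Ioi (0:ℝ), G y := by
  obtain ⟨he, heL⟩ := exp_int (x0 := x0) hL
  set e : ℝ → ℝ := fun y => Real.exp (-(y - x0) / L) with hedef
  have he1 : ∀ y, HasDerivAt e (-1 / L * e y) y := by
    intro y
    have h1 : HasDerivAt (fun y => -(y - x0) / L) (-1 / L) y := (((hasDerivAt_id y).sub_const x0).neg).div_const L
    refine h1.exp.congr_deriv ?_
    simp only [hedef]; ring
  have hepos : ∀ y, 0 < e y := fun y => Real.exp_pos _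
  have hele : ∀ y, x0 ≤ y → e y ≤ 1 := fun y hy => by
    refine Real.exp_le_one_iff.mpr ?_
    rw [neg_div]; have : 0 ≤ (y - x0) / L := div_nonneg (by linarith) hL.le
    linarith
  have hte : Tendsto e atTop (𝓝 0) := by
    refine Real.tendsto_exp_atBot.comp ?_
    have : Tendsto (fun y => ((y - x0) / L)) atTop atTop :=
      (tendsto_atTop_add_const_right atTop (-x0) tendsto_id).atTop_div_const hL
    refine (tendsto_neg_atTop_atBot.comp this).congr fun y => ?_
    simp only [Function.comp]; ring
  have hd : ∀ y ∈ Ici x0, HasDerivAt (fun y => e y * f y) (-1 / L * e y * f y + e y * f' y) y :=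
    fun y _ => (he1 y).mul (hf y)
  have hGx : IntegrableOn G (Ioi x0) := hG.mono_set (Ioi_subset_Ioi hx0)
  have hdom : IntegrableOn (fun y => c * e y + G y) (Ioi x0) := (he.const_mul c).add hGx
  have hbd : ∀ y, x0 ≤ y → |-1 / L * e y * f y + e y * f' y| ≤ c * e y + G y := by
    intro y hy
    have h1 : |-1 / L * e y * f y + e y * f' y| ≤ e y * (|f y| / L + |f' y|) := by
      have : -1 / L * e y * f y + e y * f' y = e y * (f' y - f y / L) := by ring
      rw [this, abs_mul, abs_of_pos (hepos y)]
      refine mul_le_mul_of_nonneg_left ?_ (hepos y).le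
      have h2 := abs_sub (f' y) (f y / L)
      rw [abs_div, abs_of_pos hL] at h2
      linarith
    have h2 : e y * (|f y| / L + |f' y|) ≤ e y * (c + G y) := mul_le_mul_of_nonneg_left (hb y hy) (hepos y).le
    have h3 : e y * G y ≤ G y := by nlinarith [hele y hy, hG0 y]
    linarith
  have hmeas : AEStronglyMeasurable (fun y => -1 / L * e y * f y + e y * f' y) (volume.restrict (Ioi x0)) := by
    have h1 := (cont_der he1).measurable
    have h2 := (cont_der hf).measurable
    have h3 := meas_der hf
    exact Measurable.aestronglyMeasurable (by fun_prop)
  have hi : IntegrableOn (fun y => -1 / L * e y * f y + e y * f' y) (Ioi x0) := by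
    refine Integrable.mono' hdom hmeas ?_
    filter_upwards [ae_restrict_mem measurableSet_Ioi] with y hy
    exact hbd y (le_of_lt hy)
  have ht : Tendsto (fun y => e y * f y) atTop (𝓝 0) := by
    have h1 : Tendsto (fun y => e y * B) atTop (𝓝 0) := by simpa using hte.mul_const B
    refine squeeze_zero_norm' ?_ h1
    filter_upwards [eventually_ge_atTop x0] with y hy
    rw [Real.norm_eq_abs, abs_mul, abs_of_pos (hepos y)]
    exact mul_le_mul_of_nonneg_left (hB y hy) (hepos y).le
  have ftc := integral_Ioi_of_hasDerivAt_of_tendsto' hd hi ht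
  have e0 : e x0 = 1 := by simp [hedef]
  rw [e0, one_mul, zero_sub] at ftc
  have h5 : f x0 ≤ ∫ y in Ioi x0, (c * e y + G y) := by
    have : |∫ y in Ioi x0, (-1 / L * e y * f y + e y * f' y)| ≤ ∫ y in Ioi x0, (c * e y + G y) := by
      refine abs_integral_le_integral_abs.trans ?_
      refine setIntegral_mono_on hi.abs hdom measurableSet_Ioi fun y hy => hbd y (le_of_lt hy)
    rw [ftc, abs_neg] at this
    exact (le_abs_self _).trans this
  rw [integral_add (he.const_mul c) hGx, integral_const_mul, heL] at h5
  have h6 : ∫ y in Ioi x0, G y ≤ ∫ y in Ioi (0:ℝ), G y :=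
    setIntegral_mono_set hG (ae_of_all _ hG0) (Ioi_subset_Ioi hx0).eventuallyLE
  linarith

/-- pointwise bound for functions with square integrable derivative decaying at infinity -/
lemma sqb {f f' : ℝ → ℝ} (hf : ∀ x, HasDerivAt f (f' x) x) (h0 : Tendsto f atTop (𝓝 0))
    (h1 : IntegrableOn (fun x => f x ^ 2) (Ioi 0)) (h2 : IntegrableOn (fun x => f' x ^ 2) (Ioi 0))
    {x0 l : ℝ} (hx0 : 0 ≤ x0) (hl : 0 < l) :
    f x0 ^ 2 ≤ l * (∫ y in Ioi (0:ℝ), f y ^ 2) + (∫ y in Ioi (0:ℝ), f' y ^ 2) / l := by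
  have hd : ∀ y ∈ Ici x0, HasDerivAt (fun y => f y ^ 2) (2 * f y * f' y) y := fun y _ =>
    ((hf y).fun_pow 2).congr_deriv (by simp)
  have hdom : IntegrableOn (fun y => l * f y ^ 2 + f' y ^ 2 / l) (Ioi 0) := (h1.const_mul l).add (h2.div_const l)
  have hbd : ∀ y, |2 * f y * f' y| ≤ l * f y ^ 2 + f' y ^ 2 / l := by
    intro y
    have h3 : |2 * f y * f' y| = 2 * |f y| * |f' y| := by rw [abs_mul, abs_mul]; simp
    rw [h3, ← sq_abs (f y), ← sq_abs (f' y), ← sub_nonneg]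
    have : l * |f y| ^ 2 + |f' y| ^ 2 / l - 2 * |f y| * |f' y| = (l * |f y| - |f' y|) ^ 2 / l := by
      field_simp; ring
    rw [this]; positivity
  have hi : IntegrableOn (fun y => 2 * f y * f' y) (Ioi x0) := by
    have h2 := (cont_der hf).measurable
    have h3 := meas_der hf
    refine Integrable.mono' (hdom.mono_set (Ioi_subset_Ioi hx0)) 
      (Measurable.aestronglyMeasurable (by fun_prop)) (ae_of_all _ hbd)
  have ftc := integral_Ioi_of_hasDerivAt_of_tendsto' hd hi (by simpa using h0.pow 2)
  rw [zero_sub] at ftc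
  have h5 : |∫ y in Ioi x0, 2 * f y * f' y| ≤ ∫ y in Ioi (0:ℝ), (l * f y ^ 2 + f' y ^ 2 / l) := by
    refine abs_integral_le_integral_abs.trans ?_
    refine (integral_mono hi.abs (hdom.mono_set (Ioi_subset_Ioi hx0)) hbd).trans ?_
    exact setIntegral_mono_set hdom (ae_of_all _ fun y => by positivity) (Ioi_subset_Ioi hx0).eventuallyLE
  rw [ftc, abs_neg, abs_of_nonneg (by positivity), integral_add (h1.const_mul l) (h2.div_const l),
    integral_const_mul, integral_div] at h5
  exact h5

/-- integration by parts on the half line -/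
lemma ibp {f f' g g' : ℝ → ℝ} (hf : ∀ x, HasDerivAt f (f' x) x) (hg : ∀ x, HasDerivAt g (g' x) x)
    (h1 : IntegrableOn (fun x => f' x * g x) (Ioi 0)) (h2 : IntegrableOn (fun x => f x * g' x) (Ioi 0))
    (h0 : Tendsto (fun x => f x * g x) atTop (𝓝 0)) :
    ∫ x in Ioi (0:ℝ), f x * g' x = - (f 0 * g 0) - ∫ x in Ioi (0:ℝ), f' x * g x := by
  have ftc := integral_Ioi_of_hasDerivAt_of_tendsto' (a := (0:ℝ)) (f := fun x => f x * g x) 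
    (f' := fun x => f' x * g x + f x * g' x) (fun y _ => (hf y).mul (hg y)) (h1.add h2) h0
  rw [integral_add h1 h2] at ftc
  linarith

lemma bddlem {f : ℝ → ℝ} (hf : Continuous f) (h0 : Tendsto f atTop (𝓝 0)) : ∃ B, 0 ≤ B ∧ ∀ y, 0 ≤ y → |f y| ≤ B := by
  have h1 : ∀ᶠ y in atTop, |f y| < 1 := by
    have := h0.abs
    rw [abs_zero] at this
    exact this.eventually_lt_const (by norm_num)
  obtain ⟨R, hR⟩ := eventually_atTop.mp h1
  obtain ⟨B, hB⟩ := (isCompact_Icc (a := (0:ℝ)) (b := R)).exists_bound_of_continuousOn hf.continuousOn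
  refine ⟨max B 1, by positivity, fun y hy => ?_⟩
  rcases le_total y R with h | h
  · exact (hB y ⟨hy, h⟩).trans (le_max_left _ _)
  · exact (hR y h).le.trans (le_max_right _ _)

/-- integrable on the half line with given integral -/
def HI (f : ℝ → ℝ) (v : ℝ) : Prop := IntegrableOn f (Ioi 0) ∧ ∫ x in Ioi (0:ℝ), f x = v

lemma HI.mk' {f : ℝ → ℝ} (h : IntegrableOn f (Ioi 0)) : HI f (∫ x in Ioi (0:ℝ), f x) := ⟨h, rfl⟩
lemma HI.add {f g : ℝ → ℝ} {a b : ℝ} (h : HI f a) (h' : HI g b) : HI (fun x => f x + g x) (a + b) :=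
  ⟨h.1.add h'.1, by rw [integral_add h.1 h'.1, h.2, h'.2]⟩
lemma HI.sub {f g : ℝ → ℝ} {a b : ℝ} (h : HI f a) (h' : HI g b) : HI (fun x => f x - g x) (a - b) :=
  ⟨h.1.sub h'.1, by rw [integral_sub h.1 h'.1, h.2, h'.2]⟩
lemma HI.mul {f : ℝ → ℝ} {a : ℝ} (c : ℝ) (h : HI f a) : HI (fun x => c * f x) (c * a) :=
  ⟨h.1.const_mul c, by rw [integral_const_mul, h.2]⟩
lemma HI.le {f g : ℝ → ℝ} {a b : ℝ} (h : HI f a) (h' : HI g b) (hle : ∀ x, 0 < x → f x ≤ g x) : a ≤ b := by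
  rw [← h.2, ← h'.2]; exact setIntegral_mono_on h.1 h'.1 measurableSet_Ioi hle
lemma HI.eq {f g : ℝ → ℝ} {a b : ℝ} (h : HI f a) (h' : HI g b) (hle : ∀ x, 0 < x → f x = g x) : a = b := 
  le_antisymm (h.le h' fun x hx => (hle x hx).le) (h'.le h fun x hx => (hle x hx).ge)
lemma HI.congr {f g : ℝ → ℝ} {a : ℝ} (h : HI f a) (hle : ∀ x, 0 < x → f x = g x) : HI g a :=
  ⟨h.1.congr_fun hle measurableSet_Ioi, by rw [← h.2]; exact (setIntegral_congr_fun measurableSet_Ioi hle).symm⟩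
lemma HI.nonneg {f : ℝ → ℝ} {a : ℝ} (h : HI f a) (h0 : ∀ x, 0 < x → 0 ≤ f x) : 0 ≤ a := by
  rw [← h.2]; exact setIntegral_nonneg measurableSet_Ioi h0
lemma HI.uniq {f : ℝ → ℝ} {a b : ℝ} (h : HI f a) (h' : HI f b) : a = b := h.2.symm.trans h'.2
lemma HI.dom {f g : ℝ → ℝ} {a : ℝ} (h : HI g a) (hm : AEStronglyMeasurable f (volume.restrict (Ioi 0)))
    (hle : ∀ x, 0 < x → |f x| ≤ g x) : IntegrableOn f (Ioi 0) := by
  refine Integrable.mono' h.1 hm ?_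
  filter_upwards [ae_restrict_mem measurableSet_Ioi] with x hx
  exact hle x hx

end HL

namespace HL
open MeasureTheory Filter Set Topology

structure Sol (a b : ℝ) where
  p : ℝ → ℝ → ℝ
  q : ℝ → ℝ → ℝ
  pt : ℝ → ℝ → ℝ
  qt : ℝ → ℝ → ℝ
  px : ℝ → ℝ → ℝ
  qx : ℝ → ℝ → ℝ
  pxx : ℝ → ℝ → ℝ
  qxx : ℝ → ℝ → ℝ
  hpt : ∀ x t, HasDerivAt (fun s => p x s) (pt x t) t
  hqt : ∀ x t, HasDerivAt (fun s => q x s) (qt x t) t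
  hpx : ∀ t x, HasDerivAt (fun y => p y t) (px x t) x
  hqx : ∀ t x, HasDerivAt (fun y => q y t) (qx x t) x
  hpxx : ∀ t x, HasDerivAt (fun y => px y t) (pxx x t) x
  hqxx : ∀ t x, HasDerivAt (fun y => qx y t) (qxx x t) x
  hb : ∀ t, p 0 t ^ 2 + q 0 t ^ 2 < 4 * b ^ 2
  eq1 : ∀ t x, 0 ≤ x → pt x t = - qxx x t - 2 * (p x t ^ 2 + q x t ^ 2) * q x t
  eq2 : ∀ t x, 0 ≤ x → qt x t = pxx x t + 2 * (p x t ^ 2 + q x t ^ 2) * p x t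
  bc1 : ∀ t, - qt 0 t - 2 * px 0 t * √(4 * b ^ 2 - (p 0 t ^ 2 + q 0 t ^ 2))
    - 4 * (a ^ 2 + b ^ 2) * p 0 t + 2 * p 0 t * (p 0 t ^ 2 + q 0 t ^ 2) = 0
  bc2 : ∀ t, pt 0 t - 2 * qx 0 t * √(4 * b ^ 2 - (p 0 t ^ 2 + q 0 t ^ 2))
    - 4 * (a ^ 2 + b ^ 2) * q 0 t + 2 * q 0 t * (p 0 t ^ 2 + q 0 t ^ 2) = 0
  hi0 : ∀ t, IntegrableOn (fun x => (p x t ^ 2 + q x t ^ 2) ^ 2) (Ioi 0)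
  hi1 : ∀ t, IntegrableOn (fun x => px x t ^ 2 + qx x t ^ 2) (Ioi 0)
  hi2 : ∀ t, IntegrableOn (fun x => pxx x t ^ 2 + qxx x t ^ 2) (Ioi 0)
  dp : ∀ t, Tendsto (fun x => p x t) atTop (𝓝 0)
  dq : ∀ t, Tendsto (fun x => q x t) atTop (𝓝 0)
  dpx : ∀ t, Tendsto (fun x => px x t) atTop (𝓝 0)
  dqx : ∀ t, Tendsto (fun x => qx x t) atTop (𝓝 0)

namespace Sol
variable {a b : ℝ} (S : Sol a b)

/-- squared modulus -/
def n (x t : ℝ) : ℝ := S.p x t ^ 2 + S.q x t ^ 2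
def k (x t : ℝ) : ℝ := S.px x t ^ 2 + S.qx x t ^ 2
noncomputable def Om (t : ℝ) : ℝ := √(4 * b ^ 2 - (S.p 0 t ^ 2 + S.q 0 t ^ 2))
noncomputable def P (t : ℝ) : ℝ := ∫ x in Ioi (0:ℝ), (S.p x t ^ 2 + S.q x t ^ 2) ^ 2
noncomputable def K (t : ℝ) : ℝ := ∫ x in Ioi (0:ℝ), (S.px x t ^ 2 + S.qx x t ^ 2)
noncomputable def V (t : ℝ) : ℝ := ∫ x in Ioi (0:ℝ), (S.pxx x t ^ 2 + S.qxx x t ^ 2)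
noncomputable def T (t : ℝ) : ℝ := ∫ x in Ioi (0:ℝ), (S.pt x t ^ 2 + S.qt x t ^ 2)

/-- time reversal -/
def rev : Sol a b where
  p x t := S.p x (-t)
  q x t := - S.q x (-t)
  pt x t := - S.pt x (-t)
  qt x t := S.qt x (-t)
  px x t := S.px x (-t)
  qx x t := - S.qx x (-t)
  pxx x t := S.pxx x (-t)
  qxx x t := - S.qxx x (-t)
  hpt x t := by
    exact ((S.hpt x (-t)).comp t (hasDerivAt_neg t)).congr_deriv (by simp)
  hqt x t := by
    exact ((S.hqt x (-t)).comp t (hasDerivAt_neg t)).neg.congr_deriv (by simp)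
  hpx t x := S.hpx (-t) x
  hqx t x := (S.hqx (-t) x).neg
  hpxx t x := S.hpxx (-t) x
  hqxx t x := (S.hqxx (-t) x).neg
  hb t := by simpa using S.hb (-t)
  eq1 t x hx := by rw [S.eq1 (-t) x hx]; ring
  eq2 t x hx := by rw [S.eq2 (-t) x hx]; ring
  bc1 t := by have := S.bc1 (-t); simpa using this
  bc2 t := by have := S.bc2 (-t); simp only [neg_sq]; linarith
  hi0 t := by simpa using S.hi0 (-t)
  hi1 t := by simpa using S.hi1 (-t)
  hi2 t := by simpa using S.hi2 (-t)
  dp t := S.dp (-t)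
  dq t := by simpa using (S.dq (-t)).neg
  dpx t := S.dpx (-t)
  dqx t := by simpa using (S.dqx (-t)).neg

lemma rev_P (t : ℝ) : S.rev.P t = S.P (-t) := by simp [P, rev]
lemma rev_K (t : ℝ) : S.rev.K t = S.K (-t) := by simp [K, rev]
lemma rev_V (t : ℝ) : S.rev.V t = S.V (-t) := by simp [V, rev]

lemma cp (t : ℝ) : Continuous fun x => S.p x t := cont_der (S.hpx t)
lemma cq (t : ℝ) : Continuous fun x => S.q x t := cont_der (S.hqx t)
lemma cpx (t : ℝ) : Continuous fun x => S.px x t := cont_der (S.hpxx t)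
lemma cqx (t : ℝ) : Continuous fun x => S.qx x t := cont_der (S.hqxx t)
lemma mpxx (t : ℝ) : Measurable fun x => S.pxx x t := meas_der (S.hpxx t)
lemma mqxx (t : ℝ) : Measurable fun x => S.qxx x t := meas_der (S.hqxx t)
lemma cpt (x : ℝ) : Continuous fun t => S.p x t := cont_der (S.hpt x)
lemma cqt (x : ℝ) : Continuous fun t => S.q x t := cont_der (S.hqt x)

lemma mpt (t : ℝ) : AEStronglyMeasurable (fun x => S.pt x t) (volume.restrict (Ioi 0)) := by
  have h1 := S.mqxx t
  have h2 := (S.cp t).measurable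
  have h3 := (S.cq t).measurable
  have : Measurable fun x => - S.qxx x t - 2 * (S.p x t ^ 2 + S.q x t ^ 2) * S.q x t := by fun_prop
  refine this.aestronglyMeasurable.congr ?_
  filter_upwards [ae_restrict_mem measurableSet_Ioi] with x hx
  exact (S.eq1 t x (le_of_lt hx)).symm

lemma mqt (t : ℝ) : AEStronglyMeasurable (fun x => S.qt x t) (volume.restrict (Ioi 0)) := by
  have h1 := S.mpxx t
  have h2 := (S.cp t).measurable
  have h3 := (S.cq t).measurable
  have : Measurable fun x => S.pxx x t + 2 * (S.p x t ^ 2 + S.q x t ^ 2) * S.p x t := by fun_prop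
  refine this.aestronglyMeasurable.congr ?_
  filter_upwards [ae_restrict_mem measurableSet_Ioi] with x hx
  exact (S.eq2 t x (le_of_lt hx)).symm

lemma ipx (t : ℝ) : IntegrableOn (fun x => S.px x t ^ 2) (Ioi 0) := by
  refine Integrable.mono' (S.hi1 t) ((S.cpx t).measurable.pow_const 2).aestronglyMeasurable (ae_of_all _ fun x => ?_)
  rw [Real.norm_eq_abs, abs_of_nonneg (sq_nonneg _)]; nlinarith [sq_nonneg (S.qx x t)]
lemma iqx (t : ℝ) : IntegrableOn (fun x => S.qx x t ^ 2) (Ioi 0) := by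
  refine Integrable.mono' (S.hi1 t) ((S.cqx t).measurable.pow_const 2).aestronglyMeasurable (ae_of_all _ fun x => ?_)
  rw [Real.norm_eq_abs, abs_of_nonneg (sq_nonneg _)]; nlinarith [sq_nonneg (S.px x t)]
lemma ipxx (t : ℝ) : IntegrableOn (fun x => S.pxx x t ^ 2) (Ioi 0) := by
  refine Integrable.mono' (S.hi2 t) ((S.mpxx t).pow_const 2).aestronglyMeasurable (ae_of_all _ fun x => ?_)
  rw [Real.norm_eq_abs, abs_of_nonneg (sq_nonneg _)]; nlinarith [sq_nonneg (S.qxx x t)]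
lemma iqxx (t : ℝ) : IntegrableOn (fun x => S.qxx x t ^ 2) (Ioi 0) := by
  refine Integrable.mono' (S.hi2 t) ((S.mqxx t).pow_const 2).aestronglyMeasurable (ae_of_all _ fun x => ?_)
  rw [Real.norm_eq_abs, abs_of_nonneg (sq_nonneg _)]; nlinarith [sq_nonneg (S.pxx x t)]

lemma K_eq (t : ℝ) : S.K t = (∫ x in Ioi (0:ℝ), S.px x t ^ 2) + ∫ x in Ioi (0:ℝ), S.qx x t ^ 2 :=
  integral_add (S.ipx t) (S.iqx t)
lemma V_eq (t : ℝ) : S.V t = (∫ x in Ioi (0:ℝ), S.pxx x t ^ 2) + ∫ x in Ioi (0:ℝ), S.qxx x t ^ 2 :=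
  integral_add (S.ipxx t) (S.iqxx t)

lemma P0 (t : ℝ) : 0 ≤ S.P t := integral_nonneg fun x => by positivity
lemma K0 (t : ℝ) : 0 ≤ S.K t := integral_nonneg fun x => by positivity
lemma V0 (t : ℝ) : 0 ≤ S.V t := integral_nonneg fun x => by positivity
lemma T0 (t : ℝ) : 0 ≤ S.T t := integral_nonneg fun x => by positivity

lemma hn (t x : ℝ) : HasDerivAt (fun y => S.p y t ^ 2 + S.q y t ^ 2) (2 * S.p x t * S.px x t + 2 * S.q x t * S.qx x t) x :=
  (((S.hpx t x).fun_pow 2).add ((S.hqx t x).fun_pow 2)).congr_deriv (by simp)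

lemma n_sup (t : ℝ) {x : ℝ} (hx : 0 ≤ x) : S.p x t ^ 2 + S.q x t ^ 2 ≤ 1 + S.P t + S.K t := by
  obtain ⟨B, hB0, hB⟩ := bddlem (cont_der (S.hn t)) (by simpa using ((S.dp t).pow 2).add ((S.dq t).pow 2))
  have := expb (S.hn t) (L := 1) (c := 1) (x0 := x) (B := B) one_pos hx (fun y hy => hB y (hx.trans hy))
    ((S.hi0 t).add (S.hi1 t)) (fun y => by simp only [Pi.add_apply]; positivity) (fun y hy => ?_)
  · simp only [Pi.add_apply] at this
    rw [integral_add (S.hi0 t) (S.hi1 t)] at this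
    simp only [P, K]; linarith
  · simp only [Pi.add_apply, div_one]
    rw [abs_of_nonneg (by positivity)]
    have h1 : |2 * S.p y t * S.px y t + 2 * S.q y t * S.qx y t| ≤ S.p y t ^ 2 + S.q y t ^ 2 + (S.px y t ^ 2 + S.qx y t ^ 2) := by
      rw [abs_le]
      constructor
      · nlinarith [sq_nonneg (S.p y t + S.px y t), sq_nonneg (S.q y t + S.qx y t)]
      · nlinarith [sq_nonneg (S.p y t - S.px y t), sq_nonneg (S.q y t - S.qx y t)]
    nlinarith [sq_nonneg (S.p y t ^ 2 + S.q y t ^ 2 - 1)]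

lemma k_sup (t : ℝ) {x l : ℝ} (hx : 0 ≤ x) (hl : 0 < l) : S.px x t ^ 2 + S.qx x t ^ 2 ≤ l * S.K t + S.V t / l := by
  have h1 := sqb (S.hpxx t) (S.dpx t) (S.ipx t) (S.ipxx t) hx hl
  have h2 := sqb (S.hqxx t) (S.dqx t) (S.iqx t) (S.iqxx t) hx hl
  rw [K_eq, V_eq, add_div]; linarith

lemma ipt (t : ℝ) : IntegrableOn (fun x => S.pt x t ^ 2 + S.qt x t ^ 2) (Ioi 0) := by
  refine Integrable.mono' (((S.hi2 t).const_mul 2).add ((S.hi0 t).const_mul (8 * (1 + S.P t + S.K t))))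
    (((S.mpt t).pow 2).add ((S.mqt t).pow 2)) ?_
  filter_upwards [ae_restrict_mem measurableSet_Ioi] with x hx
  have hx' := le_of_lt (mem_Ioi.mp hx)
  have hM := S.n_sup t hx'
  simp only [Pi.add_apply]
  rw [Real.norm_eq_abs, abs_of_nonneg (by positivity), S.eq1 t x hx', S.eq2 t x hx']
  set n := S.p x t ^ 2 + S.q x t ^ 2 with hn
  have hn0 : 0 ≤ n := by positivity
  have h1 : n ^ 2 * n ≤ (1 + S.P t + S.K t) * n ^ 2 := by nlinarith [sq_nonneg n]
  have h2 : (2 * n * S.q x t) ^ 2 + (2 * n * S.p x t) ^ 2 = 4 * (n ^ 2 * n) := by rw [hn]; ring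
  nlinarith [sq_nonneg (S.qxx x t - 2 * n * S.q x t), sq_nonneg (S.pxx x t - 2 * n * S.p x t)]

lemma T_le (t : ℝ) : S.T t ≤ 2 * S.V t + 8 * (1 + S.P t + S.K t) * S.P t := by
  have : S.T t ≤ ∫ x in Ioi (0:ℝ), (2 * (S.pxx x t ^ 2 + S.qxx x t ^ 2) + 8 * (1 + S.P t + S.K t) * (S.p x t ^ 2 + S.q x t ^ 2) ^ 2) := by
    refine setIntegral_mono_on (S.ipt t) (((S.hi2 t).const_mul 2).add ((S.hi0 t).const_mul (8 * (1 + S.P t + S.K t)))) 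
      measurableSet_Ioi fun x hx => ?_
    have hx' := le_of_lt (mem_Ioi.mp hx)
    have hM := S.n_sup t hx'
    rw [S.eq1 t x hx', S.eq2 t x hx']
    set n := S.p x t ^ 2 + S.q x t ^ 2 with hn
    have hn0 : 0 ≤ n := by positivity
    have h1 : n ^ 2 * n ≤ (1 + S.P t + S.K t) * n ^ 2 := by nlinarith [sq_nonneg n]
    have h2 : (2 * n * S.q x t) ^ 2 + (2 * n * S.p x t) ^ 2 = 4 * (n ^ 2 * n) := by rw [hn]; ring
    nlinarith [sq_nonneg (S.qxx x t - 2 * n * S.q x t), sq_nonneg (S.pxx x t - 2 * n * S.p x t)]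
  rw [integral_add ((S.hi2 t).const_mul 2) ((S.hi0 t).const_mul _), integral_const_mul, integral_const_mul] at this
  exact this

lemma V_le (t : ℝ) : S.V t ≤ 2 * S.T t + 8 * (1 + S.P t + S.K t) * S.P t := by
  have : S.V t ≤ ∫ x in Ioi (0:ℝ), (2 * (S.pt x t ^ 2 + S.qt x t ^ 2) + 8 * (1 + S.P t + S.K t) * (S.p x t ^ 2 + S.q x t ^ 2) ^ 2) := by
    refine setIntegral_mono_on (S.hi2 t) (((S.ipt t).const_mul 2).add ((S.hi0 t).const_mul (8 * (1 + S.P t + S.K t)))) 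
      measurableSet_Ioi fun x hx => ?_
    have hx' := le_of_lt (mem_Ioi.mp hx)
    have hM := S.n_sup t hx'
    have e1 := S.eq1 t x hx'
    have e2 := S.eq2 t x hx'
    set n := S.p x t ^ 2 + S.q x t ^ 2 with hn
    have hn0 : 0 ≤ n := by positivity
    have h1 : n ^ 2 * n ≤ (1 + S.P t + S.K t) * n ^ 2 := by nlinarith [sq_nonneg n]
    have h2 : (2 * n * S.q x t) ^ 2 + (2 * n * S.p x t) ^ 2 = 4 * (n ^ 2 * n) := by rw [hn]; ring
    have e3 : S.qxx x t = - S.pt x t - 2 * n * S.q x t := by linarith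
    have e4 : S.pxx x t = S.qt x t - 2 * n * S.p x t := by linarith
    rw [e3, e4]
    nlinarith [sq_nonneg (S.pt x t - 2 * n * S.q x t), sq_nonneg (S.qt x t + 2 * n * S.p x t)]
  rw [integral_add ((S.ipt t).const_mul 2) ((S.hi0 t).const_mul _), integral_const_mul, integral_const_mul] at this
  exact this

lemma ipt1 (t : ℝ) : IntegrableOn (fun x => S.pt x t ^ 2) (Ioi 0) := by
  refine Integrable.mono' (S.ipt t) ((S.mpt t).pow 2) (ae_of_all _ fun x => ?_)
  rw [Real.norm_eq_abs, abs_of_nonneg (sq_nonneg _)]; nlinarith [sq_nonneg (S.qt x t)]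
lemma iqt1 (t : ℝ) : IntegrableOn (fun x => S.qt x t ^ 2) (Ioi 0) := by
  refine Integrable.mono' (S.ipt t) ((S.mqt t).pow 2) (ae_of_all _ fun x => ?_)
  rw [Real.norm_eq_abs, abs_of_nonneg (sq_nonneg _)]; nlinarith [sq_nonneg (S.pt x t)]

/-- regularity on an interval -/
def Reg (D : ℝ) (I : Set ℝ) : Prop := ∀ τ ∈ I, S.T τ ≤ D

lemma T_eq (t : ℝ) : S.T t = (∫ x in Ioi (0:ℝ), S.pt x t ^ 2) + ∫ x in Ioi (0:ℝ), S.qt x t ^ 2 :=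
  integral_add (S.ipt1 t) (S.iqt1 t)

lemma lip_p {D s e : ℝ} (hD : S.Reg D (Icc s e)) {t1 t2 : ℝ} (h1 : t1 ∈ Icc s e) (h2 : t2 ∈ Icc s e) :
    IntegrableOn (fun x => (S.p x t2 - S.p x t1) ^ 2) (Ioi 0) ∧
      ∫ x in Ioi (0:ℝ), (S.p x t2 - S.p x t1) ^ 2 ≤ D * (t2 - t1) ^ 2 := by
  wlog h12 : t1 ≤ t2 generalizing t1 t2
  · have := this h2 h1 (le_of_not_ge h12)
    have e1 : (fun x => (S.p x t1 - S.p x t2) ^ 2) = fun x => (S.p x t2 - S.p x t1) ^ 2 := by ext x; ring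
    rw [e1] at this
    refine ⟨this.1, this.2.trans (le_of_eq (by ring))⟩
  have hD0 : 0 ≤ D := (S.T0 t1).trans (hD t1 h1)
  have key := lipL2 S.hpt (fun t => S.cp t) h12 (D := ENNReal.ofReal D) (fun τ hτ => by
    refine lint_of_l2 (S.ipt1 τ) (fun x => sq_nonneg _) ?_
    have := hD τ ⟨h1.1.trans hτ.1.le, hτ.2.trans h2.2⟩
    rw [S.T_eq] at this
    have h3 : 0 ≤ ∫ x in Ioi (0:ℝ), S.qt x τ ^ 2 := integral_nonneg fun x => sq_nonneg _
    linarith)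
  rw [← ENNReal.ofReal_mul (by positivity)] at key
  have := l2_of_lint (((S.cp t2).sub (S.cp t1)).aestronglyMeasurable) (by positivity) key
  exact ⟨this.1, this.2.trans (le_of_eq (by ring))⟩

lemma lip_q {D s e : ℝ} (hD : S.Reg D (Icc s e)) {t1 t2 : ℝ} (h1 : t1 ∈ Icc s e) (h2 : t2 ∈ Icc s e) :
    IntegrableOn (fun x => (S.q x t2 - S.q x t1) ^ 2) (Ioi 0) ∧
      ∫ x in Ioi (0:ℝ), (S.q x t2 - S.q x t1) ^ 2 ≤ D * (t2 - t1) ^ 2 := by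
  wlog h12 : t1 ≤ t2 generalizing t1 t2
  · have := this h2 h1 (le_of_not_ge h12)
    have e1 : (fun x => (S.q x t1 - S.q x t2) ^ 2) = fun x => (S.q x t2 - S.q x t1) ^ 2 := by ext x; ring
    rw [e1] at this
    refine ⟨this.1, this.2.trans (le_of_eq (by ring))⟩
  have hD0 : 0 ≤ D := (S.T0 t1).trans (hD t1 h1)
  have key := lipL2 S.hqt (fun t => S.cq t) h12 (D := ENNReal.ofReal D) (fun τ hτ => by
    refine lint_of_l2 (S.iqt1 τ) (fun x => sq_nonneg _) ?_
    have := hD τ ⟨h1.1.trans hτ.1.le, hτ.2.trans h2.2⟩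
    rw [S.T_eq] at this
    have h3 : 0 ≤ ∫ x in Ioi (0:ℝ), S.pt x τ ^ 2 := integral_nonneg fun x => sq_nonneg _
    linarith)
  rw [← ENNReal.ofReal_mul (by positivity)] at key
  have := l2_of_lint (((S.cq t2).sub (S.cq t1)).aestronglyMeasurable) (by positivity) key
  exact ⟨this.1, this.2.trans (le_of_eq (by ring))⟩

end Sol
end HL

namespace HL
open MeasureTheory Filter Set Topology

lemma le_of_upper {H : ℝ → ℝ} {s e : ℝ} (hs : s ≤ e) (hc : ContinuousOn H (Icc s e))
    (hR : ∀ t ∈ Icc s e, ∃ R : ℝ → ℝ, R t = 0 ∧ HasDerivWithinAt R 0 (Icc s e) t ∧ ∀ t' ∈ Icc s e, H t' - H t ≤ R t') :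
    H e ≤ H s := by
  refine image_le_of_liminf_slope_right_le_deriv_boundary (f := H) (B := fun _ => H s) (B' := fun _ => 0) (a := s) (b := e)
    hc le_rfl continuousOn_const (fun x _ => hasDerivWithinAt_const _ _ _) ?_ ⟨hs, le_rfl⟩
  intro x hx r hr
  obtain ⟨R, hR0, hRd, hRle⟩ := hR x ⟨hx.1, hx.2.le⟩
  have h1 : HasDerivWithinAt R 0 (Ioo x e) x := hRd.mono fun y hy => ⟨hx.1.trans hy.1.le, hy.2.le⟩
  rw [hasDerivWithinAt_iff_tendsto_slope] at h1
  have h2 : Ioo x e \ {x} = Ioo x e := by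
    ext y; simp only [Set.mem_sdiff, mem_Ioo, mem_singleton_iff, and_iff_left_iff_imp]; intro h; exact ne_of_gt h.1
  rw [h2, nhdsWithin_Ioo_eq_nhdsGT hx.2] at h1
  have h3 : ∀ᶠ z in 𝓝[>] x, slope H x z < r := by
    filter_upwards [h1.eventually_lt_const hr, Ioo_mem_nhdsGT hx.2] with z hz hz2
    refine lt_of_le_of_lt ?_ hz
    rw [slope_def_field, slope_def_field, hR0, sub_zero]
    have : 0 < z - x := sub_pos.mpr hz2.1
    gcongr
    exact hRle z ⟨hx.1.trans hz2.1.le, hz2.2.le⟩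
  exact h3.frequently

lemma const_of_upper {H : ℝ → ℝ} {s e : ℝ} (hs : s ≤ e) (hc : ContinuousOn H (Icc s e))
    (hR : ∀ t ∈ Icc s e, ∃ R : ℝ → ℝ, R t = 0 ∧ HasDerivWithinAt R 0 (Icc s e) t ∧ ∀ t' ∈ Icc s e, H t' - H t ≤ R t') :
    H e = H s := by
  refine le_antisymm (le_of_upper hs hc hR) ?_
  have hmap : MapsTo (fun t : ℝ => s + e - t) (Icc s e) (Icc s e) := fun t ht => ⟨by linarith [ht.2], by linarith [ht.1]⟩
  have := le_of_upper (H := fun t => H (s + e - t)) hs (hc.comp (by fun_prop) hmap) ?_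
  · simpa using this
  intro t ht
  obtain ⟨R, hR0, hRd, hRle⟩ := hR _ (hmap ht)
  refine ⟨fun t' => R (s + e - t'), hR0, ?_, fun t' ht' => hRle _ (hmap ht')⟩
  have h1 : HasDerivWithinAt (fun t : ℝ => s + e - t) (-1) (Icc s e) t := by
    simpa using ((hasDerivAt_id t).const_sub (s + e)).hasDerivWithinAt
  exact (hRd.comp t h1 hmap).congr_deriv (by simp)

namespace Sol
variable {a b : ℝ} (S : Sol a b)

noncomputable def G (t : ℝ) : ℝ := 4 * ((S.p 0 t ^ 2 + S.q 0 t ^ 2) / 6 - a ^ 2 + b ^ 2 / 3) * S.Om t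
noncomputable def H (t : ℝ) : ℝ := S.P t - S.K t + S.G t

lemma Om_pos (t : ℝ) : 0 < S.Om t := Real.sqrt_pos.mpr (by linarith [S.hb t])
lemma Om_sq (t : ℝ) : S.Om t ^ 2 = 4 * b ^ 2 - (S.p 0 t ^ 2 + S.q 0 t ^ 2) := Real.sq_sqrt (by linarith [S.hb t])

lemma hn0 (t : ℝ) : HasDerivAt (fun t => S.p 0 t ^ 2 + S.q 0 t ^ 2) (2 * S.p 0 t * S.pt 0 t + 2 * S.q 0 t * S.qt 0 t) t :=
  (((S.hpt 0 t).fun_pow 2).add ((S.hqt 0 t).fun_pow 2)).congr_deriv (by simp)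

lemma hOm (t : ℝ) : HasDerivAt S.Om (-(S.p 0 t * S.pt 0 t + S.q 0 t * S.qt 0 t) / S.Om t) t := by
  have h := ((S.hn0 t).const_sub (4 * b ^ 2)).sqrt (by linarith [S.hb t])
  refine h.congr_deriv ?_
  have := S.Om_pos t
  simp only [Om] at *
  field_simp

/-- the boundary relation -/
lemma bcrel (t : ℝ) : 2 * S.Om t * (S.px 0 t * S.pt 0 t + S.qx 0 t * S.qt 0 t) =
    (S.p 0 t ^ 2 + S.q 0 t ^ 2 - 2 * (a ^ 2 + b ^ 2)) * (2 * S.p 0 t * S.pt 0 t + 2 * S.q 0 t * S.qt 0 t) := by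
  have h1 := S.bc1 t
  have h2 := S.bc2 t
  simp only [Om]
  linear_combination (-S.pt 0 t) * h1 - (S.qt 0 t) * h2

lemma hG (t : ℝ) : HasDerivAt S.G (-2 * (S.px 0 t * S.pt 0 t + S.qx 0 t * S.qt 0 t)) t := by
  have h1 : HasDerivAt (fun t => 4 * ((S.p 0 t ^ 2 + S.q 0 t ^ 2) / 6 - a ^ 2 + b ^ 2 / 3))
      (4 * ((2 * S.p 0 t * S.pt 0 t + 2 * S.q 0 t * S.qt 0 t) / 6)) t :=
    ((((S.hn0 t).div_const 6).sub_const (a ^ 2)).add_const (b ^ 2 / 3)).const_mul 4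
  refine (h1.mul (S.hOm t)).congr_deriv ?_
  have h2 := S.bcrel t
  have h3 := S.Om_pos t
  have h4 := S.Om_sq t
  have h5 : S.Om t ≠ 0 := h3.ne'
  field_simp
  set n := S.p 0 t ^ 2 + S.q 0 t ^ 2
  linear_combination (18 : ℝ) * h2 + 24 * (S.p 0 t * S.pt 0 t + S.q 0 t * S.qt 0 t) * h4

def Bd (C : ℝ) (I : Set ℝ) : Prop := ∀ τ ∈ I, S.P τ ≤ C ∧ S.K τ ≤ C ∧ S.V τ ≤ C

lemma Bd.reg {S : Sol a b} {C : ℝ} {I : Set ℝ} (h : S.Bd C I) : S.Reg (2 * C + 8 * (1 + C + C) * C) I := by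
  intro τ hτ
  obtain ⟨h1, h2, h3⟩ := h τ hτ
  have := S.P0 τ
  have := S.K0 τ
  have hC : 0 ≤ C := by linarith
  refine (S.T_le τ).trans ?_
  gcongr

lemma Bd.mono {S : Sol a b} {C : ℝ} {I J : Set ℝ} (h : S.Bd C I) (hJ : J ⊆ I) : S.Bd C J := fun τ hτ => h τ (hJ hτ)

/-- one sided energy inequality -/
lemma en_le {D M s e : ℝ} (hD : S.Reg D (Icc s e)) (hM : ∀ τ ∈ Icc s e, ∀ x, 0 ≤ x → S.p x τ ^ 2 + S.q x τ ^ 2 ≤ M)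
    {t t' : ℝ} (ht : t ∈ Icc s e) (ht' : t' ∈ Icc s e) :
    (S.P t' - S.K t') - (S.P t - S.K t) ≤
      2 * (S.px 0 t * (S.p 0 t' - S.p 0 t) + S.qx 0 t * (S.q 0 t' - S.q 0 t))
      + 2 * ((∫ x in Ioi (0:ℝ), S.qt x t * (S.p x t' - S.p x t)) - ∫ x in Ioi (0:ℝ), S.pt x t * (S.q x t' - S.q x t))
      + 12 * M * D * (t' - t) ^ 2 := by
  obtain ⟨iw1, bw1⟩ := S.lip_p hD ht ht'
  obtain ⟨iw2, bw2⟩ := S.lip_q hD ht ht'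
  have mw1 : AEStronglyMeasurable (fun x => S.p x t' - S.p x t) (volume.restrict (Ioi 0)) :=
    ((S.cp t').sub (S.cp t)).aestronglyMeasurable
  have mw2 : AEStronglyMeasurable (fun x => S.q x t' - S.q x t) (volume.restrict (Ioi 0)) :=
    ((S.cq t').sub (S.cq t)).aestronglyMeasurable
  have m1 : AEStronglyMeasurable (fun x => S.px x t) (volume.restrict (Ioi 0)) := (S.cpx t).aestronglyMeasurable
  have m2 : AEStronglyMeasurable (fun x => S.qx x t) (volume.restrict (Ioi 0)) := (S.cqx t).aestronglyMeasurable
  have m1' : AEStronglyMeasurable (fun x => S.px x t') (volume.restrict (Ioi 0)) := (S.cpx t').aestronglyMeasurable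
  have m2' : AEStronglyMeasurable (fun x => S.qx x t') (volume.restrict (Ioi 0)) := (S.cqx t').aestronglyMeasurable
  have i1 := int_mul m1 (m1'.sub m1) (S.ipx t) (int_sq_sub m1' m1 (S.ipx t') (S.ipx t))
  have i2 := int_mul m2 (m2'.sub m2) (S.iqx t) (int_sq_sub m2' m2 (S.iqx t') (S.iqx t))
  have j1 := int_mul (S.mpxx t).aestronglyMeasurable mw1 (S.ipxx t) iw1
  have j2 := int_mul (S.mqxx t).aestronglyMeasurable mw2 (S.iqxx t) iw2
  have k1 := int_mul (S.mqt t) mw1 (S.iqt1 t) iw1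
  have k2 := int_mul (S.mpt t) mw2 (S.ipt1 t) iw2
  simp only [Pi.sub_apply] at i1 i2 j1 j2 k1 k2
  have b1 := ibp (S.hpxx t) (fun x => (S.hpx t' x).sub (S.hpx t x)) j1 i1 
    (by simpa using (S.dpx t).mul ((S.dp t').sub (S.dp t)))
  have b2 := ibp (S.hqxx t) (fun x => (S.hqx t' x).sub (S.hqx t x)) j2 i2 
    (by simpa using (S.dqx t).mul ((S.dq t').sub (S.dq t)))
  simp only [Pi.sub_apply] at b1 b2
  have L := ((HI.mk' (S.hi0 t')).sub (HI.mk' (S.hi1 t'))).sub ((HI.mk' (S.hi0 t)).sub (HI.mk' (S.hi1 t)))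
  have R := ((((HI.mk' k1).mul 2).sub ((HI.mk' k2).mul 2)).add (((HI.mk' iw1).mul (6 * M)).add ((HI.mk' iw2).mul (6 * M)))).sub
    ((((HI.mk' j1).mul 2).add ((HI.mk' j2).mul 2)).add (((HI.mk' i1).mul 2).add ((HI.mk' i2).mul 2)))
  have e2 := L.le R fun x hx => by
    have hx' := le_of_lt hx
    have hM1 := hM t ht x hx'
    have hM2 := hM t' ht' x hx'
    rw [S.eq1 t x hx', S.eq2 t x hx']
    generalize S.p x t = p at *
    generalize S.q x t = q at *
    generalize S.p x t' = p' at *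
    generalize S.q x t' = q' at *
    generalize S.px x t = px at *
    generalize S.qx x t = qx at *
    generalize S.px x t' = px' at *
    generalize S.qx x t' = qx' at *
    have hw : ((p + p') * (p' - p) + (q + q') * (q' - q)) ^ 2 ≤ 4 * M * ((p' - p) ^ 2 + (q' - q) ^ 2) := by
      have h1 : ((p + p') * (p' - p) + (q + q') * (q' - q)) ^ 2 ≤ ((p + p') ^ 2 + (q + q') ^ 2) * ((p' - p) ^ 2 + (q' - q) ^ 2) := by
        nlinarith [sq_nonneg ((p + p') * (q' - q) - (q + q') * (p' - p))]
      have h2 : (p + p') ^ 2 + (q + q') ^ 2 ≤ 4 * M := by nlinarith [sq_nonneg (p - p'), sq_nonneg (q - q')]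
      refine h1.trans (mul_le_mul_of_nonneg_right h2 (by positivity))
    have hw2 : (p ^ 2 + q ^ 2) * ((p' - p) ^ 2 + (q' - q) ^ 2) ≤ M * ((p' - p) ^ 2 + (q' - q) ^ 2) :=
      mul_le_mul_of_nonneg_right hM1 (by positivity)
    nlinarith [sq_nonneg (px' - px), sq_nonneg (qx' - qx)]
  rw [b1, b2] at e2
  have hM0 : 0 ≤ M := le_trans (by positivity) (hM t ht 0 le_rfl)
  have h3 := mul_le_mul_of_nonneg_left bw1 hM0
  have h4 := mul_le_mul_of_nonneg_left bw2 hM0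
  simp only [P, K]
  linarith

lemma en_abs {C D s e : ℝ} (hB : S.Bd C (Icc s e)) (hD : S.Reg D (Icc s e))
    {t t' : ℝ} (ht : t ∈ Icc s e) (ht' : t' ∈ Icc s e) :
    (S.P t' - S.K t') - (S.P t - S.K t) ≤
      2 * (1 + 2 * C) * (|S.p 0 t' - S.p 0 t| + |S.q 0 t' - S.q 0 t|) + 4 * D * |t' - t| + 12 * (1 + 2 * C) * D * (t' - t) ^ 2 := by
  rcases eq_or_ne t' t with rfl | hne
  · simp
  have hM : ∀ τ ∈ Icc s e, ∀ x, 0 ≤ x → S.p x τ ^ 2 + S.q x τ ^ 2 ≤ 1 + 2 * C := fun τ hτ x hx => by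
    have := S.n_sup τ hx
    have := hB τ hτ
    linarith
  have h1 := S.en_le hD hM ht ht'
  obtain ⟨iw1, bw1⟩ := S.lip_p hD ht ht'
  obtain ⟨iw2, bw2⟩ := S.lip_q hD ht ht'
  have mw1 : AEStronglyMeasurable (fun x => S.p x t' - S.p x t) (volume.restrict (Ioi 0)) :=
    ((S.cp t').sub (S.cp t)).aestronglyMeasurable
  have mw2 : AEStronglyMeasurable (fun x => S.q x t' - S.q x t) (volume.restrict (Ioi 0)) :=
    ((S.cq t').sub (S.cq t)).aestronglyMeasurable
  have k1 := int_mul (S.mqt t) mw1 (S.iqt1 t) iw1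
  have k2 := int_mul (S.mpt t) mw2 (S.ipt1 t) iw2
  set θ := |t' - t| with hθ
  have hθ0 : 0 < θ := abs_pos.mpr (sub_ne_zero.mpr hne)
  have hθ2 : (t' - t) ^ 2 = θ ^ 2 := (sq_abs _).symm
  have amgm : ∀ x y : ℝ, 2 * (x * y) ≤ θ * x ^ 2 + θ⁻¹ * y ^ 2 := fun x y => by
    have : θ * x ^ 2 + θ⁻¹ * y ^ 2 - 2 * (x * y) = θ⁻¹ * (θ * x - y) ^ 2 := by field_simp; ring
    have h2 : 0 ≤ θ⁻¹ * (θ * x - y) ^ 2 := by positivity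
    linarith
  have l1 := ((HI.mk' k1).mul 2).le (((HI.mk' (S.iqt1 t)).mul θ).add ((HI.mk' iw1).mul θ⁻¹)) (fun x _ => amgm _ _)
  have l2 := ((HI.mk' k2).mul (-2)).le (((HI.mk' (S.ipt1 t)).mul θ).add ((HI.mk' iw2).mul θ⁻¹)) (fun x _ => by
    have := amgm (-S.pt x t) (S.q x t' - S.q x t)
    nlinarith)
  have hT := hD t ht
  rw [S.T_eq] at hT
  have e1 : θ⁻¹ * (∫ x in Ioi (0:ℝ), (S.p x t' - S.p x t) ^ 2) ≤ D * θ := by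
    calc _ ≤ θ⁻¹ * (D * θ ^ 2) := by rw [← hθ2]; gcongr
      _ = D * θ := by field_simp
  have e2 : θ⁻¹ * (∫ x in Ioi (0:ℝ), (S.q x t' - S.q x t) ^ 2) ≤ D * θ := by
    calc _ ≤ θ⁻¹ * (D * θ ^ 2) := by rw [← hθ2]; gcongr
      _ = D * θ := by field_simp
  have e3 := mul_le_mul_of_nonneg_left hT hθ0.le
  have hk := S.k_sup t (x := 0) (l := 1) le_rfl one_pos
  obtain ⟨hB1, hB2, hB3⟩ := hB t ht
  have hD0 : 0 ≤ D := (S.T0 t).trans (hD t ht)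
  have hx1 : |S.px 0 t| ≤ 1 + 2 * C := by
    nlinarith [sq_abs (S.px 0 t), sq_nonneg (S.qx 0 t), sq_nonneg (|S.px 0 t| - 1), abs_nonneg (S.px 0 t)]
  have hx2 : |S.qx 0 t| ≤ 1 + 2 * C := by
    nlinarith [sq_abs (S.qx 0 t), sq_nonneg (S.px 0 t), sq_nonneg (|S.qx 0 t| - 1), abs_nonneg (S.qx 0 t)]
  have f1 : S.px 0 t * (S.p 0 t' - S.p 0 t) ≤ (1 + 2 * C) * |S.p 0 t' - S.p 0 t| := by
    refine (le_abs_self _).trans ?_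
    rw [abs_mul]; gcongr
  have f2 : S.qx 0 t * (S.q 0 t' - S.q 0 t) ≤ (1 + 2 * C) * |S.q 0 t' - S.q 0 t| := by
    refine (le_abs_self _).trans ?_
    rw [abs_mul]; gcongr
  have hDθ := mul_nonneg hD0 hθ0.le
  nlinarith

lemma H_const {C s e : ℝ} (hs : s ≤ e) (hB : S.Bd C (Icc s e)) : S.H e = S.H s := by
  set D := 2 * C + 8 * (1 + C + C) * C with hDdef
  have hD : S.Reg D (Icc s e) := hB.reg
  have hM : ∀ τ ∈ Icc s e, ∀ x, 0 ≤ x → S.p x τ ^ 2 + S.q x τ ^ 2 ≤ 1 + 2 * C := fun τ hτ x hx => by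
    have := S.n_sup τ hx
    have := hB τ hτ
    linarith
  have hGc : Continuous S.G := cont_der S.hG
  refine const_of_upper hs ?_ ?_
  · intro t ht
    have hE : ContinuousWithinAt (fun t => S.P t - S.K t) (Icc s e) t := by
      have hφ : Tendsto (fun t' => 2 * (1 + 2 * C) * (|S.p 0 t' - S.p 0 t| + |S.q 0 t' - S.q 0 t|) + 4 * D * |t' - t| + 12 * (1 + 2 * C) * D * (t' - t) ^ 2)
          (𝓝[Icc s e] t) (𝓝 0) := by
        have h1 := S.cpt 0
        have h2 := S.cqt 0
        have : Continuous (fun t' => 2 * (1 + 2 * C) * (|S.p 0 t' - S.p 0 t| + |S.q 0 t' - S.q 0 t|) + 4 * D * |t' - t| + 12 * (1 + 2 * C) * D * (t' - t) ^ 2) := by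
          fun_prop
        have := (this.tendsto t).mono_left (nhdsWithin_le_nhds (s := Icc s e))
        simpa using this
      rw [ContinuousWithinAt, tendsto_iff_dist_tendsto_zero]
      refine squeeze_zero' (Eventually.of_forall fun _ => dist_nonneg) ?_ hφ
      filter_upwards [self_mem_nhdsWithin] with t' ht'
      rw [Real.dist_eq, abs_le]
      have h1 := S.en_abs hB hD ht ht'
      have h2 := S.en_abs hB hD ht' ht
      rw [abs_sub_comm (S.p 0 t), abs_sub_comm (S.q 0 t), abs_sub_comm t] at h2
      constructor
      · nlinarith
      · exact h1
    exact hE.add hGc.continuousWithinAt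
  · intro t ht
    have d1 := lin_der (I := Icc s e) (D := D) (fun τ => (S.cp τ).aestronglyMeasurable) (S.mpt t) (S.ipt1 t) (fun x => S.hpt x t)
      (fun τ hτ => S.lip_p hD ht hτ) (S.mqt t) (S.iqt1 t)
    have d2 := lin_der (I := Icc s e) (D := D) (fun τ => (S.cq τ).aestronglyMeasurable) (S.mqt t) (S.iqt1 t) (fun x => S.hqt x t)
      (fun τ hτ => S.lip_q hD ht hτ) (S.mpt t) (S.ipt1 t)
    have d3 := (((S.hpt 0 t).sub_const (S.p 0 t)).const_mul (S.px 0 t)).add (((S.hqt 0 t).sub_const (S.q 0 t)).const_mul (S.qx 0 t))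
    have d4 : HasDerivAt (fun t' => 12 * (1 + 2 * C) * D * (t' - t) ^ 2) 0 t := by
      refine ((((hasDerivAt_id t).sub_const t).fun_pow 2).const_mul (12 * (1 + 2 * C) * D)).congr_deriv ?_
      simp
    refine ⟨fun t' => 2 * (S.px 0 t * (S.p 0 t' - S.p 0 t) + S.qx 0 t * (S.q 0 t' - S.q 0 t))
      + 2 * ((∫ x in Ioi (0:ℝ), S.qt x t * (S.p x t' - S.p x t)) - ∫ x in Ioi (0:ℝ), S.pt x t * (S.q x t' - S.q x t))
      + 12 * (1 + 2 * C) * D * (t' - t) ^ 2 + (S.G t' - S.G t), ?_, ?_, ?_⟩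
    · simp
    · refine ((((d3.const_mul 2).hasDerivWithinAt.add ((d1.sub d2).const_mul 2)).add d4.hasDerivWithinAt).add 
        ((S.hG t).sub_const (S.G t)).hasDerivWithinAt).congr_deriv ?_
      have : ∫ x in Ioi (0:ℝ), S.qt x t * S.pt x t = ∫ x in Ioi (0:ℝ), S.pt x t * S.qt x t := by
        congr 1; ext x; ring
      rw [this]; ring
    · intro t' ht'
      have := S.en_le hD hM ht ht'
      simp only [H]
      linarith

end Sol
end HL

namespace HL
open MeasureTheory Filter Set Topology

lemma exp_div_tendsto {L : ℝ} (hL : 0 < L) : Tendsto (fun y => Real.exp (-y / L)) atTop (𝓝 0) := by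
  refine Real.tendsto_exp_atBot.comp ?_
  refine (tendsto_neg_atTop_atBot.comp (tendsto_id.atTop_div_const hL)).congr fun y => ?_
  simp only [Function.comp, id]; ring

/-- a slowly varying majorant -/
lemma kernel {f f' : ℝ → ℝ} (hf : ∀ x, HasDerivAt f (f' x) x) (hf'c : Continuous f') (hf0 : ∀ x, 0 ≤ f x)
    (hlim : Tendsto f atTop (𝓝 0)) {L J : ℝ} (hL : 0 < L)
    (hg : IntegrableOn (fun x => f x / L + |f' x|) (Ioi 0)) (hJ : ∫ x in Ioi (0:ℝ), (f x / L + |f' x|) ≤ J) :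
    ∃ W W' : ℝ → ℝ, Continuous W ∧ Measurable W' ∧ (∀ x, 0 ≤ x → HasDerivAt W (W' x) x) ∧ (∀ x, 0 ≤ W x) ∧
      (∀ x, 0 ≤ x → |W' x| ≤ W x / L) ∧ (∀ x, 0 ≤ x → W x ^ 2 ≤ 1 + 2 * J) ∧ (∀ x, 0 ≤ x → f x ≤ W x ^ 2) ∧
      IntegrableOn (fun x => W x ^ 2) (Ioi 0) ∧ ∫ x in Ioi (0:ℝ), W x ^ 2 ≤ 3 * L * J + L := by
  have hfc : Continuous f := cont_der hf
  set g : ℝ → ℝ := fun x => f x / L + |f' x| with hgdef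
  have hgc : Continuous g := by fun_prop
  have hg0 : ∀ x, 0 ≤ g x := fun x => add_nonneg (div_nonneg (hf0 x) hL.le) (abs_nonneg _)
  set g1 : ℝ → ℝ := fun y => Real.exp (y / L) * g y with hg1
  set g2 : ℝ → ℝ := fun y => Real.exp (-y / L) * g y with hg2
  have hg1c : Continuous g1 := by fun_prop
  have hg2c : Continuous g2 := by fun_prop
  have hg20 : ∀ y, 0 ≤ g2 y := fun y => mul_nonneg (Real.exp_pos _).le (hg0 y)
  have hg2i : IntegrableOn g2 (Ioi 0) := by
    refine Integrable.mono' hg hg2c.aestronglyMeasurable ?_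
    filter_upwards [ae_restrict_mem measurableSet_Ioi] with y hy
    rw [Real.norm_eq_abs, abs_of_nonneg (hg20 y)]
    have : Real.exp (-y / L) ≤ 1 := Real.exp_le_one_iff.mpr (div_nonpos_of_nonpos_of_nonneg (by simpa using (le_of_lt hy)) hL.le)
    exact mul_le_of_le_one_left (hg0 y) this
  set c := ∫ y in Ioi (0:ℝ), g2 y with hc
  have hgx : ∀ x, 0 ≤ x → ∫ y in (0:ℝ)..x, g y ≤ J := fun x hx => by
    rw [intervalIntegral.integral_of_le hx]
    exact (setIntegral_mono_set hg (ae_of_all _ hg0) (Ioc_subset_Ioi_self).eventuallyLE).trans hJ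
  set T1 : ℝ → ℝ := fun x => Real.exp (-x / L) * (1 + ∫ y in (0:ℝ)..x, g1 y) with hT1
  set T2 : ℝ → ℝ := fun x => Real.exp (x / L) * (c - ∫ y in (0:ℝ)..x, g2 y) with hT2
  have hI1 : ∀ x, HasDerivAt (fun x => ∫ y in (0:ℝ)..x, g1 y) (g1 x) x := fun x => (hg1c.integral_hasStrictDerivAt 0 x).hasDerivAt
  have hI2 : ∀ x, HasDerivAt (fun x => ∫ y in (0:ℝ)..x, g2 y) (g2 x) x := fun x => (hg2c.integral_hasStrictDerivAt 0 x).hasDerivAt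
  have hE1 : ∀ x, HasDerivAt (fun x => Real.exp (-x / L)) (Real.exp (-x / L) * (-1 / L)) x := fun x =>
    ((hasDerivAt_id x).neg.div_const L).exp
  have hE2 : ∀ x, HasDerivAt (fun x => Real.exp (x / L)) (Real.exp (x / L) * (1 / L)) x := fun x =>
    ((hasDerivAt_id x).div_const L).exp
  have hee : ∀ x : ℝ, Real.exp (-x / L) * Real.exp (x / L) = 1 := fun x => by
    rw [← Real.exp_add]; simp [neg_div]
  have dT1 : ∀ x, HasDerivAt T1 (g x - T1 x / L) x := fun x => by
    refine ((hE1 x).mul ((hI1 x).const_add 1)).congr_deriv ?_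
    simp only [hT1, hg1]
    linear_combination (g x) * hee x
  have dT2 : ∀ x, HasDerivAt T2 (T2 x / L - g x) x := fun x => by
    refine ((hE2 x).mul ((hI2 x).const_sub c)).congr_deriv ?_
    simp only [hT2, hg2]
    linear_combination (-g x) * hee x
  have cT1 := cont_der dT1
  have cT2 := cont_der dT2
  have T1p : ∀ x, 0 ≤ x → 0 < T1 x := fun x hx => by
    have : 0 ≤ ∫ y in (0:ℝ)..x, g1 y := intervalIntegral.integral_nonneg hx fun y _ => mul_nonneg (Real.exp_pos _).le (hg0 y)
    have := Real.exp_pos (-x / L)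
    simp only [hT1]; positivity
  have htail : ∀ x, 0 ≤ x → c - ∫ y in (0:ℝ)..x, g2 y = ∫ y in Ioi x, g2 y := fun x hx => by
    rw [hc, ← intervalIntegral.integral_interval_add_Ioi hg2i (hg2i.mono_set (Ioi_subset_Ioi hx))]; ring
  have T2p : ∀ x, 0 ≤ x → 0 ≤ T2 x := fun x hx => by
    simp only [hT2]; rw [htail x hx]
    exact mul_nonneg (Real.exp_pos _).le (integral_nonneg hg20)
  have T2J : ∀ x, 0 ≤ x → T2 x ≤ J := fun x hx => by
    simp only [hT2]; rw [htail x hx, ← integral_const_mul]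
    refine (setIntegral_mono_on ((hg2i.mono_set (Ioi_subset_Ioi hx)).const_mul _) (hg.mono_set (Ioi_subset_Ioi hx)) measurableSet_Ioi 
      fun y hy => ?_).trans ((setIntegral_mono_set hg (ae_of_all _ hg0) (Ioi_subset_Ioi hx).eventuallyLE).trans hJ)
    simp only [hg2]
    rw [← mul_assoc, ← Real.exp_add]
    refine mul_le_of_le_one_left (hg0 y) (Real.exp_le_one_iff.mpr ?_)
    rw [← add_div]
    exact div_nonpos_of_nonpos_of_nonneg (by have := le_of_lt (mem_Ioi.mp hy); linarith) hL.le
  have T1J : ∀ x, 0 ≤ x → T1 x ≤ 1 + J := fun x hx => by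
    have h1 : Real.exp (-x / L) ≤ 1 := Real.exp_le_one_iff.mpr (div_nonpos_of_nonpos_of_nonneg (by simpa using hx) hL.le)
    have h2 : Real.exp (-x / L) * (∫ y in (0:ℝ)..x, g1 y) ≤ ∫ y in (0:ℝ)..x, g y := by
      rw [← intervalIntegral.integral_const_mul]
      refine intervalIntegral.integral_mono_on hx (Continuous.intervalIntegrable (by fun_prop) _ _) (hgc.intervalIntegrable _ _) fun y hy => ?_
      simp only [hg1]
      rw [← mul_assoc, ← Real.exp_add]
      refine mul_le_of_le_one_left (hg0 y) (Real.exp_le_one_iff.mpr ?_)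
      rw [← add_div]
      exact div_nonpos_of_nonpos_of_nonneg (by have := hy.2; linarith) hL.le
    have h3 := hgx x hx
    simp only [hT1]; rw [mul_add]; linarith
  have hft2 : ∀ x, 0 ≤ x → f x ≤ T2 x := by
    intro x hx
    have dF : ∀ y, HasDerivAt (fun y => Real.exp (-y / L) * f y - (c - ∫ z in (0:ℝ)..y, g2 z))
        (Real.exp (-y / L) * (|f' y| + f' y)) y := fun y => by
      refine (((hE1 y).mul (hf y)).sub ((hI2 y).const_sub c)).congr_deriv ?_
      simp only [hg2, hgdef]; ring
    have mF : Monotone (fun y => Real.exp (-y / L) * f y - (c - ∫ z in (0:ℝ)..y, g2 z)) := by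
      refine monotone_of_deriv_nonneg (fun y => (dF y).differentiableAt) fun y => ?_
      rw [(dF y).deriv]
      exact mul_nonneg (Real.exp_pos _).le (by linarith [neg_abs_le (f' y)])
    have lF : Tendsto (fun y => Real.exp (-y / L) * f y - (c - ∫ z in (0:ℝ)..y, g2 z)) atTop (𝓝 0) := by
      have h1 := (exp_div_tendsto hL).mul hlim
      have h2 := (intervalIntegral_tendsto_integral_Ioi 0 hg2i tendsto_id).const_sub c
      have := h1.sub h2
      simpa [← hc] using this
    have := mF.ge_of_tendsto lF x
    have h3 := Real.exp_pos (x / L)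
    have h4 : Real.exp (x / L) * (Real.exp (-x / L) * f x - (c - ∫ z in (0:ℝ)..x, g2 z)) ≤ 0 :=
      mul_nonpos_of_nonneg_of_nonpos h3.le this
    have h5 : Real.exp (x / L) * (Real.exp (-x / L) * f x - (c - ∫ z in (0:ℝ)..x, g2 z)) = f x - T2 x := by
      simp only [hT2]; linear_combination (f x) * hee x
    linarith
  have hJ0 : 0 ≤ J := (integral_nonneg hg0).trans hJ
  have hTint : ∀ X, 0 ≤ X → ∫ y in (0:ℝ)..X, (T1 y + T2 y) ≤ 3 * L * J + L := by
    intro X hX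
    have hd : ∀ y ∈ uIcc 0 X, HasDerivAt (fun y => L * (T2 y - T1 y)) ((T1 y + T2 y) - 2 * L * g y) y := fun y _ => by
      refine (((dT2 y).sub (dT1 y)).const_mul L).congr_deriv ?_
      field_simp; ring
    have := intervalIntegral.integral_eq_sub_of_hasDerivAt hd (Continuous.intervalIntegrable (by fun_prop) _ _)
    rw [intervalIntegral.integral_sub (Continuous.intervalIntegrable (by fun_prop) _ _) (Continuous.intervalIntegrable (by fun_prop) _ _), 
      intervalIntegral.integral_const_mul] at this
    have h0 : T1 0 = 1 := by simp [hT1]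
    have h1 := T2p 0 le_rfl
    have h2 := T2J X hX
    have h3 := T1p X hX
    have h4 := hgx X hX
    rw [h0] at this
    nlinarith [mul_le_mul_of_nonneg_left h4 hL.le, mul_le_mul_of_nonneg_left h2 hL.le, mul_nonneg hL.le h1, mul_nonneg hL.le h3.le]
  have hTi : IntegrableOn (fun y => T1 y + T2 y) (Ioi 0) := by
    refine integrableOn_Ioi_of_intervalIntegral_norm_bounded (b := id) (3 * L * J + L) 0 (l := atTop) (fun X => ?_) tendsto_id ?_
    · exact ((Continuous.continuousOn (by fun_prop)).integrableOn_Icc).mono_set Ioc_subset_Icc_self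
    · filter_upwards [eventually_ge_atTop 0] with X hX
      refine le_trans (le_of_eq ?_) (hTint X hX)
      refine intervalIntegral.integral_congr fun y hy => ?_
      rw [id, uIcc_of_le hX] at hy
      have h1 := T1p y hy.1
      have h2 := T2p y hy.1
      simp only [Real.norm_eq_abs]
      exact abs_of_nonneg (by linarith)
  have hTl : ∫ y in Ioi (0:ℝ), (T1 y + T2 y) ≤ 3 * L * J + L := by
    refine le_of_tendsto (intervalIntegral_tendsto_integral_Ioi 0 hTi tendsto_id) ?_
    filter_upwards [eventually_ge_atTop 0] with X hX using hTint X hX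
  have hsq : ∀ y, 0 ≤ y → √(T1 y + T2 y) ^ 2 = T1 y + T2 y := fun y hy => Real.sq_sqrt (by linarith [T1p y hy, T2p y hy])
  refine ⟨fun x => √(T1 x + T2 x), fun x => (T2 x / L - T1 x / L) / (2 * √(T1 x + T2 x)), by fun_prop, by fun_prop, ?_, fun x => Real.sqrt_nonneg _, ?_, ?_, ?_, ?_, ?_⟩
  · intro x hx
    have := ((dT1 x).add (dT2 x)).sqrt (by have := T1p x hx; have := T2p x hx; simp only [Pi.add_apply]; linarith)
    refine this.congr_deriv ?_
    simp only [Pi.add_apply]; congr 1; ring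
  · intro x hx
    have h1 := T1p x hx
    have h2 := T2p x hx
    have h3 : 0 < √(T1 x + T2 x) := Real.sqrt_pos.mpr (by linarith)
    rw [abs_div, abs_of_pos (by positivity : 0 < 2 * √(T1 x + T2 x)), div_le_div_iff₀ (by positivity) hL]
    have h4 : |T2 x / L - T1 x / L| ≤ (T1 x + T2 x) / L := by
      rw [← sub_div, abs_div, abs_of_pos hL]; gcongr
      rw [abs_le]; constructor <;> linarith
    calc _ ≤ (T1 x + T2 x) / L * L := by gcongr
      _ = √(T1 x + T2 x) ^ 2 := by rw [hsq x hx]; field_simp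
      _ ≤ _ := by nlinarith
  · intro x hx
    simp only []
    rw [hsq x hx]; linarith [T1J x hx, T2J x hx]
  · intro x hx
    simp only []
    rw [hsq x hx]; linarith [T1p x hx, hft2 x hx]
  · exact hTi.congr_fun (fun x hx => (hsq x (le_of_lt hx)).symm) measurableSet_Ioi
  · refine le_trans (le_of_eq ?_) hTl
    exact setIntegral_congr_fun measurableSet_Ioi fun x hx => hsq x (le_of_lt hx)

end HL

namespace HL
open MeasureTheory Filter Set Topology

lemma cross_le (p q x y : ℝ) {θ : ℝ} (hθ : 0 < θ) : 2 * |q * x - p * y| ≤ θ * (p ^ 2 + q ^ 2) + (x ^ 2 + y ^ 2) / θ := by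
  have h1 : (θ * (p ^ 2 + q ^ 2) + (x ^ 2 + y ^ 2) / θ) - 2 * (q * x - p * y) = ((θ * q - x) ^ 2 + (θ * p + y) ^ 2) / θ := by
    field_simp; ring
  have h2 : (θ * (p ^ 2 + q ^ 2) + (x ^ 2 + y ^ 2) / θ) + 2 * (q * x - p * y) = ((θ * q + x) ^ 2 + (θ * p - y) ^ 2) / θ := by
    field_simp; ring
  have h3 : 0 ≤ ((θ * q - x) ^ 2 + (θ * p + y) ^ 2) / θ := by positivity
  have h4 : 0 ≤ ((θ * q + x) ^ 2 + (θ * p - y) ^ 2) / θ := by positivity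
  rcases abs_cases (q * x - p * y) with h | h <;> rw [h.1] <;> linarith

lemma dot_le (p q x y : ℝ) {θ : ℝ} (hθ : 0 < θ) : |2 * p * x + 2 * q * y| ≤ θ * (p ^ 2 + q ^ 2) + (x ^ 2 + y ^ 2) / θ := by
  have := cross_le (-q) p x y hθ
  have e : 2 * p * x + 2 * q * y = 2 * (p * x - -q * y) := by ring
  rw [e, abs_mul, abs_two]
  nlinarith

namespace Sol
variable {a b : ℝ} (S : Sol a b)

lemma n_sup2 (t : ℝ) {x r : ℝ} (hx : 0 ≤ x) (hr : 0 < r) (hP : S.P t ≤ r ^ 30) (hK : S.K t ≤ 2 * r ^ 30) :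
    S.p x t ^ 2 + S.q x t ^ 2 ≤ 4 * r ^ 20 := by
  obtain ⟨B, hB0, hB⟩ := bddlem (cont_der (S.hn t)) (by simpa using ((S.dp t).pow 2).add ((S.dq t).pow 2))
  have hI := ((HI.mk' (S.hi0 t)).add (HI.mk' (S.hi1 t))).mul ((r ^ 10)⁻¹)
  have := expb (S.hn t) (L := (r ^ 10)⁻¹) (c := r ^ 30) (x0 := x) (B := B) (by positivity) hx (fun y hy => hB y (hx.trans hy))
    hI.1 (fun y => by positivity) (fun y hy => ?_)
  · rw [hI.2] at this
    have e1 : r ^ 30 * (r ^ 10)⁻¹ = r ^ 20 := by field_simp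
    have e2 : (r ^ 10)⁻¹ * (S.P t + S.K t) ≤ (r ^ 10)⁻¹ * (3 * r ^ 30) := by gcongr; linarith
    have e3 : (r ^ 10)⁻¹ * (3 * r ^ 30) = 3 * r ^ 20 := by field_simp
    simp only [P, K] at *
    linarith
  · rw [abs_of_nonneg (by positivity)]
    have h1 := dot_le (S.p y t) (S.q y t) (S.px y t) (S.qx y t) (θ := r ^ 10) (by positivity)
    have h2 : r ^ 30 + (r ^ 10)⁻¹ * (S.p y t ^ 2 + S.q y t ^ 2) ^ 2 - 2 * r ^ 10 * (S.p y t ^ 2 + S.q y t ^ 2) = 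
      (r ^ 10)⁻¹ * (S.p y t ^ 2 + S.q y t ^ 2 - r ^ 20) ^ 2 := by field_simp; ring
    have h3 : 0 ≤ (r ^ 10)⁻¹ * (S.p y t ^ 2 + S.q y t ^ 2 - r ^ 20) ^ 2 := by positivity
    rw [div_inv_eq_mul]
    rw [div_eq_mul_inv] at h1
    linarith

/-- weight class -/
structure Wt (W W' : ℝ → ℝ) (L M : ℝ) : Prop where
  c : Continuous W
  m : Measurable W'
  d : ∀ x, 0 ≤ x → HasDerivAt W (W' x) x
  nn : ∀ x, 0 ≤ W x
  d' : ∀ x, 0 ≤ x → |W' x| ≤ W x / L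
  M : ∀ x, 0 ≤ x → W x ≤ M
  i : IntegrableOn (fun x => W x ^ 2) (Ioi 0)

lemma cn (t : ℝ) : Continuous fun x => S.p x t ^ 2 + S.q x t ^ 2 := ((S.cp t).pow 2).add ((S.cq t).pow 2)

lemma Wt.iWn {W W' : ℝ → ℝ} {L M : ℝ} (w : Wt W W' L M) (t : ℝ) : IntegrableOn (fun x => W x * (S.p x t ^ 2 + S.q x t ^ 2)) (Ioi 0) :=
  int_mul w.c.aestronglyMeasurable (S.cn t).aestronglyMeasurable w.i (S.hi0 t)

lemma Wt.iWk {W W' : ℝ → ℝ} {L M : ℝ} (w : Wt W W' L M) (t : ℝ) : IntegrableOn (fun x => W x * (S.px x t ^ 2 + S.qx x t ^ 2)) (Ioi 0) := by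
  refine ((HI.mk' (S.hi1 t)).mul M).dom ?_ fun x hx => ?_
  · exact (w.c.mul (((S.cpx t).pow 2).add ((S.cqx t).pow 2))).aestronglyMeasurable
  · have := w.nn x
    rw [abs_of_nonneg (by positivity)]
    have := w.M x hx.le
    gcongr

lemma Wt.iX {W W' : ℝ → ℝ} {L M : ℝ} (w : Wt W W' L M) (hL : 0 < L) (t : ℝ) :
    IntegrableOn (fun x => W' x * (S.q x t * S.px x t - S.p x t * S.qx x t)) (Ioi 0) := by
  refine (((HI.mk' (w.iWn S t)).add (HI.mk' (w.iWk S t))).mul (1 / L)).dom ?_ fun x hx => ?_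
  · have h1 := (S.cp t).measurable
    have h2 := (S.cq t).measurable
    have h3 := (S.cpx t).measurable
    have h4 := (S.cqx t).measurable
    have h5 := w.m
    exact Measurable.aestronglyMeasurable (by fun_prop)
  · have h1 := cross_le (S.p x t) (S.q x t) (S.px x t) (S.qx x t) one_pos
    have h2 := w.d' x hx.le
    have h3 := w.nn x
    rw [abs_mul]
    calc _ ≤ W x / L * (1 * (S.p x t ^ 2 + S.q x t ^ 2) + (S.px x t ^ 2 + S.qx x t ^ 2) / 1) := by
          gcongr; linarith [abs_nonneg (S.q x t * S.px x t - S.p x t * S.qx x t)]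
      _ = _ := by ring

lemma mass_der {C s e t L M : ℝ} (hB : S.Bd C (Icc s e)) (ht : t ∈ Icc s e) (hL : 0 < L) {W W' : ℝ → ℝ} (w : Wt W W' L M) :
    HasDerivWithinAt (fun τ => (∫ x in Ioi (0:ℝ), W x * (S.p x τ ^ 2 + S.q x τ ^ 2)) + W 0 * S.Om τ) 
      (-2 * ∫ x in Ioi (0:ℝ), W' x * (S.q x t * S.px x t - S.p x t * S.qx x t)) (Icc s e) t := by
  have hD := hB.reg
  have hM0 : 0 ≤ M := (w.nn 0).trans (w.M 0 le_rfl)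
  have hWM : ∀ᵐ x ∂(volume.restrict (Ioi (0:ℝ))), |W x| ≤ M := by
    filter_upwards [ae_restrict_mem measurableSet_Ioi] with x hx
    rw [abs_of_nonneg (w.nn x)]; exact w.M x (le_of_lt hx)
  have iW2n : HI (fun x => (1 + S.P t + S.K t) * W x ^ 2) _ := (HI.mk' w.i).mul _
  have i1 : IntegrableOn (fun x => (W x * S.p x t) ^ 2) (Ioi 0) := by
    refine iW2n.dom ((w.c.mul (S.cp t)).pow 2).aestronglyMeasurable fun x hx => ?_
    rw [abs_of_nonneg (by positivity), mul_pow, mul_comm]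
    gcongr
    linarith [S.n_sup t hx.le, sq_nonneg (S.q x t)]
  have i2 : IntegrableOn (fun x => (W x * S.q x t) ^ 2) (Ioi 0) := by
    refine iW2n.dom ((w.c.mul (S.cq t)).pow 2).aestronglyMeasurable fun x hx => ?_
    rw [abs_of_nonneg (by positivity), mul_pow, mul_comm]
    gcongr
    linarith [S.n_sup t hx.le, sq_nonneg (S.p x t)]
  have j1 : ∀ τ, IntegrableOn (fun x => W x * S.p x τ ^ 2) (Ioi 0) := fun τ => by
    refine (HI.mk' (w.iWn S τ)).dom (w.c.mul ((S.cp τ).pow 2)).aestronglyMeasurable fun x hx => ?_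
    have := w.nn x
    rw [abs_of_nonneg (by positivity)]
    gcongr
    linarith [sq_nonneg (S.q x τ)]
  have j2 : ∀ τ, IntegrableOn (fun x => W x * S.q x τ ^ 2) (Ioi 0) := fun τ => by
    refine (HI.mk' (w.iWn S τ)).dom (w.c.mul ((S.cq τ).pow 2)).aestronglyMeasurable fun x hx => ?_
    have := w.nn x
    rw [abs_of_nonneg (by positivity)]
    gcongr
    linarith [sq_nonneg (S.p x τ)]
  have d1 := sq_der (I := Icc s e) (fun τ => (S.cp τ).aestronglyMeasurable) (S.mpt t) (S.ipt1 t) (fun x => S.hpt x t)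
      (fun τ hτ => S.lip_p hD ht hτ) w.c.aestronglyMeasurable hM0 hWM i1 (j1 t)
  have d2 := sq_der (I := Icc s e) (fun τ => (S.cq τ).aestronglyMeasurable) (S.mqt t) (S.iqt1 t) (fun x => S.hqt x t)
      (fun τ hτ => S.lip_q hD ht hτ) w.c.aestronglyMeasurable hM0 hWM i2 (j2 t)
  have d3 := (d1.add d2).add ((S.hOm t).const_mul (W 0)).hasDerivWithinAt
  have key : (fun τ => (∫ x in Ioi (0:ℝ), W x * (S.p x τ ^ 2 + S.q x τ ^ 2)) + W 0 * S.Om τ) =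
      ((fun τ => ∫ x in Ioi (0:ℝ), W x * S.p x τ ^ 2) + fun τ => ∫ x in Ioi (0:ℝ), W x * S.q x τ ^ 2) + fun y => W 0 * S.Om y := by
    ext τ
    simp only [Pi.add_apply]
    congr 1
    rw [← integral_add (j1 τ) (j2 τ)]
    congr 1; ext x; ring
  rw [key]
  refine d3.congr_deriv ?_
  have k1 := int_mul ((w.c.mul (S.cp t)).aestronglyMeasurable) (S.mpt t) i1 (S.ipt1 t)
  have k2 := int_mul ((w.c.mul (S.cq t)).aestronglyMeasurable) (S.mqt t) i2 (S.iqt1 t)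
  have k3 := w.iX S hL t
  simp only [Pi.mul_apply] at k1 k2
  have kk := ((HI.mk' k1).add (HI.mk' k2)).add (HI.mk' k3)
  have ftc := integral_Ioi_of_hasDerivAt_of_tendsto (a := (0:ℝ)) (m := 0) (f := fun x => W x * (S.q x t * S.px x t - S.p x t * S.qx x t))
    (f' := fun x => W x * S.p x t * S.pt x t + W x * S.q x t * S.qt x t + W' x * (S.q x t * S.px x t - S.p x t * S.qx x t))
    (Continuous.continuousWithinAt (by
      have h1 := w.c
      have h2 := S.cp t
      have h3 := S.cq t
      have h4 := S.cpx t
      have h5 := S.cqx t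
      fun_prop)) ?_ kk.1 ?_
  · rw [kk.2] at ftc
    have hO := S.Om_pos t
    have b1 := S.bc1 t
    have b2 := S.bc2 t
    have hO2 : -(S.p 0 t * S.pt 0 t + S.q 0 t * S.qt 0 t) / S.Om t = 2 * (S.q 0 t * S.px 0 t - S.p 0 t * S.qx 0 t) := by
      rw [div_eq_iff hO.ne']
      simp only [Om]
      linear_combination (S.q 0 t) * b1 - (S.p 0 t) * b2
    rw [hO2]
    linarith
  · intro x hx
    have hx' := le_of_lt (mem_Ioi.mp hx)
    refine ((w.d x hx').mul (((S.hqx t x).mul (S.hpxx t x)).sub ((S.hpx t x).mul (S.hqxx t x)))).congr_deriv ?_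
    rw [S.eq1 t x hx', S.eq2 t x hx']
    simp only [Pi.mul_apply, Pi.sub_apply]
    ring
  · have h1 : Tendsto (fun x => S.q x t * S.px x t - S.p x t * S.qx x t) atTop (𝓝 0) := by
      simpa using ((S.dq t).mul (S.dpx t)).sub ((S.dp t).mul (S.dqx t))
    have h2 : Tendsto (fun x => M * |S.q x t * S.px x t - S.p x t * S.qx x t|) atTop (𝓝 0) := by
      simpa using h1.abs.const_mul M
    refine squeeze_zero_norm' ?_ h2
    filter_upwards [eventually_ge_atTop 0] with x hx
    rw [Real.norm_eq_abs, abs_mul, abs_of_nonneg (w.nn x)]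
    have := w.M x hx
    gcongr

/-- Cauchy-Schwarz for the weighted mass -/
lemma Wt.cs {W W' : ℝ → ℝ} {L M N R t : ℝ} (w : Wt W W' L M) (hN : 0 < N) (hR : 0 < R) (hWN : ∫ x in Ioi (0:ℝ), W x ^ 2 ≤ N ^ 2)
    (hP : S.P t ≤ R ^ 2) : ∫ x in Ioi (0:ℝ), W x * (S.p x t ^ 2 + S.q x t ^ 2) ≤ N * R := by
  have := (HI.mk' (w.iWn S t)).le (((HI.mk' w.i).mul (R / (2 * N))).add ((HI.mk' (S.hi0 t)).mul (N / (2 * R)))) fun x _ => by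
    have : R / (2 * N) * W x ^ 2 + N / (2 * R) * (S.p x t ^ 2 + S.q x t ^ 2) ^ 2 - W x * (S.p x t ^ 2 + S.q x t ^ 2) = 
      (R * W x - N * (S.p x t ^ 2 + S.q x t ^ 2)) ^ 2 / (2 * N * R) := by field_simp; ring
    have h2 : 0 ≤ (R * W x - N * (S.p x t ^ 2 + S.q x t ^ 2)) ^ 2 / (2 * N * R) := by positivity
    linarith
  refine this.trans ?_
  calc _ ≤ R / (2 * N) * N ^ 2 + N / (2 * R) * R ^ 2 := by
        simp only [P] at hP
        gcongr
    _ = N * R := by field_simp; norm_num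

lemma Wt.dbd {W W' : ℝ → ℝ} {L M N R t θ K : ℝ} (w : Wt W W' L M) (hL : 0 < L) (hθ : 0 < θ) (hN : 0 < N) (hR : 0 < R) (hWN : ∫ x in Ioi (0:ℝ), W x ^ 2 ≤ N ^ 2)
    (hP : S.P t ≤ R ^ 2) (hK : S.K t ≤ K) : 
    |-2 * ∫ x in Ioi (0:ℝ), W' x * (S.q x t * S.px x t - S.p x t * S.qx x t)| ≤ 1 / L * (θ * (N * R) + M * K / θ) := by
  have h1 := w.cs S hN hR hWN hP
  have hM0 : 0 ≤ M := (w.nn 0).trans (w.M 0 le_rfl)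
  have hi := HI.mk' (w.iX S hL t)
  have hi' := (HI.mk' (w.iX S hL t).abs).mul 2
  have h2 := hi'.le ((((HI.mk' (w.iWn S t)).mul θ).add ((HI.mk' (S.hi1 t)).mul (M / θ))).mul (1 / L)) fun x hx => by
    have g1 := cross_le (S.p x t) (S.q x t) (S.px x t) (S.qx x t) hθ
    have g2 := w.d' x hx.le
    have g3 := w.nn x
    have g4 := w.M x hx.le
    rw [abs_mul]
    calc _ = |W' x| * (2 * |S.q x t * S.px x t - S.p x t * S.qx x t|) := by ring
      _ ≤ W x / L * (θ * (S.p x t ^ 2 + S.q x t ^ 2) + (S.px x t ^ 2 + S.qx x t ^ 2) / θ) := by gcongr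
      _ = 1 / L * (θ * (W x * (S.p x t ^ 2 + S.q x t ^ 2)) + W x / θ * (S.px x t ^ 2 + S.qx x t ^ 2)) := by ring
      _ ≤ _ := by gcongr
  have h3 := abs_integral_le_integral_abs (f := fun x => W' x * (S.q x t * S.px x t - S.p x t * S.qx x t)) (μ := volume.restrict (Ioi 0))
  rw [abs_mul]
  calc _ ≤ 2 * ∫ x in Ioi (0:ℝ), |W' x * (S.q x t * S.px x t - S.p x t * S.qx x t)| := by
        rw [abs_neg, abs_two]; gcongr
    _ ≤ _ := h2
    _ ≤ _ := by
        simp only [Sol.K] at hK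
        have : M * K / θ = M / θ * K := by ring
        rw [this]
        gcongr

end Sol
end HL

namespace HL
open MeasureTheory Filter Set Topology
namespace Sol
variable {a b : ℝ} (S : Sol a b)

lemma Om_le (t : ℝ) : S.Om t ≤ 2 * |b| := by
  have h1 := S.Om_sq t
  have h2 := S.Om_pos t
  refine abs_le_of_sq_le_sq' ?_ (by positivity) |>.2
  rw [mul_pow, sq_abs, h1]
  nlinarith [sq_nonneg (S.p 0 t), sq_nonneg (S.q 0 t)]

lemma P_step {C0 s e r R0 : ℝ} (hse : s ≤ e) (he : e ≤ s + 1) (hB : S.Bd C0 (Icc s e)) (hr : 1 ≤ r)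
    (hP : ∀ τ ∈ Icc s e, S.P τ ≤ r ^ 30) (hK : ∀ τ ∈ Icc s e, S.K τ ≤ 2 * r ^ 30) (hR0 : 0 < R0) (hs : S.P s ≤ R0 ^ 2) :
    S.P e ≤ r ^ 29 * (8 * R0 + 14 * |b| + 22) := by
  have hr0 : 0 < r := by linarith
  have hse' : s ∈ Icc s e := ⟨le_rfl, hse⟩
  have hee' : e ∈ Icc s e := ⟨hse, le_rfl⟩
  have hpw : ∀ {i j : ℕ}, i ≤ j → r ^ i ≤ r ^ j := fun h => pow_le_pow_right₀ hr h
  have hf : ∀ x, HasDerivAt (fun y => (S.p y e ^ 2 + S.q y e ^ 2) ^ 2) 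
      (2 * (S.p x e ^ 2 + S.q x e ^ 2) * (2 * S.p x e * S.px x e + 2 * S.q x e * S.qx x e)) x := fun x =>
    ((S.hn e x).fun_pow 2).congr_deriv (by simp)
  have h1 := S.cp e
  have h2 := S.cq e
  have h3 := S.cpx e
  have h4 := S.cqx e
  have hfc : Continuous fun x => (2 * (S.p x e ^ 2 + S.q x e ^ 2) * (2 * S.p x e * S.px x e + 2 * S.q x e * S.qx x e)) := by
    fun_prop
  have hlim : Tendsto (fun y => (S.p y e ^ 2 + S.q y e ^ 2) ^ 2) atTop (𝓝 0) := by
    simpa using (((S.dp e).pow 2).add ((S.dq e).pow 2)).pow 2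
  have dom := ((HI.mk' (S.hi0 e)).mul (1 / r ^ 18 + 2 * r ^ 10)).add ((HI.mk' (S.hi1 e)).mul (8 * r ^ 10))
  have hle : ∀ x, 0 < x → (S.p x e ^ 2 + S.q x e ^ 2) ^ 2 / r ^ 18 + 
     |2 * (S.p x e ^ 2 + S.q x e ^ 2) * (2 * S.p x e * S.px x e + 2 * S.q x e * S.qx x e)| ≤ 
     (1 / r ^ 18 + 2 * r ^ 10) * (S.p x e ^ 2 + S.q x e ^ 2) ^ 2 + 8 * r ^ 10 * (S.px x e ^ 2 + S.qx x e ^ 2) := by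
    intro x hx
    have g1 := dot_le (S.p x e) (S.q x e) (S.px x e) (S.qx x e) (θ := r ^ 10) (by positivity)
    have g2 := S.n_sup2 e hx.le hr0 (hP e hee') (hK e hee')
    rw [abs_mul, abs_of_nonneg (by positivity)]
    calc _ ≤ (S.p x e ^ 2 + S.q x e ^ 2) ^ 2 / r ^ 18 + 2 * (S.p x e ^ 2 + S.q x e ^ 2) * (r ^ 10 * (S.p x e ^ 2 + S.q x e ^ 2) + (S.px x e ^ 2 + S.qx x e ^ 2) / r ^ 10) := by gcongr
      _ = (1 / r ^ 18 + 2 * r ^ 10) * (S.p x e ^ 2 + S.q x e ^ 2) ^ 2 + 2 * (S.p x e ^ 2 + S.q x e ^ 2) * ((S.px x e ^ 2 + S.qx x e ^ 2) / r ^ 10) := by ring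
      _ ≤ (1 / r ^ 18 + 2 * r ^ 10) * (S.p x e ^ 2 + S.q x e ^ 2) ^ 2 + 2 * (4 * r ^ 20) * ((S.px x e ^ 2 + S.qx x e ^ 2) / r ^ 10) := by gcongr
      _ = _ := by field_simp; ring
  have hgi : IntegrableOn (fun x => (S.p x e ^ 2 + S.q x e ^ 2) ^ 2 / r ^ 18 + 
     |2 * (S.p x e ^ 2 + S.q x e ^ 2) * (2 * S.p x e * S.px x e + 2 * S.q x e * S.qx x e)|) (Ioi 0) := by
    refine dom.dom (Continuous.aestronglyMeasurable (by fun_prop)) fun x hx => ?_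
    rw [abs_of_nonneg (by positivity)]
    exact hle x hx
  have hJ : ∫ x in Ioi (0:ℝ), ((S.p x e ^ 2 + S.q x e ^ 2) ^ 2 / r ^ 18 + 
     |2 * (S.p x e ^ 2 + S.q x e ^ 2) * (2 * S.p x e * S.px x e + 2 * S.q x e * S.qx x e)|) ≤ 19 * r ^ 40 := by
    refine ((HI.mk' hgi).le dom hle).trans ?_
    have e1 := hP e hee'
    have e2 := hK e hee'
    simp only [P, K] at e1 e2
    calc _ ≤ (1 / r ^ 18 + 2 * r ^ 10) * r ^ 30 + 8 * r ^ 10 * (2 * r ^ 30) := by gcongr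
      _ = r ^ 12 + 18 * r ^ 40 := by field_simp; ring
      _ ≤ 19 * r ^ 40 := by linarith [hpw (show 12 ≤ 40 by norm_num)]
  obtain ⟨W, W', w1, w2, w3, w4, w5, w6, w7, w8, w9⟩ := kernel hf hfc (fun x => by positivity) hlim (L := r ^ 18) (by positivity) hgi hJ
  have o40 : 1 ≤ r ^ 40 := one_le_pow₀ hr
  have w : Wt W W' (r ^ 18) (7 * r ^ 20) := by
    refine ⟨w1, w2, w3, w4, w5, fun x hx => ?_, w8⟩
    refine (sq_le_sq₀ (w4 x) (by positivity)).mp ((w6 x hx).trans ?_)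
    rw [mul_pow, ← pow_mul]; norm_num; linarith
  have hN : ∫ x in Ioi (0:ℝ), W x ^ 2 ≤ (8 * r ^ 29) ^ 2 := by
    refine w9.trans ?_
    rw [mul_pow, ← pow_mul]
    norm_num
    have : 3 * r ^ 18 * (19 * r ^ 40) = 57 * r ^ 58 := by ring
    rw [this]
    linarith [hpw (show 18 ≤ 58 by norm_num), pow_pos hr0 58]
  have hbd : ∀ t ∈ Icc s e, ‖-2 * ∫ x in Ioi (0:ℝ), W' x * (S.q x t * S.px x t - S.p x t * S.qx x t)‖ ≤ 22 * r ^ 29 := by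
    intro t ht
    have := w.dbd S (θ := r ^ 3) (N := 8 * r ^ 29) (R := r ^ 15) (by positivity) (by positivity) (by positivity) (by positivity) hN
      ((hP t ht).trans (le_of_eq (by ring))) (hK t ht)
    refine this.trans (le_of_eq ?_)
    field_simp; ring
  have mv := (convex_Icc s e).norm_image_sub_le_of_norm_hasDerivWithin_le (fun t ht => S.mass_der hB ht (by positivity) w) hbd hse' hee'
  have c1 := w.cs S (by positivity) hR0 hN hs
  have c2 : S.P e ≤ ∫ x in Ioi (0:ℝ), W x * (S.p x e ^ 2 + S.q x e ^ 2) := by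
    refine (HI.mk' (S.hi0 e)).le (HI.mk' (w.iWn S e)) fun x hx => ?_
    have : S.p x e ^ 2 + S.q x e ^ 2 ≤ W x := (sq_le_sq₀ (by positivity) (w4 x)).mp (w7 x hx.le)
    rw [sq]; gcongr
  have m1 := (le_abs_self _).trans mv
  have c3 : W 0 * S.Om s ≤ 7 * r ^ 20 * (2 * |b|) := mul_le_mul (w.M 0 le_rfl) (S.Om_le s) (S.Om_pos s).le (by positivity)
  have c4 : 0 ≤ W 0 * S.Om e := mul_nonneg (w4 0) (S.Om_pos e).le
  have c5 : 22 * r ^ 29 * ‖e - s‖ ≤ 22 * r ^ 29 := by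
    rw [Real.norm_eq_abs, abs_of_nonneg (by linarith)]
    exact mul_le_of_le_one_right (by positivity) (by linarith)
  have c6 : r ^ 20 * |b| ≤ r ^ 29 * |b| := by gcongr <;> first | exact hr | norm_num
  linarith

noncomputable def Gm (a b : ℝ) : ℝ := 4 * (4 * b ^ 2 / 6 + a ^ 2 + b ^ 2 / 3) * (2 * |b|)

lemma G_abs (t : ℝ) : |S.G t| ≤ Gm a b := by
  simp only [G, Gm]
  have h1 := S.hb t
  rw [abs_mul, abs_mul, abs_of_pos (S.Om_pos t)]
  have h2 := S.Om_le t
  have h3 := S.Om_pos t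
  have h4 : |(S.p 0 t ^ 2 + S.q 0 t ^ 2) / 6 - a ^ 2 + b ^ 2 / 3| ≤ 4 * b ^ 2 / 6 + a ^ 2 + b ^ 2 / 3 := by
    rw [abs_le]
    constructor <;> nlinarith [sq_nonneg a, sq_nonneg b, sq_nonneg (S.p 0 t), sq_nonneg (S.q 0 t)]
  rw [abs_of_pos (by norm_num : (0:ℝ) < 4)]
  gcongr

noncomputable def rPK (a b C : ℝ) : ℝ := 1 + 2 * Gm a b + C + (8 * (1 + C) + 14 * |b| + 22)

lemma PK_bound {C C0 s e : ℝ} (hC : 0 ≤ C) (hse : s ≤ e) (he : e ≤ s + 1) (hB : S.Bd C0 (Icc s e)) (hP : S.P s ≤ C) (hK : S.K s ≤ C) :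
    ∀ τ ∈ Icc s e, S.P τ ≤ 2 * rPK a b C ^ 30 ∧ S.K τ ≤ 2 * rPK a b C ^ 30 := by
  have hGm : 0 ≤ Gm a b := by unfold Gm; positivity
  set r := rPK a b C with hr
  have hbb := abs_nonneg b
  have hr1 : 1 ≤ r := by rw [hr, rPK]; linarith
  have hrZ : 8 * (1 + C) + 14 * |b| + 22 ≤ r := by rw [hr, rPK]; linarith
  have hrE : 2 * Gm a b + C ≤ r := by rw [hr, rPK]; linarith
  have hKP : ∀ τ ∈ Icc s e, S.K τ ≤ S.P τ + (2 * Gm a b + C) := by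
    intro τ hτ
    have h1 := S.H_const hτ.1 (hB.mono (Icc_subset_Icc_right hτ.2))
    simp only [H] at h1
    have h2 := abs_le.mp (S.G_abs τ)
    have h3 := abs_le.mp (S.G_abs s)
    linarith [S.P0 s]
  have hbdd : BddAbove (Set.image S.P (Icc s e)) := ⟨C0, by rintro _ ⟨τ, hτ, rfl⟩; exact (hB τ hτ).1⟩
  set Q := sSup (Set.image S.P (Icc s e)) with hQ
  have hPQ : ∀ τ ∈ Icc s e, S.P τ ≤ Q := fun τ hτ => le_csSup hbdd ⟨τ, hτ, rfl⟩
  set ρ := (max Q (r ^ 30)) ^ ((1:ℝ) / 30) with hρ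
  have hmx : 0 ≤ max Q (r ^ 30) := le_max_of_le_right (by positivity)
  have hρ30 : ρ ^ 30 = max Q (r ^ 30) := by
    rw [hρ, ← Real.rpow_natCast, ← Real.rpow_mul hmx]; norm_num
  have hρ0 : 0 ≤ ρ := Real.rpow_nonneg hmx _
  have hrρ : r ≤ ρ := by
    refine (pow_le_pow_iff_left₀ (by linarith) hρ0 (n := 30) (by norm_num)).mp ?_
    rw [hρ30]; exact le_max_right _ _
  have hstep : ∀ τ ∈ Icc s e, S.P τ ≤ ρ ^ 29 * r := by
    intro τ hτ
    have hsub : Icc s τ ⊆ Icc s e := Icc_subset_Icc_right hτ.2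
    refine (S.P_step hτ.1 (hτ.2.trans he) (hB.mono hsub) (hr1.trans hrρ) ?_ ?_ (R0 := 1 + C) (by linarith) (hP.trans (by nlinarith))).trans ?_
    · intro σ hσ; rw [hρ30]; exact (hPQ σ (hsub hσ)).trans (le_max_left _ _)
    · intro σ hσ
      have h1 := hKP σ (hsub hσ)
      have h2 : S.P σ ≤ ρ ^ 30 := by rw [hρ30]; exact (hPQ σ (hsub hσ)).trans (le_max_left _ _)
      have h3 : r ≤ ρ ^ 30 := by
        rw [hρ30]; refine le_trans ?_ (le_max_right _ _)
        exact le_self_pow₀ hr1 (by norm_num)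
      linarith
    · gcongr
  have hQle : Q ≤ ρ ^ 29 * r := csSup_le ⟨_, s, ⟨le_rfl, hse⟩, rfl⟩ (by rintro _ ⟨τ, hτ, rfl⟩; exact hstep τ hτ)
  have hQr : Q ≤ r ^ 30 := by
    by_contra hlt
    push Not at hlt
    rw [max_eq_left hlt.le] at hρ30
    have hρp : 0 < ρ := by linarith
    have h1 : ρ ^ 29 * ρ ≤ ρ ^ 29 * r := by rw [← pow_succ, hρ30]; exact hQle
    have h2 : ρ ≤ r := le_of_mul_le_mul_left h1 (by positivity)
    have h3 : ρ ^ 30 ≤ r ^ 30 := by gcongr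
    linarith
  intro τ hτ
  have h1 := (hPQ τ hτ).trans hQr
  have h2 : r ≤ r ^ 30 := le_self_pow₀ hr1 (by norm_num)
  exact ⟨by linarith, by linarith [hKP τ hτ]⟩

end Sol
end HL

namespace HL
open MeasureTheory Filter Set Topology

lemma gron {Y Y' : ℝ → ℝ} {s e α β : ℝ} (hse : s ≤ e) (hα : 0 ≤ α) (hβ : 0 ≤ β)
    (hY : ∀ t ∈ Icc s e, HasDerivWithinAt Y (Y' t) (Icc s e) t) (hle : ∀ t ∈ Icc s e, Y' t ≤ α * Y t + β) :
    Y e ≤ Real.exp (α * (e - s)) * (Y s + β * (e - s)) := by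
  set Φ : ℝ → ℝ := fun t => Real.exp (-(α * (t - s))) * Y t - β * (t - s) with hΦ
  have hd : ∀ t ∈ Icc s e, HasDerivWithinAt Φ (Real.exp (-(α * (t - s))) * (Y' t - α * Y t) - β) (Icc s e) t := by
    intro t ht
    have h1 : HasDerivAt (fun t => Real.exp (-(α * (t - s)))) (Real.exp (-(α * (t - s))) * (-(α * 1))) t :=
      ((((hasDerivAt_id t).sub_const s).const_mul α).neg).exp
    have h2 : HasDerivAt (fun t => β * (t - s)) (β * 1) t := ((hasDerivAt_id t).sub_const s).const_mul β
    refine ((h1.hasDerivWithinAt.mul (hY t ht)).sub h2.hasDerivWithinAt).congr_deriv ?_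
    ring
  have ha : AntitoneOn Φ (Icc s e) := by
    refine antitoneOn_of_deriv_nonpos (convex_Icc s e) (fun t ht => (hd t ht).continuousWithinAt) ?_ ?_
    · intro t ht
      rw [interior_Icc] at ht
      exact ((hd t (Ioo_subset_Icc_self ht)).mono Ioo_subset_Icc_self).differentiableWithinAt.mono (by rw [interior_Icc])
    · intro t ht
      rw [interior_Icc] at ht
      rw [((hd t (Ioo_subset_Icc_self ht)).hasDerivAt (Icc_mem_nhds ht.1 ht.2)).deriv]
      have h1 := hle t (Ioo_subset_Icc_self ht)
      have h2 : Real.exp (-(α * (t - s))) ≤ 1 := Real.exp_le_one_iff.mpr (by have := mul_nonneg hα (sub_nonneg.mpr ht.1.le); linarith)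
      have h3 : Real.exp (-(α * (t - s))) * (Y' t - α * Y t) ≤ Real.exp (-(α * (t - s))) * β := by gcongr; linarith
      have h4 := mul_le_of_le_one_left hβ h2
      linarith
  have h := ha ⟨le_rfl, hse⟩ ⟨hse, le_rfl⟩ hse
  simp only [hΦ, sub_self, mul_zero, neg_zero, Real.exp_zero, one_mul, sub_zero] at h
  have h5 : Real.exp (-(α * (e - s))) * Y e ≤ Y s + β * (e - s) := by linarith
  calc Y e = Real.exp (α * (e - s)) * (Real.exp (-(α * (e - s))) * Y e) := by
        rw [← mul_assoc, ← Real.exp_add]; simp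
    _ ≤ _ := by gcongr

namespace Sol
variable {a b : ℝ} (S : Sol a b)

/-- boundary form of the difference of two times -/
def be (t1 t2 : ℝ) : ℝ := -2 * ((S.q 0 t1 - S.q 0 t2) * (S.px 0 t1 - S.px 0 t2) - (S.p 0 t1 - S.p 0 t2) * (S.qx 0 t1 - S.qx 0 t2))

noncomputable def Z (t1 t2 : ℝ) : ℝ := ∫ x in Ioi (0:ℝ), ((S.p x t1 - S.p x t2) ^ 2 + (S.q x t1 - S.q x t2) ^ 2)

lemma diff_est {ν t1 t2 : ℝ} (h1 : ∀ x, 0 ≤ x → S.p x t1 ^ 2 + S.q x t1 ^ 2 ≤ ν) (h2 : ∀ x, 0 ≤ x → S.p x t2 ^ 2 + S.q x t2 ^ 2 ≤ ν)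
    (i1 : IntegrableOn (fun x => (S.p x t1 - S.p x t2) ^ 2) (Ioi 0)) (i2 : IntegrableOn (fun x => (S.q x t1 - S.q x t2) ^ 2) (Ioi 0)) :
    2 * (∫ x in Ioi (0:ℝ), (S.p x t1 - S.p x t2) * (S.pt x t1 - S.pt x t2)) 
      + 2 * (∫ x in Ioi (0:ℝ), (S.q x t1 - S.q x t2) * (S.qt x t1 - S.qt x t2)) ≤ S.be t1 t2 + 8 * ν * S.Z t1 t2 := by
  have mw1 : AEStronglyMeasurable (fun x => S.p x t1 - S.p x t2) (volume.restrict (Ioi 0)) :=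
    ((S.cp t1).sub (S.cp t2)).aestronglyMeasurable
  have mw2 : AEStronglyMeasurable (fun x => S.q x t1 - S.q x t2) (volume.restrict (Ioi 0)) :=
    ((S.cq t1).sub (S.cq t2)).aestronglyMeasurable
  have k1 := int_mul mw1 ((S.mpt t1).sub (S.mpt t2)) i1 (int_sq_sub (S.mpt t1) (S.mpt t2) (S.ipt1 t1) (S.ipt1 t2))
  have k2 := int_mul mw2 ((S.mqt t1).sub (S.mqt t2)) i2 (int_sq_sub (S.mqt t1) (S.mqt t2) (S.iqt1 t1) (S.iqt1 t2))
  have mp := (S.mpxx t1).aestronglyMeasurable (μ := volume.restrict (Ioi 0))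
  have mp' := (S.mpxx t2).aestronglyMeasurable (μ := volume.restrict (Ioi 0))
  have mq := (S.mqxx t1).aestronglyMeasurable (μ := volume.restrict (Ioi 0))
  have mq' := (S.mqxx t2).aestronglyMeasurable (μ := volume.restrict (Ioi 0))
  have l1 := int_mul mw2 (mp.sub mp') i2 (int_sq_sub mp mp' (S.ipxx t1) (S.ipxx t2))
  have l2 := int_mul mw1 (mq.sub mq') i1 (int_sq_sub mq mq' (S.iqxx t1) (S.iqxx t2))
  simp only [Pi.sub_apply] at k1 k2 l1 l2
  have kk := (HI.mk' l1).sub (HI.mk' l2)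
  have ftc := integral_Ioi_of_hasDerivAt_of_tendsto' (a := (0:ℝ)) (m := 0) 
    (f := fun x => (S.q x t1 - S.q x t2) * (S.px x t1 - S.px x t2) - (S.p x t1 - S.p x t2) * (S.qx x t1 - S.qx x t2))
    (f' := fun x => (S.q x t1 - S.q x t2) * (S.pxx x t1 - S.pxx x t2) - (S.p x t1 - S.p x t2) * (S.qxx x t1 - S.qxx x t2))
    (fun x _ => ?_) kk.1 ?_
  · rw [kk.2] at ftc
    have i12 := (HI.mk' i1).add (HI.mk' i2)
    have hZ : S.Z t1 t2 = _ := i12.2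
    have main := (((HI.mk' k1).mul 2).add ((HI.mk' k2).mul 2)).le ((kk.mul 2).add (i12.mul (8 * ν))) fun x hx => by
      have g1 := h1 x hx.le
      have g2 := h2 x hx.le
      rw [S.eq1 t1 x hx.le, S.eq2 t1 x hx.le, S.eq1 t2 x hx.le, S.eq2 t2 x hx.le]
      generalize S.p x t1 = p' at *
      generalize S.q x t1 = q' at *
      generalize S.p x t2 = p at *
      generalize S.q x t2 = q at *
      have e1 : ((p + p') * (p' - p) + (q + q') * (q' - q)) ^ 2 ≤ 4 * ν * ((p' - p) ^ 2 + (q' - q) ^ 2) := by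
        have h1 : ((p + p') * (p' - p) + (q + q') * (q' - q)) ^ 2 ≤ ((p + p') ^ 2 + (q + q') ^ 2) * ((p' - p) ^ 2 + (q' - q) ^ 2) := by
          nlinarith [sq_nonneg ((p + p') * (q' - q) - (q + q') * (p' - p))]
        have h2 : (p + p') ^ 2 + (q + q') ^ 2 ≤ 4 * ν := by nlinarith [sq_nonneg (p - p'), sq_nonneg (q - q')]
        refine h1.trans (mul_le_mul_of_nonneg_right h2 (by positivity))
      have e2 : (p * (q' - q) - q * (p' - p)) ^ 2 ≤ ν * ((p' - p) ^ 2 + (q' - q) ^ 2) := by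
        have h1 : (p * (q' - q) - q * (p' - p)) ^ 2 ≤ (p ^ 2 + q ^ 2) * ((p' - p) ^ 2 + (q' - q) ^ 2) := by
          nlinarith [sq_nonneg (p * (p' - p) + q * (q' - q))]
        refine h1.trans (mul_le_mul_of_nonneg_right g2 (by positivity))
      have e3 := sq_nonneg (((p + p') * (p' - p) + (q + q') * (q' - q)) - 2 * (p * (q' - q) - q * (p' - p)))
      nlinarith
    rw [hZ]
    simp only [be]
    linarith
  · exact (((S.hqx t1 x).sub (S.hqx t2 x)).mul ((S.hpxx t1 x).sub (S.hpxx t2 x))).sub 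
      (((S.hpx t1 x).sub (S.hpx t2 x)).mul ((S.hqxx t1 x).sub (S.hqxx t2 x))) |>.congr_deriv (by simp; ring)
  · simpa using (((S.dq t1).sub (S.dq t2)).mul ((S.dpx t1).sub (S.dpx t2))).sub 
      (((S.dp t1).sub (S.dp t2)).mul ((S.dqx t1).sub (S.dqx t2)))

lemma Z_eq {D s e t1 t2 : ℝ} (hD : S.Reg D (Icc s e)) (h1 : t1 ∈ Icc s e) (h2 : t2 ∈ Icc s e) :
    S.Z t1 t2 = (∫ x in Ioi (0:ℝ), (S.p x t1 - S.p x t2) ^ 2) + ∫ x in Ioi (0:ℝ), (S.q x t1 - S.q x t2) ^ 2 :=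
  integral_add (S.lip_p hD h2 h1).1 (S.lip_q hD h2 h1).1

/-- derivative of the squared distance between `u (t+h)` and `u t` -/
lemma dy {D s e h t : ℝ} (hD : S.Reg D (Icc s e)) (hh : 0 ≤ h) (ht : t ∈ Icc s (e - h)) :
    HasDerivWithinAt (fun τ => S.Z (τ + h) τ) (2 * (∫ x in Ioi (0:ℝ), (S.p x (t + h) - S.p x t) * (S.pt x (t + h) - S.pt x t)) 
      + 2 * (∫ x in Ioi (0:ℝ), (S.q x (t + h) - S.q x t) * (S.qt x (t + h) - S.qt x t))) (Icc s (e - h)) t := by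
  have sub1 : ∀ τ ∈ Icc s (e - h), τ ∈ Icc s e := fun τ hτ => ⟨hτ.1, by linarith [hτ.2]⟩
  have sub2 : ∀ τ ∈ Icc s (e - h), τ + h ∈ Icc s e := fun τ hτ => ⟨by linarith [hτ.1], by linarith [hτ.2]⟩
  have aux : ∀ (F Ft : ℝ → ℝ → ℝ), (∀ τ, Continuous fun x => F x τ) → (∀ x t, HasDerivAt (fun s => F x s) (Ft x t) t) →
      (∀ τ, AEStronglyMeasurable (fun x => Ft x τ) (volume.restrict (Ioi 0))) → (∀ τ, IntegrableOn (fun x => Ft x τ ^ 2) (Ioi 0)) →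
      (∀ t1 ∈ Icc s e, ∀ t2 ∈ Icc s e, IntegrableOn (fun x => (F x t2 - F x t1) ^ 2) (Ioi 0) ∧
      ∫ x in Ioi (0:ℝ), (F x t2 - F x t1) ^ 2 ≤ D * (t2 - t1) ^ 2) → 
      HasDerivWithinAt (fun τ => ∫ x in Ioi (0:ℝ), (F x (τ + h) - F x τ) ^ 2) 
        (2 * ∫ x in Ioi (0:ℝ), (F x (t + h) - F x t) * (Ft x (t + h) - Ft x t)) (Icc s (e - h)) t := by
    intro F Ft hc hd hm hi hl
    have := sq_der (μ := volume.restrict (Ioi (0:ℝ))) (I := Icc s (e - h)) (t := t) (D := 4 * D) (M := 1) (f := fun x τ => F x (τ + h) - F x τ) 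
      (ft := fun x => Ft x (t + h) - Ft x t) (W := fun _ => 1) (fun τ => ((hc (τ + h)).sub (hc τ)).aestronglyMeasurable)
      ((hm (t + h)).sub (hm t)) (int_sq_sub (hm (t + h)) (hm t) (hi _) (hi _)) 
      (fun x => ((hd x (t + h)).comp_add_const t h).sub (hd x t)) ?_ aestronglyMeasurable_const zero_le_one 
      (ae_of_all _ fun _ => by simp) (by simp only [one_mul]; exact (hl t (sub1 t ht) (t + h) (sub2 t ht)).1)
      (by simp only [one_mul]; exact (hl t (sub1 t ht) (t + h) (sub2 t ht)).1)
    · simpa using this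
    · intro τ hτ
      obtain ⟨a1, a2⟩ := hl _ (sub2 t ht) _ (sub2 τ hτ)
      obtain ⟨b1, b2⟩ := hl _ (sub1 t ht) _ (sub1 τ hτ)
      have r := ((HI.mk' a1).mul 2).add ((HI.mk' b1).mul 2)
      have hle : ∀ x, (F x (τ + h) - F x τ - (F x (t + h) - F x t)) ^ 2 ≤ 2 * (F x (τ + h) - F x (t + h)) ^ 2 + 2 * (F x τ - F x t) ^ 2 := by
        intro x
        nlinarith [sq_nonneg ((F x (τ + h) - F x (t + h)) + (F x τ - F x t))]
      have li : IntegrableOn (fun x => (F x (τ + h) - F x τ - (F x (t + h) - F x t)) ^ 2) (Ioi 0) := by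
        refine r.dom ?_ fun x _ => ?_
        · exact (((((hc (τ + h)).sub (hc τ)).sub ((hc (t + h)).sub (hc t)))).pow 2).aestronglyMeasurable
        · rw [abs_of_nonneg (by positivity)]; exact hle x
      refine ⟨li, ((HI.mk' li).le r fun x _ => hle x).trans ?_⟩
      have : τ + h - (t + h) = τ - t := by ring
      rw [this] at a2
      linarith
  have d1 := aux S.p S.pt S.cp S.hpt S.mpt S.ipt1 (fun t1 h1 t2 h2 => S.lip_p hD h1 h2)
  have d2 := aux S.q S.qt S.cq S.hqt S.mqt S.iqt1 (fun t1 h1 t2 h2 => S.lip_q hD h1 h2)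
  refine (d1.add d2).congr (fun τ hτ => ?_) ?_
  · exact S.Z_eq hD (sub2 τ hτ) (sub1 τ hτ)
  · exact S.Z_eq hD (sub2 t ht) (sub1 t ht)

/-- derivative of the squared distance between `u t` and `u s` -/
lemma dz {D s e t : ℝ} (hD : S.Reg D (Icc s e)) (ht : t ∈ Icc s e) :
    HasDerivWithinAt (fun τ => S.Z τ s) (2 * (∫ x in Ioi (0:ℝ), (S.p x t - S.p x s) * S.pt x t) 
      + 2 * (∫ x in Ioi (0:ℝ), (S.q x t - S.q x s) * S.qt x t)) (Icc s e) t := by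
  have hs : s ∈ Icc s e := ⟨le_rfl, ht.1.trans ht.2⟩
  have aux : ∀ (F Ft : ℝ → ℝ → ℝ), (∀ τ, Continuous fun x => F x τ) → (∀ x t, HasDerivAt (fun s => F x s) (Ft x t) t) →
      (∀ τ, AEStronglyMeasurable (fun x => Ft x τ) (volume.restrict (Ioi 0))) → (∀ τ, IntegrableOn (fun x => Ft x τ ^ 2) (Ioi 0)) →
      (∀ t1 ∈ Icc s e, ∀ t2 ∈ Icc s e, IntegrableOn (fun x => (F x t2 - F x t1) ^ 2) (Ioi 0) ∧
      ∫ x in Ioi (0:ℝ), (F x t2 - F x t1) ^ 2 ≤ D * (t2 - t1) ^ 2) → 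
      HasDerivWithinAt (fun τ => ∫ x in Ioi (0:ℝ), (F x τ - F x s) ^ 2) 
        (2 * ∫ x in Ioi (0:ℝ), (F x t - F x s) * Ft x t) (Icc s e) t := by
    intro F Ft hc hd hm hi hl
    have := sq_der (μ := volume.restrict (Ioi (0:ℝ))) (I := Icc s e) (t := t) (D := D) (M := 1) (f := fun x τ => F x τ - F x s) 
      (ft := fun x => Ft x t) (W := fun _ => 1) (fun τ => ((hc τ).sub (hc s)).aestronglyMeasurable)
      (hm t) (hi _) 
      (fun x => (hd x t).sub_const _) (fun τ hτ => by simp only [sub_sub_sub_cancel_right]; exact hl t ht τ hτ) aestronglyMeasurable_const zero_le_one 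
      (ae_of_all _ fun _ => by simp) (by simp only [one_mul]; exact (hl s hs t ht).1)
      (by simp only [one_mul]; exact (hl s hs t ht).1)
    simpa using this
  have d1 := aux S.p S.pt S.cp S.hpt S.mpt S.ipt1 (fun t1 h1 t2 h2 => S.lip_p hD h1 h2)
  have d2 := aux S.q S.qt S.cq S.hqt S.mqt S.iqt1 (fun t1 h1 t2 h2 => S.lip_q hD h1 h2)
  refine (d1.add d2).congr (fun τ hτ => ?_) ?_
  · exact S.Z_eq hD hτ hs
  · exact S.Z_eq hD ht hs

end Sol
end HL

namespace HL
open MeasureTheory Filter Set Topology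
namespace Sol
variable {a b : ℝ} (S : Sol a b)

/-- uniform control of the boundary values on a time window -/
structure BX (B X s e : ℝ) : Prop where
  hB : 1 + 4 * a ^ 2 + 4 * b ^ 2 ≤ B
  hO : ∀ τ ∈ Icc s e, 1 ≤ B * S.Om τ
  hX : 1 ≤ X
  h1 : ∀ τ ∈ Icc s e, |S.pt 0 τ| ≤ X
  h2 : ∀ τ ∈ Icc s e, |S.qt 0 τ| ≤ X

variable {S}
variable {B X s e : ℝ}

lemma BX.B1 (h : S.BX B X s e) : 1 ≤ B := by nlinarith [h.hB, sq_nonneg a, sq_nonneg b]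

lemma BX.n0 (h : S.BX B X s e) (t : ℝ) : S.p 0 t ^ 2 + S.q 0 t ^ 2 ≤ B := by nlinarith [h.hB, sq_nonneg a, S.hb t]

lemma BX.p0 (h : S.BX B X s e) (t : ℝ) : |S.p 0 t| ≤ B := by
  have := h.B1
  exact abs_le_of_sq_le_sq (by nlinarith [h.n0 t, sq_nonneg (S.q 0 t)]) (by linarith)
lemma BX.q0 (h : S.BX B X s e) (t : ℝ) : |S.q 0 t| ≤ B := by
  have := h.B1
  exact abs_le_of_sq_le_sq (by nlinarith [h.n0 t, sq_nonneg (S.p 0 t)]) (by linarith)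

lemma BX.lam (h : S.BX B X s e) (t : ℝ) : |4 * (a ^ 2 + b ^ 2) - 2 * (S.p 0 t ^ 2 + S.q 0 t ^ 2)| ≤ 2 * B := by
  have := h.B1
  have := h.hB
  have := h.n0 t
  rw [abs_le]; constructor
  · nlinarith [sq_nonneg a, sq_nonneg b]
  · nlinarith [sq_nonneg (S.p 0 t), sq_nonneg (S.q 0 t)]

lemma BX.px (h : S.BX B X s e) {t : ℝ} (ht : t ∈ Icc s e) : |S.px 0 t| ≤ 2 * B ^ 3 * X := by
  have hB := h.B1
  have hX := h.hX
  have hO := h.hO t ht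
  have hOp := S.Om_pos t
  have e1 : 2 * S.Om t * S.px 0 t = - S.qt 0 t - (4 * (a ^ 2 + b ^ 2) - 2 * (S.p 0 t ^ 2 + S.q 0 t ^ 2)) * S.p 0 t := by
    have := S.bc1 t; simp only [Om]; linarith
  have e2 : 2 * S.Om t * |S.px 0 t| ≤ X + 2 * B * B := by
    have : |2 * S.Om t * S.px 0 t| = 2 * S.Om t * |S.px 0 t| := by rw [abs_mul, abs_of_pos (by positivity)]
    rw [← this, e1]
    refine (abs_sub _ _).trans (add_le_add (by rw [abs_neg]; exact h.h2 t ht) ?_)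
    rw [abs_mul]
    exact mul_le_mul (h.lam t) (h.p0 t) (abs_nonneg _) (by linarith)
  have e3 : X + 2 * B * B ≤ 3 * B ^ 2 * X := by nlinarith [mul_nonneg (by linarith : (0:ℝ) ≤ X - 1) (by nlinarith : (0:ℝ) ≤ B ^ 2), mul_nonneg (by linarith : (0:ℝ) ≤ X) (by nlinarith : (0:ℝ) ≤ B ^ 2 - 1)]
  have e4 : |S.px 0 t| ≤ B * S.Om t * |S.px 0 t| := le_mul_of_one_le_left (abs_nonneg _) hO
  have e5 : B * (2 * S.Om t * |S.px 0 t|) ≤ B * (3 * B ^ 2 * X) := mul_le_mul_of_nonneg_left (e2.trans e3) (by linarith)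
  nlinarith [mul_nonneg (by positivity : (0:ℝ) ≤ B ^ 3) (by linarith : 0 ≤ X)]

lemma BX.qx (h : S.BX B X s e) {t : ℝ} (ht : t ∈ Icc s e) : |S.qx 0 t| ≤ 2 * B ^ 3 * X := by
  have hB := h.B1
  have hX := h.hX
  have hO := h.hO t ht
  have hOp := S.Om_pos t
  have e1 : 2 * S.Om t * S.qx 0 t = S.pt 0 t - (4 * (a ^ 2 + b ^ 2) - 2 * (S.p 0 t ^ 2 + S.q 0 t ^ 2)) * S.q 0 t := by
    have := S.bc2 t; simp only [Om]; linarith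
  have e2 : 2 * S.Om t * |S.qx 0 t| ≤ X + 2 * B * B := by
    have : |2 * S.Om t * S.qx 0 t| = 2 * S.Om t * |S.qx 0 t| := by rw [abs_mul, abs_of_pos (by positivity)]
    rw [← this, e1]
    refine (abs_sub _ _).trans (add_le_add (h.h1 t ht) ?_)
    rw [abs_mul]
    exact mul_le_mul (h.lam t) (h.q0 t) (abs_nonneg _) (by linarith)
  have e3 : X + 2 * B * B ≤ 3 * B ^ 2 * X := by nlinarith [mul_nonneg (by linarith : (0:ℝ) ≤ X - 1) (by nlinarith : (0:ℝ) ≤ B ^ 2), mul_nonneg (by linarith : (0:ℝ) ≤ X) (by nlinarith : (0:ℝ) ≤ B ^ 2 - 1)]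
  have e4 : |S.qx 0 t| ≤ B * S.Om t * |S.qx 0 t| := le_mul_of_one_le_left (abs_nonneg _) hO
  have e5 : B * (2 * S.Om t * |S.qx 0 t|) ≤ B * (3 * B ^ 2 * X) := mul_le_mul_of_nonneg_left (e2.trans e3) (by linarith)
  nlinarith [mul_nonneg (by positivity : (0:ℝ) ≤ B ^ 3) (by linarith : 0 ≤ X)]

lemma BX.w1 (h : S.BX B X s e) {t1 t2 : ℝ} (ht1 : t1 ∈ Icc s e) (ht2 : t2 ∈ Icc s e) : |S.p 0 t1 - S.p 0 t2| ≤ X * |t1 - t2| :=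
  Convex.norm_image_sub_le_of_norm_hasDerivWithin_le (f := fun t => S.p 0 t) (fun t _ => (S.hpt 0 t).hasDerivWithinAt) (fun t ht => h.h1 t ht) (convex_Icc s e) ht2 ht1
lemma BX.w2 (h : S.BX B X s e) {t1 t2 : ℝ} (ht1 : t1 ∈ Icc s e) (ht2 : t2 ∈ Icc s e) : |S.q 0 t1 - S.q 0 t2| ≤ X * |t1 - t2| :=
  Convex.norm_image_sub_le_of_norm_hasDerivWithin_le (f := fun t => S.q 0 t) (fun t _ => (S.hqt 0 t).hasDerivWithinAt) (fun t ht => h.h2 t ht) (convex_Icc s e) ht2 ht1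

lemma BX.dn (h : S.BX B X s e) {t1 t2 : ℝ} (ht1 : t1 ∈ Icc s e) (ht2 : t2 ∈ Icc s e) : 
    |(S.p 0 t1 ^ 2 + S.q 0 t1 ^ 2) - (S.p 0 t2 ^ 2 + S.q 0 t2 ^ 2)| ≤ 4 * B * (X * |t1 - t2|) := by
  have e1 : (S.p 0 t1 ^ 2 + S.q 0 t1 ^ 2) - (S.p 0 t2 ^ 2 + S.q 0 t2 ^ 2) = (S.p 0 t1 + S.p 0 t2) * (S.p 0 t1 - S.p 0 t2) + (S.q 0 t1 + S.q 0 t2) * (S.q 0 t1 - S.q 0 t2) := by ring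
  have hB := h.B1
  have k1 : |S.p 0 t1 + S.p 0 t2| ≤ 2 * B := (abs_add_le _ _).trans (by linarith [h.p0 t1, h.p0 t2])
  have k2 : |S.q 0 t1 + S.q 0 t2| ≤ 2 * B := (abs_add_le _ _).trans (by linarith [h.q0 t1, h.q0 t2])
  rw [e1]
  refine (abs_add_le _ _).trans ?_
  rw [abs_mul, abs_mul]
  have l1 := mul_le_mul k1 (h.w1 ht1 ht2) (abs_nonneg _) (by linarith)
  have l2 := mul_le_mul k2 (h.w2 ht1 ht2) (abs_nonneg _) (by linarith)
  linarith

lemma BX.dO (h : S.BX B X s e) {t1 t2 : ℝ} (ht1 : t1 ∈ Icc s e) (ht2 : t2 ∈ Icc s e) : 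
    |S.Om t1 - S.Om t2| ≤ 2 * B ^ 2 * (X * |t1 - t2|) := by
  have hB := h.B1
  have o1 := h.hO t1 ht1
  have o2 := h.hO t2 ht2
  have e1 : |S.Om t1 + S.Om t2| * |S.Om t1 - S.Om t2| ≤ 4 * B * (X * |t1 - t2|) := by
    rw [← abs_mul]
    have : (S.Om t1 + S.Om t2) * (S.Om t1 - S.Om t2) = -((S.p 0 t1 ^ 2 + S.q 0 t1 ^ 2) - (S.p 0 t2 ^ 2 + S.q 0 t2 ^ 2)) := by
      linear_combination S.Om_sq t1 - S.Om_sq t2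
    rw [this, abs_neg]
    exact h.dn ht1 ht2
  rw [abs_of_pos (add_pos (S.Om_pos t1) (S.Om_pos t2))] at e1
  have e2 := mul_le_mul_of_nonneg_left e1 (by linarith : 0 ≤ B)
  have e3 : 2 * |S.Om t1 - S.Om t2| ≤ B * (S.Om t1 + S.Om t2) * |S.Om t1 - S.Om t2| := 
    mul_le_mul_of_nonneg_right (by linarith) (abs_nonneg _)
  linarith

/-- the crude boundary bound -/
lemma BX.be_le (h : S.BX B X s e) {t1 t2 : ℝ} (ht1 : t1 ∈ Icc s e) (ht2 : t2 ∈ Icc s e) : 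
    S.be t1 t2 ≤ 16 * B ^ 3 * X ^ 2 * |t1 - t2| := by
  have hB := h.B1
  have hX := h.hX
  have k1 : |S.px 0 t1 - S.px 0 t2| ≤ 4 * B ^ 3 * X := (abs_sub _ _).trans (by linarith [h.px ht1, h.px ht2])
  have k2 : |S.qx 0 t1 - S.qx 0 t2| ≤ 4 * B ^ 3 * X := (abs_sub _ _).trans (by linarith [h.qx ht1, h.qx ht2])
  have l1 := mul_le_mul (h.w2 ht1 ht2) k1 (abs_nonneg _) (by positivity)
  have l2 := mul_le_mul (h.w1 ht1 ht2) k2 (abs_nonneg _) (by positivity)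
  rw [← abs_mul] at l1 l2
  have m1 := neg_abs_le ((S.q 0 t1 - S.q 0 t2) * (S.px 0 t1 - S.px 0 t2))
  have m2 := le_abs_self ((S.p 0 t1 - S.p 0 t2) * (S.qx 0 t1 - S.qx 0 t2))
  simp only [be]
  nlinarith

set_option maxHeartbeats 800000 in
/-- the refined boundary bound -/
lemma BX.be_fine (h : S.BX B X s e) {t1 t2 : ℝ} (ht1 : t1 ∈ Icc s e) (ht2 : t2 ∈ Icc s e) : 
    S.be t1 t2 ≤ 1 / (2 * S.Om t2) * (2 * (S.p 0 t1 - S.p 0 t2) * (S.pt 0 t1 - S.pt 0 t2) + 2 * (S.q 0 t1 - S.q 0 t2) * (S.qt 0 t1 - S.qt 0 t2))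
      + 38 * B ^ 6 * X ^ 3 * |t1 - t2| ^ 2 := by
  have hB := h.B1
  have hX := h.hX
  have hOp := S.Om_pos t2
  have hO := h.hO t2 ht2
  set w1 := S.p 0 t1 - S.p 0 t2 with hw1
  set w2 := S.q 0 t1 - S.q 0 t2 with hw2
  set F1 := (4 * (a ^ 2 + b ^ 2) - 2 * (S.p 0 t1 ^ 2 + S.q 0 t1 ^ 2)) * S.p 0 t1 - (4 * (a ^ 2 + b ^ 2) - 2 * (S.p 0 t2 ^ 2 + S.q 0 t2 ^ 2)) * S.p 0 t2 with hF1
  set F2 := (4 * (a ^ 2 + b ^ 2) - 2 * (S.p 0 t1 ^ 2 + S.q 0 t1 ^ 2)) * S.q 0 t1 - (4 * (a ^ 2 + b ^ 2) - 2 * (S.p 0 t2 ^ 2 + S.q 0 t2 ^ 2)) * S.q 0 t2 with hF2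
  set d := |t1 - t2| with hd
  have hd0 : 0 ≤ d := abs_nonneg _
  have g1 := h.w1 ht1 ht2
  have g2 := h.w2 ht1 ht2
  rw [← hw1] at g1
  rw [← hw2] at g2
  have gn := h.dn ht1 ht2
  have gO := h.dO ht1 ht2
  have gl := h.lam t1
  have idn : 2 * S.Om t2 * S.be t1 t2 = (2 * w1 * (S.pt 0 t1 - S.pt 0 t2) + 2 * w2 * (S.qt 0 t1 - S.qt 0 t2)) 
      + (2 * (w2 * F1 - w1 * F2) + 4 * ((S.Om t1 - S.Om t2) * (w2 * S.px 0 t1 - w1 * S.qx 0 t1))) := by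
    have c1 : 2 * S.Om t2 * S.px 0 t2 = - S.qt 0 t2 - (4 * (a ^ 2 + b ^ 2) - 2 * (S.p 0 t2 ^ 2 + S.q 0 t2 ^ 2)) * S.p 0 t2 := by
      have := S.bc1 t2; simp only [Om]; linarith
    have c2 : 2 * S.Om t2 * S.qx 0 t2 = S.pt 0 t2 - (4 * (a ^ 2 + b ^ 2) - 2 * (S.p 0 t2 ^ 2 + S.q 0 t2 ^ 2)) * S.q 0 t2 := by
      have := S.bc2 t2; simp only [Om]; linarith
    have c3 : 2 * S.Om t1 * S.px 0 t1 = - S.qt 0 t1 - (4 * (a ^ 2 + b ^ 2) - 2 * (S.p 0 t1 ^ 2 + S.q 0 t1 ^ 2)) * S.p 0 t1 := by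
      have := S.bc1 t1; simp only [Om]; linarith
    have c4 : 2 * S.Om t1 * S.qx 0 t1 = S.pt 0 t1 - (4 * (a ^ 2 + b ^ 2) - 2 * (S.p 0 t1 ^ 2 + S.q 0 t1 ^ 2)) * S.q 0 t1 := by
      have := S.bc2 t1; simp only [Om]; linarith
    simp only [be, ← hw1, ← hw2]
    rw [hF1, hF2]
    linear_combination (-2 * w2) * c3 + 2 * w2 * c1 + 2 * w1 * c4 - 2 * w1 * c2
  have fb : ∀ z1 z2 : ℝ, |z2| ≤ B → |z1 - z2| ≤ X * d → |(4 * (a ^ 2 + b ^ 2) - 2 * (S.p 0 t1 ^ 2 + S.q 0 t1 ^ 2)) * z1 - (4 * (a ^ 2 + b ^ 2) - 2 * (S.p 0 t2 ^ 2 + S.q 0 t2 ^ 2)) * z2| ≤ 10 * B ^ 2 * (X * d) := by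
    intro z1 z2 y1 y2
    have : (4 * (a ^ 2 + b ^ 2) - 2 * (S.p 0 t1 ^ 2 + S.q 0 t1 ^ 2)) * z1 - (4 * (a ^ 2 + b ^ 2) - 2 * (S.p 0 t2 ^ 2 + S.q 0 t2 ^ 2)) * z2
      = (4 * (a ^ 2 + b ^ 2) - 2 * (S.p 0 t1 ^ 2 + S.q 0 t1 ^ 2)) * (z1 - z2) - 2 * (((S.p 0 t1 ^ 2 + S.q 0 t1 ^ 2) - (S.p 0 t2 ^ 2 + S.q 0 t2 ^ 2)) * z2) := by ring
    rw [this]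
    refine (abs_sub _ _).trans ?_
    rw [abs_mul, abs_mul, abs_mul, abs_two]
    have r1 := mul_le_mul gl y2 (abs_nonneg _) (by positivity)
    have r2 := mul_le_mul gn y1 (abs_nonneg _) (by positivity)
    have r3 : B * (X * d) ≤ B ^ 2 * (X * d) := mul_le_mul_of_nonneg_right (by nlinarith) (by positivity)
    linarith
  have f1 := fb _ _ (h.p0 t2) g1
  have f2 := fb _ _ (h.q0 t2) g2
  rw [← hF1] at f1
  rw [← hF2] at f2
  have r1 := mul_le_mul g2 f1 (abs_nonneg _) (by positivity)
  have r2 := mul_le_mul g1 f2 (abs_nonneg _) (by positivity)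
  have r3 := mul_le_mul g2 (h.px ht1) (abs_nonneg _) (by positivity)
  have r4 := mul_le_mul g1 (h.qx ht1) (abs_nonneg _) (by positivity)
  rw [← abs_mul] at r1 r2 r3 r4
  have r5 : |w2 * S.px 0 t1 - w1 * S.qx 0 t1| ≤ 4 * B ^ 3 * X * (X * d) := (abs_sub _ _).trans (by linarith)
  have r6 := mul_le_mul gO r5 (abs_nonneg _) (by positivity)
  rw [← abs_mul] at r6
  have r7 : 2 * (w2 * F1 - w1 * F2) + 4 * ((S.Om t1 - S.Om t2) * (w2 * S.px 0 t1 - w1 * S.qx 0 t1)) ≤ 40 * B ^ 2 * (X ^ 2 * d ^ 2) + 32 * B ^ 5 * (X ^ 3 * d ^ 2) := by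
    have := le_abs_self (w2 * F1)
    have := neg_abs_le (w1 * F2)
    have := le_abs_self ((S.Om t1 - S.Om t2) * (w2 * S.px 0 t1 - w1 * S.qx 0 t1))
    linarith
  have r8 : B ^ 2 * (X ^ 2 * d ^ 2) ≤ B ^ 5 * (X ^ 3 * d ^ 2) := by
    have y1 : B ^ 2 ≤ B ^ 5 := pow_le_pow_right₀ hB (by norm_num)
    have y2 : X ^ 2 ≤ X ^ 3 := pow_le_pow_right₀ hX (by norm_num)
    have y3 : X ^ 2 * d ^ 2 ≤ X ^ 3 * d ^ 2 := mul_le_mul_of_nonneg_right y2 (by positivity)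
    exact mul_le_mul y1 y3 (by positivity) (by positivity)
  have r9 : 40 * B ^ 2 * (X ^ 2 * d ^ 2) + 32 * B ^ 5 * (X ^ 3 * d ^ 2) ≤ 2 * S.Om t2 * (38 * B ^ 6 * X ^ 3 * d ^ 2) := by
    have : B ^ 5 * (X ^ 3 * d ^ 2) * 1 ≤ B ^ 5 * (X ^ 3 * d ^ 2) * (B * S.Om t2) := mul_le_mul_of_nonneg_left hO (by positivity)
    have r10 : 0 ≤ B ^ 5 * (X ^ 3 * d ^ 2) := by positivity
    have r11 : 2 * S.Om t2 * (38 * B ^ 6 * X ^ 3 * d ^ 2) = 76 * (B ^ 5 * (X ^ 3 * d ^ 2) * (B * S.Om t2)) := by ring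
    rw [r11]
    linarith
  have fin : 2 * S.Om t2 * S.be t1 t2 ≤ 2 * S.Om t2 * (1 / (2 * S.Om t2) * (2 * w1 * (S.pt 0 t1 - S.pt 0 t2) + 2 * w2 * (S.qt 0 t1 - S.qt 0 t2))
      + 38 * B ^ 6 * X ^ 3 * d ^ 2) := by
    rw [mul_add, ← mul_assoc (2 * S.Om t2) (1 / (2 * S.Om t2)), mul_one_div_cancel (by positivity), one_mul, idn]
    linarith
  exact le_of_mul_le_mul_left fin (by positivity)

end Sol
end HL

namespace HL
open MeasureTheory Filter Set Topology
namespace Sol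
variable {a b : ℝ} {S : Sol a b}
variable {B X s e : ℝ}

lemma Z_start (h : S.BX B X s e) {D ν d : ℝ} (hD : S.Reg D (Icc s e)) (hν0 : 0 ≤ ν)
    (hν : ∀ τ ∈ Icc s e, ∀ x, 0 ≤ x → S.p x τ ^ 2 + S.q x τ ^ 2 ≤ ν) (hd : 0 < d) (hd1 : d ≤ 1) (hde : s + d ≤ e) :
    S.Z (s + d) s ≤ Real.exp (8 * ν + 1) * (d ^ 2 * (16 * B ^ 3 * X ^ 2 + S.T s)) := by
  have hB := h.B1
  have hX := h.hX
  have hT := S.T0 s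
  have sub : Icc s (s + d) ⊆ Icc s e := Icc_subset_Icc_right hde
  have hs : s ∈ Icc s (s + d) := ⟨le_rfl, by linarith⟩
  have hD' : S.Reg D (Icc s (s + d)) := fun τ hτ => hD τ (sub hτ)
  have hg := gron (Y := fun τ => S.Z τ s) (α := 8 * ν + 1 / d) (β := d * (16 * B ^ 3 * X ^ 2 + S.T s)) (by linarith : s ≤ s + d) 
    (by positivity) (by positivity) (fun t ht => S.dz hD' ht) ?_
  · have hZ : S.Z s s = 0 := by simp [Z]
    have e1 : (8 * ν + 1 / d) * (s + d - s) = 8 * ν * d + 1 := by field_simp; ring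
    simp only [hZ, zero_add, e1] at hg
    refine hg.trans ?_
    have e2 : d * (16 * B ^ 3 * X ^ 2 + S.T s) * (s + d - s) = d ^ 2 * (16 * B ^ 3 * X ^ 2 + S.T s) := by ring
    rw [e2]
    refine mul_le_mul_of_nonneg_right (Real.exp_le_exp.mpr ?_) (by positivity)
    nlinarith
  · intro t ht
    have lp := S.lip_p hD' hs ht
    have lq := S.lip_q hD' hs ht
    have hb := h.be_le (sub ht) (sub hs)
    have de := S.diff_est (hν t (sub ht)) (hν s (sub hs)) lp.1 lq.1
    have mw1 : AEStronglyMeasurable (fun x => S.p x t - S.p x s) (volume.restrict (Ioi 0)) :=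
      ((S.cp t).sub (S.cp s)).aestronglyMeasurable
    have mw2 : AEStronglyMeasurable (fun x => S.q x t - S.q x s) (volume.restrict (Ioi 0)) :=
      ((S.cq t).sub (S.cq s)).aestronglyMeasurable
    have k1 := int_mul mw1 (S.mpt t) lp.1 (S.ipt1 t)
    have k2 := int_mul mw2 (S.mqt t) lq.1 (S.iqt1 t)
    have l1 := int_mul mw1 (S.mpt s) lp.1 (S.ipt1 s)
    have l2 := int_mul mw2 (S.mqt s) lq.1 (S.iqt1 s)
    have q1 : ∫ x in Ioi (0:ℝ), (S.p x t - S.p x s) * (S.pt x t - S.pt x s) = (∫ x in Ioi (0:ℝ), (S.p x t - S.p x s) * S.pt x t) - ∫ x in Ioi (0:ℝ), (S.p x t - S.p x s) * S.pt x s := by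
      rw [← integral_sub k1 l1]; congr 1; ext x; ring
    have q2 : ∫ x in Ioi (0:ℝ), (S.q x t - S.q x s) * (S.qt x t - S.qt x s) = (∫ x in Ioi (0:ℝ), (S.q x t - S.q x s) * S.qt x t) - ∫ x in Ioi (0:ℝ), (S.q x t - S.q x s) * S.qt x s := by
      rw [← integral_sub k2 l2]; congr 1; ext x; ring
    rw [q1, q2] at de
    have am : ∀ y z : ℝ, 2 * (y * z) ≤ 1 / d * y ^ 2 + d * z ^ 2 := by
      intro y z
      have : 1 / d * y ^ 2 + d * z ^ 2 - 2 * (y * z) = 1 / d * (y - d * z) ^ 2 := by field_simp; ring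
      have : 0 ≤ 1 / d * (y - d * z) ^ 2 := by positivity
      linarith
    have r1 := ((HI.mk' l1).mul 2).le (((HI.mk' lp.1).mul (1 / d)).add ((HI.mk' (S.ipt1 s)).mul d)) fun x _ => am _ _
    have r2 := ((HI.mk' l2).mul 2).le (((HI.mk' lq.1).mul (1 / d)).add ((HI.mk' (S.iqt1 s)).mul d)) fun x _ => am _ _
    have hTe := S.T_eq s
    have hZe := S.Z_eq hD' ht hs
    have hb2 : 16 * B ^ 3 * X ^ 2 * |t - s| ≤ 16 * B ^ 3 * X ^ 2 * d := by
      refine mul_le_mul_of_nonneg_left ?_ (by positivity)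
      rw [abs_of_nonneg (by linarith [ht.1])]; linarith [ht.2]
    have z1 : (8 * ν + 1 / d) * S.Z t s = 8 * ν * S.Z t s + (1 / d * (∫ x in Ioi (0:ℝ), (S.p x t - S.p x s) ^ 2) + 1 / d * ∫ x in Ioi (0:ℝ), (S.q x t - S.q x s) ^ 2) := by
      rw [add_mul, hZe]; ring
    have z2 : d * (16 * B ^ 3 * X ^ 2 + S.T s) = 16 * B ^ 3 * X ^ 2 * d + (d * (∫ x in Ioi (0:ℝ), S.pt x s ^ 2) + d * ∫ x in Ioi (0:ℝ), S.qt x s ^ 2) := by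
      rw [hTe]; ring
    rw [z1, z2]
    linarith

lemma hsig (t : ℝ) : HasDerivAt (fun t => 1 / (2 * S.Om t)) ((S.p 0 t * S.pt 0 t + S.q 0 t * S.qt 0 t) / (2 * S.Om t ^ 3)) t := by
  have hO := S.Om_pos t
  have := ((S.hOm t).const_mul 2).fun_inv (by positivity)
  simp only [one_div]
  refine this.congr_deriv ?_
  field_simp

lemma Y_step (h : S.BX B X s e) {D ν d τ : ℝ} (hD : S.Reg D (Icc s e)) (hν0 : 0 ≤ ν) (he : e ≤ s + 1)
    (hν : ∀ τ ∈ Icc s e, ∀ x, 0 ≤ x → S.p x τ ^ 2 + S.q x τ ^ 2 ≤ ν) (hd : 0 < d) (hτ : τ ∈ Icc s (e - d)) :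
    S.Z (τ + d) τ ≤ Real.exp (8 * ν) * (S.Z (s + d) s + (8 * ν * B + 40 * B ^ 6) * (X ^ 3 * d ^ 2)) + B * (X ^ 3 * d ^ 2) := by
  have hB := h.B1
  have hX := h.hX
  set w := fun t => (S.p 0 (t + d) - S.p 0 t) ^ 2 + (S.q 0 (t + d) - S.q 0 t) ^ 2 with hw
  have sub1 : ∀ t ∈ Icc s (e - d), t ∈ Icc s e := fun t ht => ⟨ht.1, by linarith [ht.2]⟩
  have sub2 : ∀ t ∈ Icc s (e - d), t + d ∈ Icc s e := fun t ht => ⟨by linarith [ht.1], by linarith [ht.2]⟩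
  have habs : ∀ t : ℝ, |t + d - t| = d := fun t => by rw [add_sub_cancel_left, abs_of_pos hd]
  have hsub : Icc s τ ⊆ Icc s (e - d) := Icc_subset_Icc_right hτ.2
  have hw0 : ∀ t, 0 ≤ w t := fun t => by rw [hw]; positivity
  have hw2 : ∀ t ∈ Icc s (e - d), w t ≤ 2 * (X ^ 2 * d ^ 2) := by
    intro t ht
    have k1 := h.w1 (sub2 t ht) (sub1 t ht)
    have k2 := h.w2 (sub2 t ht) (sub1 t ht)
    rw [habs] at k1 k2
    have k3 := sq_le_sq' (by linarith [(abs_le.mp k1).1] : -(X * d) ≤ S.p 0 (t + d) - S.p 0 t) (abs_le.mp k1).2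
    have k4 := sq_le_sq' (by linarith [(abs_le.mp k2).1] : -(X * d) ≤ S.q 0 (t + d) - S.q 0 t) (abs_le.mp k2).2
    simp only [hw]
    rw [mul_pow] at k3 k4
    linarith
  have hsig1 : ∀ t ∈ Icc s (e - d), 1 / (2 * S.Om t) ≤ B / 2 ∧ 0 ≤ 1 / (2 * S.Om t) := by
    intro t ht
    have := h.hO t (sub1 t ht)
    have hO := S.Om_pos t
    refine ⟨?_, by positivity⟩
    rw [div_le_div_iff₀ (by positivity) (by positivity)]
    linarith
  have hX23 : X ^ 2 * d ^ 2 ≤ X ^ 3 * d ^ 2 := mul_le_mul_of_nonneg_right (pow_le_pow_right₀ hX (by norm_num)) (by positivity)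
  have hsw : ∀ t ∈ Icc s (e - d), 1 / (2 * S.Om t) * w t ≤ B * (X ^ 3 * d ^ 2) := by
    intro t ht
    obtain ⟨k1, k2⟩ := hsig1 t ht
    have := mul_le_mul k1 (hw2 t ht) (hw0 t) (by positivity)
    have := mul_le_mul_of_nonneg_left hX23 (by positivity : 0 ≤ B)
    linarith
  have hdd : ∀ t, HasDerivAt (fun t => 1 / (2 * S.Om t) * w t) ((S.p 0 t * S.pt 0 t + S.q 0 t * S.qt 0 t) / (2 * S.Om t ^ 3) * w t
      + 1 / (2 * S.Om t) * (2 * (S.p 0 (t + d) - S.p 0 t) * (S.pt 0 (t + d) - S.pt 0 t) + 2 * (S.q 0 (t + d) - S.q 0 t) * (S.qt 0 (t + d) - S.qt 0 t))) t := by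
    intro t
    have q1 := ((((S.hpt 0 (t + d)).comp_add_const t d).sub (S.hpt 0 t)).fun_pow 2).add ((((S.hqt 0 (t + d)).comp_add_const t d).sub (S.hqt 0 t)).fun_pow 2)
    exact ((hsig t).mul q1).congr_deriv (by simp [hw])
  have hg := gron (Y := fun t => S.Z (t + d) t - 1 / (2 * S.Om t) * w t) (α := 8 * ν) (β := (8 * ν * B + 40 * B ^ 6) * (X ^ 3 * d ^ 2)) hτ.1
    (by positivity) (by positivity) (fun t ht => ((S.dy hD hd.le (hsub ht)).mono hsub).sub (hdd t).hasDerivWithinAt) ?_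
  · have k1 := hsw τ hτ
    have k2 := hsw s ⟨le_rfl, hτ.1.trans hτ.2⟩
    have k3 : 0 ≤ 1 / (2 * S.Om s) * w s := mul_nonneg (hsig1 s ⟨le_rfl, hτ.1.trans hτ.2⟩).2 (hw0 s)
    have k4 : Real.exp (8 * ν * (τ - s)) ≤ Real.exp (8 * ν) := by
      apply Real.exp_le_exp.mpr
      nlinarith [hτ.1, hτ.2]
    have hZ0 : 0 ≤ S.Z (s + d) s := integral_nonneg fun x => by positivity
    have hβ : 0 ≤ (8 * ν * B + 40 * B ^ 6) * (X ^ 3 * d ^ 2) := by positivity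
    have k5 : S.Z (s + d) s - 1 / (2 * S.Om s) * w s + (8 * ν * B + 40 * B ^ 6) * (X ^ 3 * d ^ 2) * (τ - s) ≤ S.Z (s + d) s + (8 * ν * B + 40 * B ^ 6) * (X ^ 3 * d ^ 2) := by
      have : (8 * ν * B + 40 * B ^ 6) * (X ^ 3 * d ^ 2) * (τ - s) ≤ (8 * ν * B + 40 * B ^ 6) * (X ^ 3 * d ^ 2) :=
        mul_le_of_le_one_right hβ (by linarith [hτ.1, hτ.2])
      linarith
    have k6 := mul_le_mul_of_nonneg_left k5 (Real.exp_pos (8 * ν * (τ - s))).le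
    have k7 := mul_le_mul_of_nonneg_right k4 (by positivity : 0 ≤ S.Z (s + d) s + (8 * ν * B + 40 * B ^ 6) * (X ^ 3 * d ^ 2))
    have hg' : S.Z (τ + d) τ - 1 / (2 * S.Om τ) * w τ ≤ Real.exp (8 * ν * (τ - s)) * (S.Z (s + d) s - 1 / (2 * S.Om s) * w s + (8 * ν * B + 40 * B ^ 6) * (X ^ 3 * d ^ 2) * (τ - s)) := hg
    linarith
  · intro t ht
    have ht' := hsub ht
    have lp := S.lip_p hD (sub1 t ht') (sub2 t ht')
    have lq := S.lip_q hD (sub1 t ht') (sub2 t ht')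
    have de := S.diff_est (hν _ (sub2 t ht')) (hν t (sub1 t ht')) lp.1 lq.1
    have bf := h.be_fine (sub2 t ht') (sub1 t ht')
    rw [habs] at bf
    have k1 := hsw t ht'
    have k2 := mul_le_mul_of_nonneg_left k1 (by positivity : 0 ≤ 8 * ν)
    have hO := S.Om_pos t
    have k3 : -((S.p 0 t * S.pt 0 t + S.q 0 t * S.qt 0 t) / (2 * S.Om t ^ 3)) ≤ B ^ 4 * X := by
      rw [← neg_div, div_le_iff₀ (by positivity)]
      have m1 := mul_le_mul (h.p0 t) (h.h1 t (sub1 t ht')) (abs_nonneg _) (by positivity)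
      have m2 := mul_le_mul (h.q0 t) (h.h2 t (sub1 t ht')) (abs_nonneg _) (by positivity)
      rw [← abs_mul] at m1 m2
      have m3 := neg_abs_le (S.p 0 t * S.pt 0 t)
      have m4 := neg_abs_le (S.q 0 t * S.qt 0 t)
      have m5 : 1 ≤ (B * S.Om t) ^ 3 := one_le_pow₀ (h.hO t (sub1 t ht'))
      have m6 := mul_le_mul_of_nonneg_left m5 (by positivity : 0 ≤ B * X)
      have m7 : B ^ 4 * X * (2 * S.Om t ^ 3) = 2 * (B * X * (B * S.Om t) ^ 3) := by ring
      rw [m7]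
      linarith
    have k4 := mul_le_mul k3 (hw2 t ht') (hw0 t) (by positivity)
    have k5 : B ^ 4 * X * (2 * (X ^ 2 * d ^ 2)) ≤ 2 * B ^ 6 * (X ^ 3 * d ^ 2) := by
      have : B ^ 4 ≤ B ^ 6 := pow_le_pow_right₀ hB (by norm_num)
      have := mul_le_mul_of_nonneg_right this (by positivity : 0 ≤ X ^ 3 * d ^ 2)
      linarith
    simp only [hw] at k2 k4 ⊢
    linarith

end Sol
end HL

namespace HL
open MeasureTheory Filter Set Topology
namespace Sol
variable {a b : ℝ} {S : Sol a b}
variable {B X s e : ℝ}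

noncomputable def cz (ν B : ℝ) : ℝ := Real.exp (8 * ν) * (Real.exp (8 * ν + 1) * (16 * B ^ 3) + (8 * ν * B + 40 * B ^ 6)) + B

lemma Z_all (h : S.BX B X s e) {D ν d τ : ℝ} (hD : S.Reg D (Icc s e)) (hν0 : 0 ≤ ν) (he : e ≤ s + 1)
    (hν : ∀ τ ∈ Icc s e, ∀ x, 0 ≤ x → S.p x τ ^ 2 + S.q x τ ^ 2 ≤ ν) (hd : 0 < d) (hτ : τ ∈ Icc s (e - d)) :
    S.Z (τ + d) τ ≤ d ^ 2 * (cz ν B * (S.T s + X ^ 3)) := by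
  have hB := h.B1
  have hX := h.hX
  have hT := S.T0 s
  have h1 := Y_step h hD hν0 he hν hd hτ
  have h2 := Z_start h hD hν0 hν hd (by linarith [hτ.1, hτ.2]) (by linarith [hτ.1, hτ.2])
  have hX23 : X ^ 2 ≤ X ^ 3 := pow_le_pow_right₀ hX (by norm_num)
  have hB3 : 1 ≤ B ^ 3 := one_le_pow₀ hB
  have h3 : 16 * B ^ 3 * X ^ 2 + S.T s ≤ 16 * B ^ 3 * (S.T s + X ^ 3) := by
    have := mul_le_mul_of_nonneg_left hX23 (by positivity : 0 ≤ 16 * B ^ 3)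
    have : S.T s ≤ 16 * B ^ 3 * S.T s := le_mul_of_one_le_left hT (by linarith)
    linarith
  have h4 : S.Z (s + d) s ≤ Real.exp (8 * ν + 1) * (d ^ 2 * (16 * B ^ 3 * (S.T s + X ^ 3))) := by
    refine h2.trans (by gcongr)
  have h5 : X ^ 3 * d ^ 2 ≤ d ^ 2 * (S.T s + X ^ 3) := by nlinarith [mul_nonneg hT (sq_nonneg d)]
  calc S.Z (τ + d) τ ≤ _ := h1
    _ ≤ Real.exp (8 * ν) * (Real.exp (8 * ν + 1) * (d ^ 2 * (16 * B ^ 3 * (S.T s + X ^ 3))) + (8 * ν * B + 40 * B ^ 6) * (d ^ 2 * (S.T s + X ^ 3))) + B * (d ^ 2 * (S.T s + X ^ 3)) := by gcongr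
    _ = _ := by rw [cz]; ring

lemma cz1 {ν : ℝ} (hν0 : 0 ≤ ν) (hB : 1 ≤ B) : 1 ≤ cz ν B := by
  have : 0 ≤ Real.exp (8 * ν) * (Real.exp (8 * ν + 1) * (16 * B ^ 3) + (8 * ν * B + 40 * B ^ 6)) := by positivity
  rw [cz]; linarith

lemma quot_lim {f : ℝ → ℝ} {f' t c : ℝ} (hf : HasDerivAt f f' t) (hc : 0 < c) :
    Tendsto (fun k : ℕ => (f t - f (t - c / (k + 1))) / (c / (k + 1))) atTop (𝓝 f') := by
  have h1 := hf.tendsto_slope_zero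
  have h0 : Tendsto (fun k : ℕ => -(c / ((k:ℝ) + 1))) atTop (𝓝 0) := by
    have := (tendsto_const_div_atTop_nhds_zero_nat c).comp (tendsto_add_atTop_nat 1)
    simpa using this.neg
  have h2 : Tendsto (fun k : ℕ => -(c / ((k:ℝ) + 1))) atTop (𝓝[≠] 0) := by
    refine tendsto_nhdsWithin_iff.mpr ⟨h0, Eventually.of_forall fun k => ?_⟩
    have : 0 < c / ((k:ℝ) + 1) := by positivity
    simp only [mem_compl_iff, mem_singleton_iff]; linarith
  refine (h1.comp h2).congr fun k => ?_
  have : 0 < c / ((k:ℝ) + 1) := by positivity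
  simp only [Function.comp_apply, smul_eq_mul, ← sub_eq_add_neg]
  rw [inv_mul_eq_div, ← neg_sub (f t), neg_div_neg_eq]

lemma T_bound (h : S.BX B X s e) {D ν t : ℝ} (hD : S.Reg D (Icc s e)) (hν0 : 0 ≤ ν) (he : e ≤ s + 1)
    (hν : ∀ τ ∈ Icc s e, ∀ x, 0 ≤ x → S.p x τ ^ 2 + S.q x τ ^ 2 ≤ ν) (ht : t ∈ Icc s e) :
    S.T t ≤ 2 * (cz ν B * (S.T s + X ^ 3)) := by
  have hX := h.hX
  have hc := cz1 hν0 h.B1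
  have hT := S.T0 s
  have hD0 : 0 ≤ cz ν B * (S.T s + X ^ 3) := by positivity
  rcases eq_or_lt_of_le ht.1 with rfl | hst
  · have : S.T s ≤ cz ν B * (S.T s + X ^ 3) := by
      have := le_mul_of_one_le_left (by positivity : 0 ≤ S.T s + X ^ 3) hc
      have : 0 ≤ X ^ 3 := by positivity
      linarith
    linarith
  have hc0 : 0 < t - s := by linarith
  have aux : ∀ (F Ft : ℝ → ℝ → ℝ), (∀ τ, Continuous fun x => F x τ) → (∀ x t, HasDerivAt (fun s => F x s) (Ft x t) t) →
      (AEStronglyMeasurable (fun x => Ft x t) (volume.restrict (Ioi 0))) →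
      (∀ t1 ∈ Icc s e, ∀ t2 ∈ Icc s e, IntegrableOn (fun x => (F x t2 - F x t1) ^ 2) (Ioi 0)) →
      (∀ d > 0, t - d ∈ Icc s e → ∫ x in Ioi (0:ℝ), (F x t - F x (t - d)) ^ 2 ≤ d ^ 2 * (cz ν B * (S.T s + X ^ 3))) →
      ∫ x in Ioi (0:ℝ), Ft x t ^ 2 ≤ cz ν B * (S.T s + X ^ 3) := by
    intro F Ft c1 c2 c3 c4 c5
    refine (l2_of_lint c3 hD0 ?_).2
    refine fatou_sq (f := fun k x => (F x t - F x (t - (t - s) / (k + 1))) / ((t - s) / (k + 1))) (fun k => ?_) 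
      (fun x _ => quot_lim (c2 x t) hc0) fun k => ?_
    · exact (((c1 _).sub (c1 _)).div_const _).measurable
    · have hk : 0 < (t - s) / ((k:ℝ) + 1) := by positivity
      have hk2 : (t - s) / ((k:ℝ) + 1) ≤ t - s := div_le_self hc0.le (by linarith [Nat.cast_nonneg (α := ℝ) k])
      have hm : t - (t - s) / ((k:ℝ) + 1) ∈ Icc s e := ⟨by linarith, by linarith [ht.2]⟩
      have i1 := c4 _ hm t ht
      have i2 := c5 _ hk hm
      set d := (t - s) / ((k:ℝ) + 1) with hd
      have e1 : ∀ x, ((F x t - F x (t - d)) / d) ^ 2 = (1 / d ^ 2) * (F x t - F x (t - d)) ^ 2 := fun x => by rw [div_pow, div_eq_inv_mul, one_div]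
      refine lint_of_l2 ?_ (fun x => by positivity) ?_
      · simp only [e1]; exact Integrable.const_mul i1 _
      · simp only [e1]
        rw [integral_const_mul, one_div, inv_mul_le_iff₀ (by positivity)]
        exact i2
  have hZ : ∀ d > 0, t - d ∈ Icc s e → (∫ x in Ioi (0:ℝ), (S.p x t - S.p x (t - d)) ^ 2) + (∫ x in Ioi (0:ℝ), (S.q x t - S.q x (t - d)) ^ 2) ≤ d ^ 2 * (cz ν B * (S.T s + X ^ 3)) := by
    intro d hd hm
    have := Z_all h hD hν0 he hν hd (τ := t - d) ⟨hm.1, by linarith [ht.2]⟩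
    rw [sub_add_cancel, S.Z_eq hD ht hm] at this
    exact this
  have r1 := aux S.p S.pt S.cp S.hpt (S.mpt t) (fun t1 h1 t2 h2 => (S.lip_p hD h1 h2).1) fun d hd hm => by
    have := hZ d hd hm
    have : 0 ≤ ∫ x in Ioi (0:ℝ), (S.q x t - S.q x (t - d)) ^ 2 := integral_nonneg fun x => sq_nonneg _
    linarith
  have r2 := aux S.q S.qt S.cq S.hqt (S.mqt t) (fun t1 h1 t2 h2 => (S.lip_q hD h1 h2).1) fun d hd hm => by
    have := hZ d hd hm
    have : 0 ≤ ∫ x in Ioi (0:ℝ), (S.p x t - S.p x (t - d)) ^ 2 := integral_nonneg fun x => sq_nonneg _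
    linarith
  rw [S.T_eq]
  linarith

lemma bdry_vel (hB1 : 1 + 4 * a ^ 2 + 4 * b ^ 2 ≤ B) (t : ℝ) : S.pt 0 t ^ 2 ≤ 8 * B ^ 2 * (S.px 0 t ^ 2 + S.qx 0 t ^ 2) + 8 * B ^ 4 ∧
    S.qt 0 t ^ 2 ≤ 8 * B ^ 2 * (S.px 0 t ^ 2 + S.qx 0 t ^ 2) + 8 * B ^ 4 := by
  have hB : 1 ≤ B := by nlinarith [sq_nonneg a, sq_nonneg b]
  have hn : S.p 0 t ^ 2 + S.q 0 t ^ 2 ≤ B := by nlinarith [sq_nonneg a, S.hb t]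
  have hBB : B ≤ B ^ 2 := by nlinarith
  have hO : S.Om t ^ 2 ≤ B ^ 2 := by rw [S.Om_sq]; nlinarith [sq_nonneg a, sq_nonneg (S.p 0 t), sq_nonneg (S.q 0 t)]
  set L := 4 * (a ^ 2 + b ^ 2) - 2 * (S.p 0 t ^ 2 + S.q 0 t ^ 2) with hL
  have l2 : L ^ 2 ≤ (2 * B) ^ 2 := by
    apply sq_le_sq'
    · rw [hL]; nlinarith [sq_nonneg a, sq_nonneg b]
    · rw [hL]; nlinarith [sq_nonneg (S.p 0 t), sq_nonneg (S.q 0 t)]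
  have key : ∀ z x y : ℝ, y ^ 2 ≤ B ^ 2 → x ^ 2 ≤ S.px 0 t ^ 2 + S.qx 0 t ^ 2 → z = 2 * S.Om t * x + L * y → z ^ 2 ≤ 8 * B ^ 2 * (S.px 0 t ^ 2 + S.qx 0 t ^ 2) + 8 * B ^ 4 := by
    intro z x y hy hx hz
    have m1 : S.Om t ^ 2 * x ^ 2 ≤ B ^ 2 * (S.px 0 t ^ 2 + S.qx 0 t ^ 2) := mul_le_mul hO hx (sq_nonneg _) (sq_nonneg _)
    have m2 : L ^ 2 * y ^ 2 ≤ (2 * B) ^ 2 * B ^ 2 := mul_le_mul l2 hy (sq_nonneg _) (sq_nonneg _)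
    have m3 : z ^ 2 ≤ 8 * (S.Om t ^ 2 * x ^ 2) + 2 * (L ^ 2 * y ^ 2) := by rw [hz]; nlinarith [sq_nonneg (2 * S.Om t * x - L * y)]
    nlinarith
  constructor
  · refine key _ (S.qx 0 t) (S.q 0 t) (by nlinarith [sq_nonneg (S.p 0 t)]) (by nlinarith [sq_nonneg (S.px 0 t)]) ?_
    have := S.bc2 t; rw [hL]; simp only [Om]; linarith
  · refine key _ (-S.px 0 t) (-S.p 0 t) (by nlinarith [sq_nonneg (S.q 0 t)]) (by nlinarith [sq_nonneg (S.qx 0 t)]) ?_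
    have := S.bc1 t; rw [hL]; simp only [Om]; linarith

end Sol

lemma V_bound (a b B M C : ℝ) : ∃ C' : ℝ, ∀ (S : Sol a b) (s e C0 : ℝ), s ≤ e → e ≤ s + 1 → 1 + 4 * a ^ 2 + 4 * b ^ 2 ≤ B → 
    (∀ τ ∈ Icc s e, 1 ≤ B * S.Om τ) → S.Bd C0 (Icc s e) → (∀ τ ∈ Icc s e, S.P τ ≤ M ∧ S.K τ ≤ M) → S.V s ≤ C → ∀ τ ∈ Icc s e, S.V τ ≤ C' := by
  set ν := 1 + M + M with hν
  set T0 := 2 * C + 8 * ν * M with hT0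
  set A := 4 * (Sol.cz ν B * (T0 + 1)) + 8 * ν * M with hA
  set E := 128 * B ^ 4 * (M + 1) * A + 8 * B ^ 4 with hE
  refine ⟨A * (2 * E) ^ 3, fun S s e C0 hse he hB1 hO hBd hPK hV τ0 hτ0 => ?_⟩
  have hB : 1 ≤ B := by nlinarith [sq_nonneg a, sq_nonneg b]
  have hs : s ∈ Icc s e := ⟨le_rfl, hse⟩
  have hM : 0 ≤ M := (S.P0 s).trans (hPK s hs).1
  have hC : 0 ≤ C := (S.V0 s).trans hV
  have hν0 : 0 ≤ ν := by positivity
  have hc := Sol.cz1 hν0 hB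
  have hT00 : 0 ≤ T0 := by positivity
  have hA1 : 1 ≤ A := by
    have : 1 ≤ Sol.cz ν B * (T0 + 1) := one_le_mul_of_one_le_of_one_le hc (by linarith)
    have : 0 ≤ 8 * ν * M := by positivity
    linarith
  have hE1 : 1 ≤ E := by
    have : 1 ≤ B ^ 4 := one_le_pow₀ hB
    have : 0 ≤ 128 * B ^ 4 * (M + 1) * A := by positivity
    linarith
  have hreg := hBd.reg
  have hνb : ∀ τ ∈ Icc s e, ∀ x, 0 ≤ x → S.p x τ ^ 2 + S.q x τ ^ 2 ≤ ν := fun τ hτ x hx => 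
    (S.n_sup τ hx).trans (by linarith [(hPK τ hτ).1, (hPK τ hτ).2])
  have hPM : ∀ τ ∈ Icc s e, 8 * (1 + S.P τ + S.K τ) * S.P τ ≤ 8 * ν * M := by
    intro τ hτ
    obtain ⟨k1, k2⟩ := hPK τ hτ
    have := S.P0 τ
    have := S.K0 τ
    rw [hν]
    gcongr
  have hTs : S.T s ≤ T0 := (S.T_le s).trans (by linarith [hPM s hs])
  have hVX : ∀ X, S.BX B X s e → ∀ τ ∈ Icc s e, S.V τ ≤ A * X ^ 3 := by
    intro X h τ hτ
    have hX := h.hX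
    have hX3 : 1 ≤ X ^ 3 := one_le_pow₀ hX
    have k1 := Sol.T_bound h hreg hν0 he hνb hτ
    have k2 := S.V_le τ
    have k3 := hPM τ hτ
    have k4 : S.T s + X ^ 3 ≤ (T0 + 1) * X ^ 3 := by nlinarith
    have k5 : Sol.cz ν B * (S.T s + X ^ 3) ≤ Sol.cz ν B * ((T0 + 1) * X ^ 3) := by gcongr
    have k6 : 8 * ν * M ≤ 8 * ν * M * X ^ 3 := le_mul_of_one_le_right (by positivity) hX3
    calc S.V τ ≤ 4 * (Sol.cz ν B * ((T0 + 1) * X ^ 3)) + 8 * ν * M * X ^ 3 := by linarith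
      _ = A * X ^ 3 := by rw [hA]; ring
  have step : ∀ X, S.BX B X s e → S.BX B (√(X ^ 2 / 2 + E * X)) s e := by
    intro X h
    have hX := h.hX
    have hκ : ∀ τ ∈ Icc s e, 8 * B ^ 2 * (S.px 0 τ ^ 2 + S.qx 0 τ ^ 2) + 8 * B ^ 4 ≤ X ^ 2 / 2 + E * X := by
      intro τ hτ
      have hl : 0 < X ^ 2 / (16 * B ^ 2 * (M + 1)) := by positivity
      have k1 := S.k_sup τ le_rfl hl
      have k2 := hVX X h τ hτ
      have k3 := (hPK τ hτ).2
      have k4 : X ^ 2 / (16 * B ^ 2 * (M + 1)) * S.K τ + S.V τ / (X ^ 2 / (16 * B ^ 2 * (M + 1))) ≤ X ^ 2 / (16 * B ^ 2 * (M + 1)) * (M + 1) + A * X ^ 3 / (X ^ 2 / (16 * B ^ 2 * (M + 1))) := by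
        gcongr; linarith
      have k5 : X ^ 2 / (16 * B ^ 2 * (M + 1)) * (M + 1) + A * X ^ 3 / (X ^ 2 / (16 * B ^ 2 * (M + 1))) = X ^ 2 / (16 * B ^ 2) + 16 * B ^ 2 * (M + 1) * A * X := by
        field_simp
      have k6 : 8 * B ^ 2 * (S.px 0 τ ^ 2 + S.qx 0 τ ^ 2) ≤ 8 * B ^ 2 * (X ^ 2 / (16 * B ^ 2) + 16 * B ^ 2 * (M + 1) * A * X) :=
        mul_le_mul_of_nonneg_left (by linarith) (by positivity)
      have k7 : 8 * B ^ 2 * (X ^ 2 / (16 * B ^ 2) + 16 * B ^ 2 * (M + 1) * A * X) = X ^ 2 / 2 + 128 * B ^ 4 * (M + 1) * A * X := by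
        have k9 : 8 * B ^ 2 * (X ^ 2 / (16 * B ^ 2)) = X ^ 2 / 2 := by
          rw [mul_div_assoc', div_eq_div_iff (by positivity) (by norm_num)]; ring
        rw [mul_add, k9]; ring
      have k8 : 8 * B ^ 4 ≤ 8 * B ^ 4 * X := le_mul_of_one_le_right (by positivity) hX
      rw [hE, add_mul]
      linarith
    refine ⟨hB1, hO, ?_, fun τ hτ => ?_, fun τ hτ => ?_⟩
    · rw [Real.one_le_sqrt]; nlinarith
    · exact Real.abs_le_sqrt ((S.bdry_vel hB1 τ).1.trans (hκ τ hτ))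
    · exact Real.abs_le_sqrt ((S.bdry_vel hB1 τ).2.trans (hκ τ hτ))
  set Q := {X | S.BX B X s e} with hQ
  have hne : Q.Nonempty := by
    have hκ : ∀ τ ∈ Icc s e, 8 * B ^ 2 * (S.px 0 τ ^ 2 + S.qx 0 τ ^ 2) + 8 * B ^ 4 ≤ 8 * B ^ 2 * (C0 + C0) + 8 * B ^ 4 := by
      intro τ hτ
      have k1 := S.k_sup τ le_rfl one_pos
      obtain ⟨-, k2, k3⟩ := hBd τ hτ
      rw [div_one] at k1
      have := mul_le_mul_of_nonneg_left (by linarith : S.px 0 τ ^ 2 + S.qx 0 τ ^ 2 ≤ C0 + C0) (by positivity : 0 ≤ 8 * B ^ 2)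
      linarith
    have h0 : 0 ≤ C0 := (S.V0 s).trans (hBd s hs).2.2
    refine ⟨√(8 * B ^ 2 * (C0 + C0) + 8 * B ^ 4), hB1, hO, ?_, fun τ hτ => ?_, fun τ hτ => ?_⟩
    · rw [Real.one_le_sqrt]
      have : 1 ≤ B ^ 4 := one_le_pow₀ hB
      have : 0 ≤ 8 * B ^ 2 * (C0 + C0) := by positivity
      linarith
    · exact Real.abs_le_sqrt ((S.bdry_vel hB1 τ).1.trans (hκ τ hτ))
    · exact Real.abs_le_sqrt ((S.bdry_vel hB1 τ).2.trans (hκ τ hτ))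
  have hinf : S.BX B (sInf Q) s e := 
    ⟨hB1, hO, le_csInf hne fun X h => h.hX, fun τ hτ => le_csInf hne fun X h => h.h1 τ hτ, fun τ hτ => le_csInf hne fun X h => h.h2 τ hτ⟩
  have hbdd : BddBelow Q := ⟨1, fun X h => h.hX⟩
  have hle := csInf_le hbdd (step _ hinf)
  have hX1 := hinf.hX
  set X := sInf Q
  have hXE : X ≤ 2 * E := by
    have := (Real.le_sqrt' (by linarith)).mp hle
    nlinarith
  exact (hVX X hinf τ0 hτ0).trans (by gcongr)

end HL

namespace HL
open MeasureTheory Filter Set Topology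

lemma apriori (a b B C : ℝ) : ∃ C' : ℝ, ∀ (S : Sol a b) (s e C0 : ℝ), s ≤ e → e ≤ s + 1 → 1 + 4 * a ^ 2 + 4 * b ^ 2 ≤ B → 
    (∀ τ ∈ Icc s e, 1 ≤ B * S.Om τ) → S.Bd C0 (Icc s e) → S.P s ≤ C → S.K s ≤ C → S.V s ≤ C → S.Bd C' (Icc s e) := by
  obtain ⟨C1, h1⟩ := V_bound a b B (2 * Sol.rPK a b C ^ 30) C
  refine ⟨max C1 (2 * Sol.rPK a b C ^ 30), fun S s e C0 hse he hB hO hBd hP hK hV τ hτ => ?_⟩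
  have hPK := S.PK_bound ((S.P0 s).trans hP) hse he hBd hP hK
  exact ⟨(hPK τ hτ).1.trans (le_max_right _ _), (hPK τ hτ).2.trans (le_max_right _ _), 
    (h1 S s e C0 hse he hB hO hBd hPK hV τ hτ).trans (le_max_left _ _)⟩

lemma Sol.rev_Om {a b : ℝ} (S : Sol a b) (t : ℝ) : S.rev.Om t = S.Om (-t) := by simp [Sol.Om, Sol.rev]

lemma Sol.rev_Bd {a b : ℝ} {S : Sol a b} {C s e : ℝ} : S.rev.Bd C (Icc (-e) (-s)) ↔ S.Bd C (Icc s e) := by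
  simp only [Sol.Bd, Sol.rev_P, Sol.rev_K, Sol.rev_V]
  constructor
  · intro h τ hτ
    simpa using h (-τ) ⟨by linarith [hτ.2], by linarith [hτ.1]⟩
  · intro h τ hτ
    exact h (-τ) ⟨by linarith [hτ.2], by linarith [hτ.1]⟩

lemma apriori_back (a b B C : ℝ) : ∃ C' : ℝ, ∀ (S : Sol a b) (s e C0 : ℝ), s ≤ e → e ≤ s + 1 → 1 + 4 * a ^ 2 + 4 * b ^ 2 ≤ B → 
    (∀ τ ∈ Icc s e, 1 ≤ B * S.Om τ) → S.Bd C0 (Icc s e) → S.P e ≤ C → S.K e ≤ C → S.V e ≤ C → S.Bd C' (Icc s e) := by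
  obtain ⟨C', h⟩ := apriori a b B C
  refine ⟨C', fun S s e C0 hse he hB hO hBd hP hK hV => Sol.rev_Bd.mp (h S.rev (-e) (-s) C0 (by linarith) (by linarith) hB (fun τ hτ => ?_)
    (Sol.rev_Bd.mpr hBd) (by simpa [Sol.rev_P]) (by simpa [Sol.rev_K]) (by simpa [Sol.rev_V]))⟩
  rw [S.rev_Om]
  exact hO (-τ) ⟨by linarith [hτ.2], by linarith [hτ.1]⟩

lemma quotb {f f' f'' : ℝ → ℝ} (h1 : ∀ x, HasDerivAt f (f' x) x) (h2 : ∀ x, HasDerivAt f' (f'' x) x) {M x δ : ℝ} 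
    (hM : ∫⁻ x in Ioi (0:ℝ), ENNReal.ofReal (f'' x ^ 2) ≤ ENNReal.ofReal M) (hM0 : 0 ≤ M) (hx : 0 ≤ x) (hδ : 0 < δ) :
    |(f (x + δ) - f x) / δ - f' x| ≤ √(δ * M) := by
  obtain ⟨ξ, hξ, he⟩ := exists_hasDerivAt_eq_slope f f' (by linarith : x < x + δ) (cont_der h1).continuousOn (fun y _ => h1 y)
  rw [add_sub_cancel_left] at he
  rw [← he]
  apply Real.abs_le_sqrt
  have k1 := cs1 h2 hξ.1.le
  have k2 : ∫⁻ y in Ioc x ξ, ENNReal.ofReal (f'' y ^ 2) ≤ ENNReal.ofReal M := 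
    (lintegral_mono_set (fun y hy => lt_of_le_of_lt hx hy.1)).trans hM
  have k3 : ENNReal.ofReal ((f' ξ - f' x) ^ 2) ≤ ENNReal.ofReal (δ * M) := by
    rw [ENNReal.ofReal_mul hδ.le]
    refine k1.trans (mul_le_mul' (ENNReal.ofReal_le_ofReal (by linarith [hξ.2])) k2)
  exact (ENNReal.ofReal_le_ofReal_iff (by positivity)).mp k3

lemma dconv {f f' f'' : ℕ → ℝ → ℝ} {g g' g'' : ℝ → ℝ} (h1 : ∀ k x, HasDerivAt (f k) (f' k x) x) (h2 : ∀ k x, HasDerivAt (f' k) (f'' k x) x) 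
    (h3 : ∀ x, HasDerivAt g (g' x) x) (h4 : ∀ x, HasDerivAt g' (g'' x) x) {M x : ℝ} (hM0 : 0 ≤ M)
    (hM : ∀ k, ∫⁻ x in Ioi (0:ℝ), ENNReal.ofReal (f'' k x ^ 2) ≤ ENNReal.ofReal M)
    (hM' : ∫⁻ x in Ioi (0:ℝ), ENNReal.ofReal (g'' x ^ 2) ≤ ENNReal.ofReal M) (hx : 0 < x)
    (hc : ∀ x, 0 < x → Tendsto (fun k => f k x) atTop (𝓝 (g x))) : Tendsto (fun k => f' k x) atTop (𝓝 (g' x)) := by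
  rw [Metric.tendsto_atTop]
  intro ε hε
  obtain ⟨δ, hδ, hδM⟩ : ∃ δ : ℝ, 0 < δ ∧ √(δ * M) ≤ ε / 4 := by
    refine ⟨(ε / 4) ^ 2 / (M + 1), by positivity, ?_⟩
    rw [Real.sqrt_le_left (by positivity), div_mul_eq_mul_div, div_le_iff₀ (by positivity)]
    nlinarith [sq_nonneg (ε / 4)]
  have hq : Tendsto (fun k => (f k (x + δ) - f k x) / δ) atTop (𝓝 ((g (x + δ) - g x) / δ)) :=
    ((hc _ (by linarith)).sub (hc x hx)).div_const δ
  obtain ⟨N, hN⟩ := Metric.tendsto_atTop.mp hq (ε / 4) (by positivity)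
  refine ⟨N, fun k hk => ?_⟩
  have e1 := hN k hk
  rw [Real.dist_eq] at e1 ⊢
  have e2 := abs_le.mp ((quotb (h1 k) (h2 k) (hM k) hM0 hx.le hδ).trans hδM)
  have e3 := abs_le.mp ((quotb h3 h4 hM' hM0 hx.le hδ).trans hδM)
  have e4 := abs_lt.mp e1
  rw [abs_lt]
  constructor <;> linarith [e2.1, e2.2, e3.1, e3.2, e4.1, e4.2]

namespace Sol
variable {a b : ℝ} (S : Sol a b)

def N (C : ℝ) : Set ℝ := {t | S.P t ≤ C ∧ S.K t ≤ C ∧ S.V t ≤ C}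

lemma N_lim {C t : ℝ} {τ : ℕ → ℝ} (hτ : ∀ k, τ k ∈ S.N C) (hl : Tendsto τ atTop (𝓝 t)) : t ∈ S.N (2 * C) := by
  have hC : 0 ≤ C := (S.P0 (τ 0)).trans (hτ 0).1
  have cp : ∀ x, Tendsto (fun k => S.p x (τ k)) atTop (𝓝 (S.p x t)) := fun x => ((S.cpt x).tendsto t).comp hl
  have cq : ∀ x, Tendsto (fun k => S.q x (τ k)) atTop (𝓝 (S.q x t)) := fun x => ((S.cqt x).tendsto t).comp hl
  have sq0 : ∀ f : ℝ → ℝ, 0 ≤ ∫ x in Ioi (0:ℝ), f x ^ 2 := fun f => integral_nonneg fun x => sq_nonneg _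
  have b1 : ∀ k, ∫⁻ x in Ioi (0:ℝ), ENNReal.ofReal (S.px x (τ k) ^ 2) ≤ ENNReal.ofReal C := fun k =>
    lint_of_l2 (S.ipx _) (fun x => sq_nonneg _) (by have := (hτ k).2.1; rw [S.K_eq] at this; linarith [sq0 fun x => S.qx x (τ k)])
  have b2 : ∀ k, ∫⁻ x in Ioi (0:ℝ), ENNReal.ofReal (S.qx x (τ k) ^ 2) ≤ ENNReal.ofReal C := fun k =>
    lint_of_l2 (S.iqx _) (fun x => sq_nonneg _) (by have := (hτ k).2.1; rw [S.K_eq] at this; linarith [sq0 fun x => S.px x (τ k)])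
  have b3 : ∀ k, ∫⁻ x in Ioi (0:ℝ), ENNReal.ofReal (S.pxx x (τ k) ^ 2) ≤ ENNReal.ofReal C := fun k =>
    lint_of_l2 (S.ipxx _) (fun x => sq_nonneg _) (by have := (hτ k).2.2; rw [S.V_eq] at this; linarith [sq0 fun x => S.qxx x (τ k)])
  have b4 : ∀ k, ∫⁻ x in Ioi (0:ℝ), ENNReal.ofReal (S.qxx x (τ k) ^ 2) ≤ ENNReal.ofReal C := fun k =>
    lint_of_l2 (S.iqxx _) (fun x => sq_nonneg _) (by have := (hτ k).2.2; rw [S.V_eq] at this; linarith [sq0 fun x => S.pxx x (τ k)])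
  have mono : ∀ _ : ℕ, ENNReal.ofReal C ≤ ENNReal.ofReal (max C (S.V t)) := fun k => ENNReal.ofReal_le_ofReal (le_max_left _ _)
  have hM0 : 0 ≤ max C (S.V t) := hC.trans (le_max_left _ _)
  have cpx : ∀ x, 0 < x → Tendsto (fun k => S.px x (τ k)) atTop (𝓝 (S.px x t)) := fun x hx =>
    dconv (fun k => S.hpx (τ k)) (fun k => S.hpxx (τ k)) (S.hpx t) (S.hpxx t) hM0 (fun k => (b3 k).trans (mono k))
      (lint_of_l2 (S.ipxx _) (fun x => sq_nonneg _) (le_trans (by rw [S.V_eq]; linarith [sq0 fun x => S.qxx x t]) (le_max_right C (S.V t)))) hx (fun x _ => cp x)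
  have cqx : ∀ x, 0 < x → Tendsto (fun k => S.qx x (τ k)) atTop (𝓝 (S.qx x t)) := fun x hx =>
    dconv (fun k => S.hqx (τ k)) (fun k => S.hqxx (τ k)) (S.hqx t) (S.hqxx t) hM0 (fun k => (b4 k).trans (mono k))
      (lint_of_l2 (S.iqxx _) (fun x => sq_nonneg _) (le_trans (by rw [S.V_eq]; linarith [sq0 fun x => S.pxx x t]) (le_max_right C (S.V t)))) hx (fun x _ => cq x)
  have r0 := fatou_sq (f := fun k x => S.p x (τ k) ^ 2 + S.q x (τ k) ^ 2) (f0 := fun x => S.p x t ^ 2 + S.q x t ^ 2) (D := ENNReal.ofReal C)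
    (fun k => (((S.cp _).pow 2).add ((S.cq _).pow 2)).measurable) (fun x _ => ((cp x).pow 2).add ((cq x).pow 2))
    (fun k => lint_of_l2 (S.hi0 _) (fun x => sq_nonneg _) (hτ k).1)
  have r1 := lscL2 (fun k => S.hpx (τ k)) (S.hpx t) (fun x _ => cp x) b1
  have r2 := lscL2 (fun k => S.hqx (τ k)) (S.hqx t) (fun x _ => cq x) b2
  have r3 := lscL2 (fun k => S.hpxx (τ k)) (S.hpxx t) cpx b3
  have r4 := lscL2 (fun k => S.hqxx (τ k)) (S.hqxx t) cqx b4
  have s0 := (l2_of_lint (((S.cp t).pow 2).add ((S.cq t).pow 2)).aestronglyMeasurable hC r0).2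
  have s1 := (l2_of_lint (S.cpx t).aestronglyMeasurable hC r1).2
  have s2 := (l2_of_lint (S.cqx t).aestronglyMeasurable hC r2).2
  have s3 := (l2_of_lint (S.mpxx t).aestronglyMeasurable hC r3).2
  have s4 := (l2_of_lint (S.mqxx t).aestronglyMeasurable hC r4).2
  refine ⟨?_, by rw [S.K_eq]; linarith, by rw [S.V_eq]; linarith⟩
  have : S.P t ≤ C := s0
  linarith

lemma N_closure {C : ℝ} : closure (S.N C) ⊆ S.N (2 * C) := by
  intro t ht
  obtain ⟨τ, h1, h2⟩ := mem_closure_iff_seq_limit.mp ht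
  exact S.N_lim h1 h2

end Sol
end HL

namespace HL
open MeasureTheory Filter Set Topology
namespace Sol
variable {a b : ℝ} (S : Sol a b)

/-- times near which the energies are locally bounded -/
def Gs : Set ℝ := {t | ∃ ε > 0, ∃ C, S.Bd C (Icc (t - ε) (t + ε))}

lemma Gs_open : IsOpen S.Gs := by
  rw [Metric.isOpen_iff]
  rintro t ⟨ε, hε, C, hC⟩
  refine ⟨ε / 2, by positivity, fun τ hτ => ⟨ε / 2, by positivity, C, hC.mono fun y hy => ?_⟩⟩
  rw [Metric.mem_ball, Real.dist_eq, abs_lt] at hτ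
  exact ⟨by linarith [hy.1, hτ.1], by linarith [hy.2, hτ.2]⟩

lemma Gs_compact {s e : ℝ} (h : Icc s e ⊆ S.Gs) : ∃ C, S.Bd C (Icc s e) := by
  refine isCompact_Icc.induction_on (p := fun I => ∃ C, S.Bd C I) ⟨0, fun τ hτ => hτ.elim⟩ ?_ ?_ ?_
  · rintro I J hIJ ⟨C, hC⟩
    exact ⟨C, hC.mono hIJ⟩
  · rintro I J ⟨C, hC⟩ ⟨C', hC'⟩
    refine ⟨max C C', fun τ hτ => ?_⟩
    rcases hτ with hτ | hτ
    · obtain ⟨h1, h2, h3⟩ := hC τ hτ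
      exact ⟨h1.trans (le_max_left _ _), h2.trans (le_max_left _ _), h3.trans (le_max_left _ _)⟩
    · obtain ⟨h1, h2, h3⟩ := hC' τ hτ
      exact ⟨h1.trans (le_max_right _ _), h2.trans (le_max_right _ _), h3.trans (le_max_right _ _)⟩
  · intro t ht
    obtain ⟨ε, hε, C, hC⟩ := h ht
    exact ⟨Icc (t - ε) (t + ε), mem_nhdsWithin_of_mem_nhds (Icc_mem_nhds (by linarith) (by linarith)), C, hC⟩

lemma N_max (t : ℝ) : ∃ C, t ∈ S.N C := 
  ⟨max (S.P t) (max (S.K t) (S.V t)), le_max_left _ _, (le_max_left _ _).trans (le_max_right _ _), (le_max_right _ _).trans (le_max_right _ _)⟩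

lemma N_mono {C C' : ℝ} (h : C ≤ C') : S.N C ⊆ S.N C' := fun _ ht => ⟨ht.1.trans h, ht.2.1.trans h, ht.2.2.trans h⟩

lemma right_claim (B C : ℝ) (hB : 1 + 4 * a ^ 2 + 4 * b ^ 2 ≤ B) : ∃ C', ∀ (α t : ℝ), α ≤ t → t ≤ α + 1 → (∀ τ ∈ Icc α t, 1 ≤ B * S.Om τ) →
    α ∈ S.N C → Ioc α t ⊆ S.Gs → t ∈ S.N C' := by
  obtain ⟨C', hC'⟩ := apriori a b B C
  refine ⟨C', fun α t hαt ht1 hO hα hG => ?_⟩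
  obtain ⟨C1, hC1⟩ := S.N_max t
  obtain ⟨C2, hC2⟩ := apriori_back a b B C1
  have hbd : S.Bd (max C C2) (Icc α t) := by
    intro τ hτ
    rcases eq_or_lt_of_le hτ.1 with h | h
    · rw [← h]; exact S.N_mono (le_max_left _ _) hα
    · obtain ⟨C0, hC0⟩ := S.Gs_compact (s := τ) (e := t) fun y hy => hG ⟨lt_of_lt_of_le h hy.1, hy.2⟩
      have := hC2 S τ t C0 hτ.2 (by linarith [hτ.1]) hB (fun y hy => hO y ⟨hτ.1.trans hy.1, hy.2⟩) hC0 hC1.1 hC1.2.1 hC1.2.2 τ ⟨le_rfl, hτ.2⟩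
      exact S.N_mono (le_max_right C C2) this
  exact hC' S α t _ hαt ht1 hB hO hbd hα.1 hα.2.1 hα.2.2 t ⟨hαt, le_rfl⟩

lemma left_claim (B C : ℝ) (hB : 1 + 4 * a ^ 2 + 4 * b ^ 2 ≤ B) : ∃ C', ∀ (α t : ℝ), t ≤ α → α ≤ t + 1 → (∀ τ ∈ Icc t α, 1 ≤ B * S.Om τ) →
    α ∈ S.N C → Ico t α ⊆ S.Gs → t ∈ S.N C' := by
  obtain ⟨C', hC'⟩ := apriori_back a b B C
  refine ⟨C', fun α t hαt ht1 hO hα hG => ?_⟩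
  obtain ⟨C1, hC1⟩ := S.N_max t
  obtain ⟨C2, hC2⟩ := apriori a b B C1
  have hbd : S.Bd (max C C2) (Icc t α) := by
    intro τ hτ
    rcases eq_or_lt_of_le hτ.2 with h | h
    · rw [h]; exact S.N_mono (le_max_left _ _) hα
    · obtain ⟨C0, hC0⟩ := S.Gs_compact (s := t) (e := τ) fun y hy => hG ⟨hy.1, lt_of_le_of_lt hy.2 h⟩
      have := hC2 S t τ C0 hτ.1 (by linarith [hτ.2]) hB (fun y hy => hO y ⟨hy.1, hy.2.trans hτ.2⟩) hC0 hC1.1 hC1.2.1 hC1.2.2 τ ⟨hτ.1, le_rfl⟩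
      exact S.N_mono (le_max_right C C2) this
  exact hC' S t α _ hαt ht1 hB hO hbd hα.1 hα.2.1 hα.2.2 t ⟨le_rfl, hαt⟩

lemma Gs_univ : S.Gs = univ := by
  by_contra hne
  have hBn : (S.Gsᶜ).Nonempty := nonempty_compl.mpr hne
  have hBc : IsClosed S.Gsᶜ := S.Gs_open.isClosed_compl
  haveI : Nonempty (S.Gsᶜ : Set ℝ) := hBn.to_subtype
  haveI : CompleteSpace (S.Gsᶜ : Set ℝ) := hBc.completeSpace_coe
  obtain ⟨n, ⟨p, hp⟩, hn⟩ := nonempty_interior_of_iUnion_of_closed (f := fun n : ℕ => (Subtype.val ⁻¹' closure (S.N n) : Set (S.Gsᶜ : Set ℝ)))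
    (fun n => isClosed_closure.preimage continuous_subtype_val) (by
      rw [eq_univ_iff_forall]
      intro t
      obtain ⟨C, hC⟩ := S.N_max t
      obtain ⟨n, hn⟩ := exists_nat_ge C
      exact mem_iUnion.mpr ⟨n, subset_closure (S.N_mono hn hC)⟩)
  rw [mem_interior_iff_mem_nhds, Metric.mem_nhds_iff] at hn
  obtain ⟨r0, hr0, hball⟩ := hn
  set C : ℝ := 2 * n
  have hN0 : ∀ t ∈ S.Gsᶜ, |t - p| < r0 → t ∈ S.N C := by
    intro t ht htp
    have : (⟨t, ht⟩ : (S.Gsᶜ : Set ℝ)) ∈ Metric.ball (⟨p, hp⟩ : (S.Gsᶜ : Set ℝ)) r0 := by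
      rw [Metric.mem_ball, Subtype.dist_eq, Real.dist_eq]; exact htp
    exact S.N_closure (hball this)
  obtain ⟨B, hB, hO⟩ : ∃ B, 1 + 4 * a ^ 2 + 4 * b ^ 2 ≤ B ∧ ∀ τ ∈ Icc (p - 1) (p + 1), 1 ≤ B * S.Om τ := by
    have hc : ContinuousOn (fun t => (S.Om t)⁻¹) (Icc (p - 1) (p + 1)) := fun t _ => 
      ((S.hOm t).continuousAt.inv₀ (S.Om_pos t).ne').continuousWithinAt
    obtain ⟨M, hM⟩ := isCompact_Icc.bddAbove_image hc
    refine ⟨max M (1 + 4 * a ^ 2 + 4 * b ^ 2), le_max_right _ _, fun τ hτ => ?_⟩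
    have h1 : (S.Om τ)⁻¹ ≤ max M (1 + 4 * a ^ 2 + 4 * b ^ 2) := (hM (mem_image_of_mem _ hτ)).trans (le_max_left _ _)
    rw [inv_le_iff_one_le_mul₀ (S.Om_pos τ)] at h1
    exact h1
  obtain ⟨C1, hC1⟩ := S.right_claim B C hB
  obtain ⟨C2, hC2⟩ := S.left_claim B C hB
  set r := min (r0 / 2) 1
  have hr : 0 < r := lt_min (by positivity) one_pos
  have hr1 : r ≤ 1 := min_le_right _ _
  have hr2 : r < r0 := lt_of_le_of_lt (min_le_left _ _) (by linarith)
  apply hp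
  refine ⟨r, hr, max C (max C1 C2), fun t ht => ?_⟩
  show t ∈ S.N (max C (max C1 C2))
  by_cases htB : t ∈ S.Gsᶜ
  · refine S.N_mono (le_max_left _ _) (hN0 t htB ?_)
    rw [abs_lt]; exact ⟨by linarith [ht.1], by linarith [ht.2]⟩
  rcases le_total p t with hpt | hpt
  · have hcomp : IsCompact (S.Gsᶜ ∩ Icc p t) := isCompact_Icc.inter_left hBc
    obtain ⟨α, hα, hmax⟩ := hcomp.exists_isGreatest ⟨p, hp, le_rfl, hpt⟩
    refine S.N_mono ((le_max_left _ _).trans (le_max_right _ _)) (hC1 α t hα.2.2 (by linarith [hα.2.1, ht.2]) (fun τ hτ => hO τ ⟨?_, ?_⟩) (hN0 α hα.1 ?_) ?_)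
    · linarith [hα.2.1, hτ.1]
    · linarith [hτ.2, ht.2]
    · rw [abs_lt]; exact ⟨by linarith [hα.2.1], by linarith [ht.2, hα.2.2]⟩
    · intro y hy
      by_contra hyG
      exact absurd (hmax ⟨hyG, hα.2.1.trans hy.1.le, hy.2⟩) (not_le.mpr hy.1)
  · have hcomp : IsCompact (S.Gsᶜ ∩ Icc t p) := isCompact_Icc.inter_left hBc
    obtain ⟨α, hα, hmin⟩ := hcomp.exists_isLeast ⟨p, hp, hpt, le_rfl⟩
    refine S.N_mono ((le_max_right _ _).trans (le_max_right _ _)) (hC2 α t hα.2.1 (by linarith [hα.2.2, ht.1]) (fun τ hτ => hO τ ⟨?_, ?_⟩) (hN0 α hα.1 ?_) ?_)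
    · linarith [ht.1, hτ.1]
    · linarith [hτ.2, hα.2.2]
    · rw [abs_lt]; exact ⟨by linarith [hα.2.1, ht.1], by linarith [hα.2.2]⟩
    · intro y hy
      by_contra hyG
      exact absurd (hmin ⟨hyG, hy.1, hy.2.le.trans hα.2.2⟩) (not_le.mpr hy.2)

lemma H_deriv (t : ℝ) : HasDerivAt S.H 0 t := by
  have ht : t ∈ S.Gs := by rw [S.Gs_univ]; trivial
  obtain ⟨ε, hε, C, hC⟩ := ht
  have : S.H =ᶠ[𝓝 t] fun _ => S.H (t - ε) := by
    filter_upwards [Icc_mem_nhds (by linarith : t - ε < t) (by linarith : t < t + ε)] with τ hτ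
    exact S.H_const hτ.1 (hC.mono (Icc_subset_Icc_right hτ.2))
  exact (hasDerivAt_const t _).congr_of_eventuallyEq this

end Sol
end HL


open Complex MeasureTheory Filter

/-- for a solution of NLS on the half-line with the time-dependent boundary
condition `iu_t - 2u_x√(4b² - |u|²) - 4(a² + b²)u + 2u|u|² = 0` at `x = 0` and decay as
`x → +∞`, the third modified conserved quantity
`I₃ = (i/4)∫₀^∞ (|u|⁴ - |u_x|²) dx + [(i/6)|u(0,t)|² - i(a² - b²/3)]√(4b² - |u(0,t)|²)`
is conserved: `dI₃/dt = 0`. -/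
theorem stmt_19 (a b : ℝ) (u ut ux uxx : ℝ → ℝ → ℂ)
    (hut : ∀ x t, HasDerivAt (fun s => u x s) (ut x t) t)
    (hux : ∀ x t, HasDerivAt (fun y => u y t) (ux x t) x)
    (huxx : ∀ x t, HasDerivAt (fun y => ux y t) (uxx x t) x)
    (hbound : ∀ t, Complex.normSq (u 0 t) < 4 * b ^ 2)
    -- NLS on the half-line
    (hNLS : ∀ t : ℝ, ∀ x : ℝ, 0 ≤ x →
      Complex.I * ut x t + uxx x t + 2 * u x t * (Complex.normSq (u x t) : ℂ) = 0)
    -- the time-dependent boundary condition at x = 0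
    (hbc : ∀ t : ℝ,
      Complex.I * ut 0 t
        - 2 * ux 0 t * ((Real.sqrt (4 * b ^ 2 - Complex.normSq (u 0 t)) : ℝ) : ℂ)
        - 4 * ((a : ℂ) ^ 2 + (b : ℂ) ^ 2) * u 0 t
        + 2 * u 0 t * (Complex.normSq (u 0 t) : ℂ) = 0)
    -- decay of u and its derivatives as x → +∞
    (hint : ∀ t, IntegrableOn (fun x => (Complex.normSq (u x t)) ^ 2) (Set.Ioi 0))
    (hint' : ∀ t, IntegrableOn (fun x => Complex.normSq (ux x t)) (Set.Ioi 0))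
    (hint'' : ∀ t, IntegrableOn (fun x => Complex.normSq (uxx x t)) (Set.Ioi 0))
    (hdecay : ∀ t, Tendsto (fun x => u x t) atTop (nhds 0))
    (hdecay' : ∀ t, Tendsto (fun x => ux x t) atTop (nhds 0))
    (hdecay'' : ∀ t, Tendsto (fun x => uxx x t) atTop (nhds 0)) :
    ∀ t : ℝ,
      deriv (fun s =>
        (Complex.I / 4) * (∫ x in Set.Ioi (0 : ℝ),
            (((Complex.normSq (u x s)) ^ 2 - Complex.normSq (ux x s) : ℝ) : ℂ))
          + ((Complex.I / 6) * (Complex.normSq (u 0 s) : ℂ)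
              - Complex.I * ((a ^ 2 - b ^ 2 / 3 : ℝ) : ℂ))
            * ((Real.sqrt (4 * b ^ 2 - Complex.normSq (u 0 s)) : ℝ) : ℂ)) t = 0 := by
  have nsq : ∀ z : ℂ, Complex.normSq z = z.re ^ 2 + z.im ^ 2 := fun z => by
    rw [Complex.normSq_apply]; ring
  have dre : ∀ (f : ℝ → ℂ) (f' : ℂ) (x : ℝ), HasDerivAt f f' x →
      HasDerivAt (fun y => (f y).re) f'.re x := fun f f' x h =>
    Complex.reCLM.hasFDerivAt.comp_hasDerivAt x h
  have dim : ∀ (f : ℝ → ℂ) (f' : ℂ) (x : ℝ), HasDerivAt f f' x →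
      HasDerivAt (fun y => (f y).im) f'.im x := fun f f' x h =>
    Complex.imCLM.hasFDerivAt.comp_hasDerivAt x h
  have tre : ∀ (f : ℝ → ℂ), Tendsto f atTop (nhds 0) →
      Tendsto (fun y => (f y).re) atTop (nhds 0) := fun f h => by
    have := (Complex.continuous_re.tendsto 0).comp h
    simpa [Function.comp_def] using this
  have tim : ∀ (f : ℝ → ℂ), Tendsto f atTop (nhds 0) →
      Tendsto (fun y => (f y).im) atTop (nhds 0) := fun f h => by
    have := (Complex.continuous_im.tendsto 0).comp h
    simpa [Function.comp_def] using this
  have ab : ((a : ℂ) ^ 2 + (b : ℂ) ^ 2) = ((a ^ 2 + b ^ 2 : ℝ) : ℂ) := by push_cast; ring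
  simp only [nsq] at hbound hNLS hbc hint hint' hint''
  simp only [ab] at hbc
  let S : HL.Sol a b :=
    { p := fun x t => (u x t).re
      q := fun x t => (u x t).im
      pt := fun x t => (ut x t).re
      qt := fun x t => (ut x t).im
      px := fun x t => (ux x t).re
      qx := fun x t => (ux x t).im
      pxx := fun x t => (uxx x t).re
      qxx := fun x t => (uxx x t).im
      hpt := fun x t => dre _ _ _ (hut x t)
      hqt := fun x t => dim _ _ _ (hut x t)
      hpx := fun t x => dre _ _ _ (hux x t)
      hqx := fun t x => dim _ _ _ (hux x t)
      hpxx := fun t x => dre _ _ _ (huxx x t)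
      hqxx := fun t x => dim _ _ _ (huxx x t)
      hb := hbound
      eq1 := fun t x hx => by
        have h := congrArg Complex.im (hNLS t x hx)
        simp only [Complex.add_im, Complex.mul_im, Complex.mul_re, Complex.I_re, Complex.I_im,
          Complex.ofReal_re, Complex.ofReal_im, Complex.re_ofNat, Complex.im_ofNat,
          Complex.zero_im] at h
        linarith
      eq2 := fun t x hx => by
        have h := congrArg Complex.re (hNLS t x hx)
        simp only [Complex.add_re, Complex.mul_im, Complex.mul_re, Complex.I_re, Complex.I_im,
          Complex.ofReal_re, Complex.ofReal_im, Complex.re_ofNat, Complex.im_ofNat,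
          Complex.zero_re] at h
        linarith
      bc1 := fun t => by
        have h := congrArg Complex.re (hbc t)
        simp only [Complex.add_re, Complex.sub_re, Complex.mul_im, Complex.mul_re, Complex.I_re,
          Complex.I_im, Complex.ofReal_re, Complex.ofReal_im, Complex.re_ofNat, Complex.im_ofNat,
          Complex.zero_re] at h
        linarith
      bc2 := fun t => by
        have h := congrArg Complex.im (hbc t)
        simp only [Complex.add_im, Complex.sub_im, Complex.mul_im, Complex.mul_re, Complex.I_re,
          Complex.I_im, Complex.ofReal_re, Complex.ofReal_im, Complex.re_ofNat, Complex.im_ofNat,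
          Complex.zero_im] at h
        linarith
      hi0 := hint
      hi1 := hint'
      hi2 := hint''
      dp := fun t => tre _ (hdecay t)
      dq := fun t => tim _ (hdecay t)
      dpx := fun t => tre _ (hdecay' t)
      dqx := fun t => tim _ (hdecay' t) }
  intro t
  have key : (fun s =>
        (Complex.I / 4) * (∫ x in Set.Ioi (0 : ℝ),
            (((Complex.normSq (u x s)) ^ 2 - Complex.normSq (ux x s) : ℝ) : ℂ))
          + ((Complex.I / 6) * (Complex.normSq (u 0 s) : ℂ)
              - Complex.I * ((a ^ 2 - b ^ 2 / 3 : ℝ) : ℂ))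
            * ((Real.sqrt (4 * b ^ 2 - Complex.normSq (u 0 s)) : ℝ) : ℂ))
      = fun s => (Complex.I / 4) * ((S.H s : ℝ) : ℂ) := by
    funext s
    have hI : (∫ x in Set.Ioi (0 : ℝ),
        (((Complex.normSq (u x s)) ^ 2 - Complex.normSq (ux x s) : ℝ) : ℂ))
        = ((S.P s - S.K s : ℝ) : ℂ) := by
      rw [integral_complex_ofReal]
      congr 1
      simp only [nsq]
      exact integral_sub (S.hi0 s) (S.hi1 s)
    have hO : Real.sqrt (4 * b ^ 2 - Complex.normSq (u 0 s)) = S.Om s := by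
      rw [nsq]; rfl
    have hn : Complex.normSq (u 0 s) = S.p 0 s ^ 2 + S.q 0 s ^ 2 := nsq _
    rw [hI, hO, hn]
    unfold HL.Sol.H HL.Sol.G
    push_cast
    ring
  rw [key]
  have h := ((S.H_deriv t).ofReal_comp.const_mul (Complex.I / 4)).deriv
  rw [h]
  simp
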